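/- For every integer n ≥ 7, the inequality N2(0,10,n) + N2(3,10,n) > N2(2,10,n) + N2(5,10,n) holds. -/

import Mathlib

open scoped Classical

/-- The M2-rank of a partition: ⌈ℓ/2⌉ − s, where ℓ is the largest part
(0 for the empty partition) and s is the number of parts. -/
def m2Rank {n : ℕ} (P : n.Partition) : ℤ :=
  (((P.parts.sup + 1) / 2 : ℕ) : ℤ) - (Multiset.card P.parts : ℤ)

/-- A partition has no repeated odd parts. -/
def NoRepeatedOddParts {n : ℕ} (P : n.Partition) : Prop :=
  ∀ j : ℕ, Odd j → P.parts.count j ≤ 1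

/-- `N2 r m n` is the number of partitions of `n` without repeated odd parts whose
M2-rank is congruent to `r` modulo `m`. -/
noncomputable def N2 (r : ℤ) (m n : ℕ) : ℕ :=
  Nat.card {P : n.Partition // NoRepeatedOddParts P ∧ m2Rank P ≡ r [ZMOD (m : ℤ)]}

/-- multisets of positive integers without repeated odd elements -/
def NRm (X : Multiset ℕ) : Prop := (∀ x ∈ X, 0 < x) ∧ ∀ j, Odd j → X.count j ≤ 1

/-- rank of a multiset -/
def rkm (X : Multiset ℕ) : ℤ := (((X.sup + 1) / 2 : ℕ) : ℤ) - (Multiset.card X : ℤ)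

def dysNew (m : ℤ) (X : Multiset ℕ) : ℕ :=
  (2 * ((Multiset.card X : ℤ) + m) + (if X.count 1 = 0 then 1 else 0)).toNat

def dysY (X : Multiset ℕ) : Multiset ℕ := (X.filter (2 < ·)).map (· - 2)

def dysF (m : ℤ) (X : Multiset ℕ) : Multiset ℕ :=
  if dysNew m X = 0 then 0 else dysNew m X ::ₘ dysY X

def dysB (m : ℤ) (Z : Multiset ℕ) : Multiset ℕ :=
  (Z.erase Z.sup).map (· + 2) +
   (if Z.sup % 2 = 0 then
      1 ::ₘ Multiset.replicate (((Z.sup / 2 : ℕ) : ℤ) - m - 1 - Multiset.card (Z.erase Z.sup)).toNat 2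
    else Multiset.replicate (((Z.sup / 2 : ℕ) : ℤ) - m - Multiset.card (Z.erase Z.sup)).toNat 2)

theorem NRm.decomp {X : Multiset ℕ} (h : NRm X) :
    X = (dysY X).map (· + 2) + Multiset.replicate (X.count 1) 1
      + Multiset.replicate (X.count 2) 2 := by
  have h1 : (dysY X).map (· + 2) = X.filter (2 < ·) := by
    unfold dysY
    rw [Multiset.map_map]
    conv_rhs => rw [← Multiset.map_id (X.filter (2 < ·))]
    apply Multiset.map_congr rfl
    intro x hx
    have := (Multiset.mem_filter.1 hx).2
    simp only [Function.comp, id]; omega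
  rw [h1]
  ext a
  simp only [Multiset.count_add, Multiset.count_filter, Multiset.count_replicate]
  have h0 : X.count 0 = 0 := by
    rw [Multiset.count_eq_zero]; intro h'; exact absurd (h.1 0 h') (by omega)
  rcases lt_trichotomy a 2 with ha | ha | ha
  · interval_cases a <;> simp [h0]
  · subst ha; simp
  · have h1 : ¬ (1 = a) := by omega
    have h2 : ¬ (2 = a) := by omega
    simp [ha, h1, h2]

theorem dysY_count (X : Multiset ℕ) (j : ℕ) (hj : 0 < j) : (dysY X).count j = X.count (j + 2) := by
  have h2 : (dysY X).count j = ((dysY X).map (· + 2)).count (j+2) := by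
    exact (Multiset.count_map_eq_count' (fun x : ℕ => x + 2) _ (fun a b h => by simpa using h) j).symm
  rw [h2]
  unfold dysY
  rw [Multiset.map_map]
  have : Multiset.map ((· + 2) ∘ (· - 2)) (X.filter (2 < ·)) = X.filter (2 < ·) := by
    conv_rhs => rw [← Multiset.map_id (X.filter (2 < ·))]
    apply Multiset.map_congr rfl
    intro x hx
    have := (Multiset.mem_filter.1 hx).2
    simp only [Function.comp, id]; omega
  rw [this, Multiset.count_filter, if_pos (by omega)]

theorem dysY_mem {X : Multiset ℕ} {y : ℕ} (h : y ∈ dysY X) : 0 < y ∧ y + 2 ∈ X := by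
  unfold dysY at h
  obtain ⟨x, hx, rfl⟩ := Multiset.mem_map.1 h
  obtain ⟨h1, h2⟩ := Multiset.mem_filter.1 hx
  refine ⟨by omega, ?_⟩
  rwa [Nat.sub_add_cancel (by omega)]

theorem le_msup {X : Multiset ℕ} {x : ℕ} (h : x ∈ X) : x ≤ X.sup := Multiset.le_sup h

theorem NRm.card_eq {X : Multiset ℕ} (h : NRm X) :
    Multiset.card X = Multiset.card (dysY X) + X.count 1 + X.count 2 := by
  have := congrArg Multiset.card h.decomp
  simpa using this

theorem NRm.sum_eq {X : Multiset ℕ} (h : NRm X) :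
    X.sum = (dysY X).sum + 2 * Multiset.card (dysY X) + X.count 1 + 2 * X.count 2 := by
  have := congrArg Multiset.sum h.decomp
  simp only [Multiset.sum_add, Multiset.sum_replicate, Multiset.sum_map_add, Multiset.map_id',
    Multiset.map_const', smul_eq_mul] at this
  omega

theorem msup_empty_of_zero {X : Multiset ℕ} (h : NRm X) (h0 : X.sup = 0) : X = 0 := by
  apply Multiset.eq_zero_of_forall_notMem
  intro a ha
  have := le_msup ha
  have := h.1 a ha
  omega

theorem NRm.sup_pos {X : Multiset ℕ} (h : NRm X) (h0 : X ≠ 0) : 0 < X.sup := by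
  by_contra hc
  exact h0 (msup_empty_of_zero h (by omega))

/-- facts on the forward map -/
theorem dysNew_facts {m : ℤ} (hm : m ≠ -1) {X : Multiset ℕ} (h : NRm X) (hr : rkm X ≤ m + 1) :
    ((dysNew m X : ℕ) : ℤ) = 2 * ((Multiset.card X : ℤ) + m) + (if X.count 1 = 0 then 1 else 0)
    ∧ (∀ y ∈ dysY X, y ≤ dysNew m X) ∧ (X.count 1 = 0 → dysNew m X ∉ dysY X) := by
  unfold rkm at hr
  have hc1 : X.count 1 ≤ 1 := h.2 1 (by decide)
  have hcard := h.card_eq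
  have e : ((dysNew m X : ℕ) : ℤ)
      = 2 * ((Multiset.card X : ℤ) + m) + (if X.count 1 = 0 then 1 else 0) := by
    unfold dysNew
    rw [Int.toNat_of_nonneg]
    by_cases hX : X = 0
    · subst hX; simp at hr ⊢; omega
    · have := h.sup_pos hX
      split_ifs <;> omega
  refine ⟨e, ?_, ?_⟩
  · intro y hy
    have h1 := le_msup (dysY_mem hy).2
    split_ifs at e <;> omega
  · intro h0 hy
    have h1 := le_msup (dysY_mem hy).2
    rw [if_pos h0] at e
    omega

theorem dysY_zero_of_new {m : ℤ} (hm : m ≠ -1) {X : Multiset ℕ} (h : NRm X) (hr : rkm X ≤ m + 1)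
    (h0 : dysNew m X = 0) : dysY X = 0 := by
  obtain ⟨e, h1, _⟩ := dysNew_facts hm h hr
  apply Multiset.eq_zero_of_forall_notMem
  intro a ha
  have := h1 a ha
  have := (dysY_mem ha).1
  omega

theorem msup_cons_eq {a : ℕ} {Y : Multiset ℕ} (h : ∀ y ∈ Y, y ≤ a) : (a ::ₘ Y).sup = a := by
  rw [Multiset.sup_cons]
  exact sup_eq_left.2 (Multiset.sup_le.2 h)

theorem dysF_facts {m : ℤ} (hm : m ≠ -1) {X : Multiset ℕ} (h : NRm X) (hr : rkm X ≤ m + 1) :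
    NRm (dysF m X) ∧ ((dysF m X).sum : ℤ) = X.sum + 2 * m + 1 ∧ m ≤ rkm (dysF m X)
    ∧ dysB m (dysF m X) = X := by
  obtain ⟨e, h1, h2⟩ := dysNew_facts hm h hr
  have hz := dysY_zero_of_new hm h hr
  have hc1 : X.count 1 ≤ 1 := h.2 1 (by decide)
  have hcard := h.card_eq
  have hsum := h.sum_eq
  have hdec := h.decomp
  have hsup : (dysF m X).sup = dysNew m X := by
    unfold dysF
    split_ifs with h0
    · simp [h0]
    · exact msup_cons_eq h1
  have her : (dysF m X).erase (dysNew m X) = dysY X := by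
    unfold dysF
    split_ifs with h0
    · simp [hz h0]
    · simp
  refine ⟨⟨?_, ?_⟩, ?_, ?_, ?_⟩
  · intro x hx
    unfold dysF at hx
    split_ifs at hx with h0
    · simp at hx
    · rcases Multiset.mem_cons.1 hx with rfl | hx
      · omega
      · exact (dysY_mem hx).1
  · intro j hj
    have hj0 : 0 < j := hj.pos
    unfold dysF
    split_ifs with h0
    · simp
    · rw [Multiset.count_cons, dysY_count _ _ hj0]
      have h3 : X.count (j + 2) ≤ 1 := h.2 _ (by rw [Nat.odd_add]; simp [hj])
      split_ifs with h4
      · subst h4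
        have h5 : X.count 1 = 0 := by
          by_contra hne
          rw [if_neg hne] at e
          rcases hj with ⟨k, hk⟩
          omega
        have := h2 h5
        rw [← dysY_count _ _ hj0, Multiset.count_eq_zero.2 this]
      · omega
  · unfold dysF
    split_ifs with h0
    · have := hz h0
      rw [this] at hcard hsum
      rw [Multiset.card_zero] at hcard hsum
      rw [Multiset.sum_zero] at hsum ⊢
      split_ifs at e <;> omega
    · rw [Multiset.sum_cons]
      split_ifs at e <;> omega
  · unfold rkm
    rw [hsup]
    unfold dysF
    split_ifs with h0
    · have := hz h0
      rw [this] at hcard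
      simp at hcard
      simp [h0]
      split_ifs at e <;> omega
    · rw [Multiset.card_cons]
      split_ifs at e <;> omega
  · unfold dysB
    rw [hsup, her]
    conv_rhs => rw [hdec]
    rw [add_assoc]
    congr 1
    by_cases h5 : X.count 1 = 0
    · rw [if_pos h5] at e
      rw [if_neg (by omega), h5]
      simp only [Multiset.replicate_zero, zero_add]
      congr 1
      omega
    · rw [if_neg h5] at e
      have h6 : X.count 1 = 1 := by omega
      rw [if_pos (by omega), h6]
      rw [Multiset.replicate_one, Multiset.singleton_add]
      congr 2
      omega

theorem dysB_facts {m : ℤ} (hm : m ≠ -1) {Z : Multiset ℕ} (h : NRm Z) (hr : m ≤ rkm Z)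
    (hs : Z = 0 → m < 0) :
    NRm (dysB m Z) ∧ rkm (dysB m Z) ≤ m + 1 ∧ dysF m (dysB m Z) = Z := by
  set L := Z.sup with hL
  set Y := Z.erase L with hY
  have hYL : ∀ y ∈ Y, 0 < y ∧ y ≤ L ∧ (L % 2 = 1 → y < L) := by
    intro y hy
    have hyZ := Multiset.mem_of_mem_erase hy
    refine ⟨h.1 y hyZ, le_msup hyZ, ?_⟩
    intro hodd
    have hle := le_msup hyZ
    rcases hle.lt_or_eq with h1 | h1
    · exact h1
    · exfalso
      have h2 := h.2 L (Nat.odd_iff.2 hodd)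
      have h3 : 0 < Y.count L := by rw [Multiset.count_pos]; rw [← hL] at h1; rwa [← h1]
      rw [hY, Multiset.count_erase_self] at h3
      omega
  have hYodd : ∀ j, Odd j → Y.count j ≤ 1 := fun j hj =>
    (Multiset.count_le_of_le j (Multiset.erase_le L Z)).trans (h.2 j hj)
  have hZ : Z ≠ 0 → Z = L ::ₘ Y := by
    intro hne
    have : L ∈ Z := by
      obtain ⟨b, hb⟩ := Multiset.exists_mem_of_ne_zero hne
      have : ∃ x ∈ Z, x = Z.sup := by
        by_contra hcon
        push Not at hcon
        have h0 := h.sup_pos hne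
        have : Z.sup ≤ Z.sup - 1 := Multiset.sup_le.2 (fun x hx => by
          have := le_msup hx
          have := hcon x hx
          omega)
        omega
      obtain ⟨x, hx, hx2⟩ := this
      rw [hL, ← hx2]; exact hx
    exact (Multiset.cons_erase this).symm
  have hbal : (L % 2 = 0 → (Multiset.card Y : ℤ) + 1 ≤ ((L / 2 : ℕ) : ℤ) - m)
      ∧ (L % 2 = 1 → (Multiset.card Y : ℤ) ≤ ((L / 2 : ℕ) : ℤ) - m) := by
    unfold rkm at hr
    by_cases hne : Z = 0
    · have hm0 := hs hne
      have : L = 0 := by rw [hL, hne]; simp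
      have hY0 : Y = 0 := by rw [hY, hne]; simp
      rw [hY0, this]; simp; omega
    · have h1 := congrArg Multiset.card (hZ hne)
      rw [Multiset.card_cons] at h1
      rw [h1, ← hL] at hr
      constructor <;> intro _ <;> omega
  obtain ⟨R, hR, hBR⟩ : ∃ R, dysB m Z = Y.map (· + 2) +
      (Multiset.replicate (if L % 2 = 0 then 1 else 0) 1 + Multiset.replicate R 2)
      ∧ (R : ℤ) = ((L / 2 : ℕ) : ℤ) - m - Multiset.card Y - (if L % 2 = 0 then 1 else 0) := by
    by_cases h0 : L % 2 = 0
    · refine ⟨(((L / 2 : ℕ) : ℤ) - m - 1 - Multiset.card Y).toNat, ?_, ?_⟩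
      · unfold dysB
        rw [← hL, ← hY, if_pos h0, if_pos h0]
        simp
      · have := hbal.1 h0
        rw [if_pos h0]; omega
    · refine ⟨(((L / 2 : ℕ) : ℤ) - m - Multiset.card Y).toNat, ?_, ?_⟩
      · unfold dysB
        rw [← hL, ← hY, if_neg h0, if_neg h0]
        simp
      · have := hbal.2 (by omega)
        rw [if_neg h0]; omega
  have hcardB : (Multiset.card (dysB m Z) : ℤ) = ((L / 2 : ℕ) : ℤ) - m := by
    rw [hR]; simp only [Multiset.card_add, Multiset.card_map, Multiset.card_replicate]
    push_cast
    rw [hBR]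
    split_ifs <;> push_cast <;> ring
  have hcount1 : (dysB m Z).count 1 = if L % 2 = 0 then 1 else 0 := by
    rw [hR]
    simp only [Multiset.count_add, Multiset.count_replicate]
    have : (Y.map (· + 2)).count 1 = 0 := by
      rw [Multiset.count_eq_zero]; simp
    rw [this]; simp
  have hBmem : ∀ x ∈ dysB m Z, (∃ y ∈ Y, x = y + 2) ∨ x = 1 ∨ x = 2 := by
    intro x hx
    rw [hR] at hx
    simp only [Multiset.mem_add, Multiset.mem_map] at hx
    rcases hx with ⟨y, hy, rfl⟩ | hx | hx
    · exact Or.inl ⟨y, hy, rfl⟩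
    · exact Or.inr (Or.inl (Multiset.eq_of_mem_replicate hx))
    · exact Or.inr (Or.inr (Multiset.eq_of_mem_replicate hx))
  have hNR : NRm (dysB m Z) := by
    refine ⟨?_, ?_⟩
    · intro x hx
      rcases hBmem x hx with ⟨y, _, rfl⟩ | rfl | rfl <;> omega
    · intro j hj
      by_cases hj1 : j = 1
      · subst hj1; rw [hcount1]; split_ifs <;> omega
      · have hj3 : 2 < j := by
          rcases hj with ⟨k, hk⟩; omega
        obtain ⟨i, rfl⟩ : ∃ i, j = i + 2 := ⟨j - 2, by omega⟩
        rw [hR]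
        simp only [Multiset.count_add, Multiset.count_replicate]
        have hcm := Multiset.count_map_eq_count' (fun x : ℕ => x + 2) Y
          (fun a b h => by simpa using h) i
        rw [if_neg (by omega), if_neg (by omega), hcm]
        have := hYodd i (by rw [Nat.odd_add] at hj; simpa using hj)
        omega
  refine ⟨hNR, ?_, ?_⟩
  · unfold rkm
    rw [hcardB]
    have : (dysB m Z).sup ≤ 2 * (L / 2) + 2 := by
      apply Multiset.sup_le.2
      intro x hx
      rcases hBmem x hx with ⟨y, hy, rfl⟩ | rfl | rfl
      · obtain ⟨h1, h2, h3⟩ := hYL y hy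
        omega
      · omega
      · omega
    omega
  · have hYB : dysY (dysB m Z) = Y := by
      unfold dysY
      rw [hR]
      rw [Multiset.filter_add, Multiset.filter_add]
      have e1 : (Y.map (· + 2)).filter (2 < ·) = Y.map (· + 2) := by
        rw [Multiset.filter_eq_self]
        intro x hx
        obtain ⟨y, hy, rfl⟩ := Multiset.mem_map.1 hx
        have := (hYL y hy).1
        omega
      have e2 : ∀ k, (Multiset.replicate k 1).filter (2 < ·) = 0 := by
        intro k; rw [Multiset.filter_eq_nil]; intro x hx
        rw [Multiset.eq_of_mem_replicate hx]; omega
      have e3 : ∀ k, (Multiset.replicate k 2).filter (2 < ·) = 0 := by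
        intro k; rw [Multiset.filter_eq_nil]; intro x hx
        rw [Multiset.eq_of_mem_replicate hx]; omega
      rw [e1, e2, e3]
      simp
    have hnew : dysNew m (dysB m Z) = L := by
      unfold dysNew
      rw [hcardB, hcount1]
      by_cases h0 : L % 2 = 0
      · simp [h0]; omega
      · simp [h0]; omega
    unfold dysF
    rw [hnew, hYB]
    split_ifs with h0
    · exact (msup_empty_of_zero h h0).symm
    · refine (hZ ?_).symm
      rintro hz
      apply h0; rw [hL, hz]; simp

/-- the finset of partitions without repeated odd parts -/
noncomputable def nrp (n : ℕ) : Finset n.Partition := Finset.univ.filter NoRepeatedOddParts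

noncomputable def nrH (m : ℤ) (n : ℕ) : ℕ := ((nrp n).filter (fun P => m ≤ m2Rank P)).card
noncomputable def nrL (m : ℤ) (n : ℕ) : ℕ := ((nrp n).filter (fun P => m2Rank P ≤ m)).card
noncomputable def nrP (n : ℕ) : ℕ := (nrp n).card

theorem nrp_NRm {n : ℕ} {P : n.Partition} (h : P ∈ nrp n) : NRm P.parts :=
  ⟨fun _ hx => P.parts_pos hx, (Finset.mem_filter.1 h).2⟩

theorem nrL_add_nrH (m : ℤ) (n : ℕ) : nrL m n + nrH (m + 1) n = nrP n := by
  unfold nrL nrH nrP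
  rw [← Finset.card_filter_add_card_filter_not (s := nrp n) (fun P => m2Rank P ≤ m)]
  congr 2
  apply Finset.filter_congr
  intro P _
  push Not
  exact Int.add_one_le_iff

theorem dys_card {m : ℤ} (hm : m ≠ -1) {N N' : ℕ} (h : (N : ℤ) = N' + 2 * m + 1) :
    nrL (m + 1) N' = nrH m N := by
  unfold nrL nrH
  refine Finset.card_bij'
    (i := fun P hP => (⟨dysF m P.parts, ?_, ?_⟩ : N.Partition))
    (j := fun Q hQ => (⟨dysB m Q.parts, ?_, ?_⟩ : N'.Partition)) ?_ ?_ ?_ ?_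
  · intro i hi
    exact (dysF_facts hm (nrp_NRm (Finset.mem_filter.1 hP).1) (Finset.mem_filter.1 hP).2).1.1 i hi
  · have h1 := (dysF_facts hm (nrp_NRm (Finset.mem_filter.1 hP).1) (Finset.mem_filter.1 hP).2).2.1
    rw [P.parts_sum] at h1
    omega
  · intro i hi
    refine (dysB_facts hm (nrp_NRm (Finset.mem_filter.1 hQ).1) (Finset.mem_filter.1 hQ).2 ?_).1.1 i hi
    intro h0
    have := Q.parts_sum
    rw [h0, Multiset.sum_zero] at this
    omega
  · obtain ⟨h1, h2, h3⟩ := dysB_facts hm (nrp_NRm (Finset.mem_filter.1 hQ).1)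
      (Finset.mem_filter.1 hQ).2 (by
        intro h0
        have := Q.parts_sum
        rw [h0, Multiset.sum_zero] at this
        omega)
    have h4 := (dysF_facts hm h1 h2).2.1
    rw [h3, Q.parts_sum] at h4
    omega
  · intro P hP
    obtain ⟨h1, h2, h3, h4⟩ := dysF_facts hm (nrp_NRm (Finset.mem_filter.1 hP).1)
      (Finset.mem_filter.1 hP).2
    refine Finset.mem_filter.2 ⟨Finset.mem_filter.2 ⟨Finset.mem_univ _, h1.2⟩, h3⟩
  · intro Q hQ
    obtain ⟨h1, h2, h3⟩ := dysB_facts hm (nrp_NRm (Finset.mem_filter.1 hQ).1)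
      (Finset.mem_filter.1 hQ).2 (by
        intro h0
        have := Q.parts_sum
        rw [h0, Multiset.sum_zero] at this
        omega)
    refine Finset.mem_filter.2 ⟨Finset.mem_filter.2 ⟨Finset.mem_univ _, h1.2⟩, h2⟩
  · intro P hP
    obtain ⟨h1, h2, h3, h4⟩ := dysF_facts hm (nrp_NRm (Finset.mem_filter.1 hP).1)
      (Finset.mem_filter.1 hP).2
    exact Nat.Partition.ext h4
  · intro Q hQ
    obtain ⟨h1, h2, h3⟩ := dysB_facts hm (nrp_NRm (Finset.mem_filter.1 hQ).1)
      (Finset.mem_filter.1 hQ).2 (by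
        intro h0
        have := Q.parts_sum
        rw [h0, Multiset.sum_zero] at this
        omega)
    exact Nat.Partition.ext h3

theorem nrH_small {m : ℤ} (hm : 0 ≤ m) {N : ℕ} (hN : 0 < N) (h : (N : ℤ) < 2 * m + 1) :
    nrH m N = 0 := by
  unfold nrH
  rw [Finset.card_eq_zero, Finset.filter_eq_empty_iff]
  intro Q hQ hr
  obtain ⟨h1, h2, h3⟩ := dysB_facts (by omega) (nrp_NRm hQ) hr (by
        intro h0
        have := Q.parts_sum
        rw [h0, Multiset.sum_zero] at this
        omega)
  have h4 := (dysF_facts (by omega) h1 h2).2.1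
  rw [h3, Q.parts_sum] at h4
  omega

theorem nrL_small {j : ℤ} (hj : 1 ≤ j) {N : ℕ} (h : (N : ℤ) < 2 * j + 1) :
    nrL (-j) N = 0 := by
  unfold nrL
  rw [Finset.card_eq_zero, Finset.filter_eq_empty_iff]
  intro Q hQ hr
  have h4 := (dysF_facts (m := -j-1) (by omega) (nrp_NRm hQ) (by unfold rkm; unfold m2Rank at hr; omega)).2.1
  rw [Q.parts_sum] at h4
  omega

theorem nrH_zero_of_pos {m : ℤ} (hm : 0 < m) : nrH m 0 = 0 := by
  unfold nrH
  rw [Finset.card_eq_zero, Finset.filter_eq_empty_iff]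
  intro Q hQ hr
  have : Q.parts = 0 := by
    apply Multiset.eq_zero_of_forall_notMem
    intro a ha
    have h1 := Multiset.le_sum_of_mem ha
    have := Q.parts_pos ha
    rw [Q.parts_sum] at h1
    omega
  unfold m2Rank at hr
  rw [this] at hr
  simp at hr
  omega

theorem nrH_rec {j : ℕ} (hj : 1 ≤ j) (n : ℕ) :
    (nrH j n : ℤ) = if n < 2 * j + 1 then (0:ℤ) else (nrP (n - (2 * j + 1)) : ℤ) - (nrH (j + 2 : ℕ) (n - (2 * j + 1)) : ℤ) := by
  split_ifs with h
  · rcases Nat.eq_zero_or_pos n with rfl | h0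
    · rw [nrH_zero_of_pos (by omega)]; rfl
    · rw [nrH_small (by omega) h0 (by omega)]; rfl
  · have h1 := dys_card (m := j) (by omega) (N := n) (N' := n - (2 * j + 1)) (by omega)
    have h2 := nrL_add_nrH ((j : ℤ) + 1) (n - (2 * j + 1))
    have h3 : (((j + 2 : ℕ) : ℤ)) = (j : ℤ) + 1 + 1 := by push_cast; ring
    rw [h3]
    omega

theorem nrL_rec {j : ℕ} (hj : 1 ≤ j) (n : ℕ) :
    (nrL (-(j : ℤ)) n : ℤ) = if n < 2 * j + 1 then (0:ℤ) else (nrP (n - (2 * j + 1)) : ℤ) - (nrL (-((j + 2 : ℕ) : ℤ)) (n - (2 * j + 1)) : ℤ) := by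
  split_ifs with h
  · rw [nrL_small (by omega) (by omega)]; rfl
  · have h1 := dys_card (m := -(j:ℤ) - 1) (by omega) (N := n - (2 * j + 1)) (N' := n) (by omega)
    have h2 := nrL_add_nrH (-((j + 2 : ℕ) : ℤ)) (n - (2 * j + 1))
    have h3 : -((j + 2 : ℕ) : ℤ) + 1 = -(j : ℤ) - 1 := by push_cast; ring
    have h4 : -(j : ℤ) - 1 + 1 = - j := by ring
    rw [h3] at h2
    rw [h4] at h1
    omega

theorem nr_symm (n : ℕ) : ∀ j : ℕ, 1 ≤ j → nrL (-(j : ℤ)) n = nrH j n := by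
  induction n using Nat.strong_induction_on with
  | _ n ih =>
    intro j hj
    have h1 := nrL_rec hj n
    have h2 := nrH_rec hj n
    split_ifs at h1 h2 with h
    · omega
    · have := ih (n - (2 * j + 1)) (by omega) (j + 2) (by omega)
      omega

theorem nrP_eq (n : ℕ) : nrP n = nrH 0 n + nrH 1 n := by
  have h1 := nrL_add_nrH (-1) n
  have h2 := nr_symm n 1 le_rfl
  norm_num at h1 h2
  omega

theorem nrP_zero : nrP 0 = 1 := by
  unfold nrP nrp
  rw [Finset.filter_true_of_mem]
  · simp
  · intro P _ j hj
    have : P.parts = 0 := by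
      apply Multiset.eq_zero_of_forall_notMem
      intro a ha
      have h1 := Multiset.le_sum_of_mem ha
      have := P.parts_pos ha
      rw [P.parts_sum] at h1
      omega
    rw [this]; simp

theorem nrH0_zero : nrH 0 0 = 1 := by
  have h1 := nrP_eq 0
  rw [nrP_zero, nrH_zero_of_pos (m := 1) (by norm_num)] at h1
  omega

theorem nrH0_rec (n : ℕ) : (nrH 0 n : ℤ) = if n = 0 then (1:ℤ) else (nrP (n - 1) : ℤ) - (nrH 2 (n - 1) : ℤ) := by
  split_ifs with h
  · rw [h, nrH0_zero]; rfl
  · have h1 := dys_card (m := 0) (by omega) (N := n) (N' := n - 1) (by omega)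
    have h2 := nrL_add_nrH 1 (n - 1)
    norm_num at h1 h2
    omega

theorem conv_sum {ι : Type*} (T : ℕ → Finset ι) (e : ι → ℕ) (c : ι → ℤ) (P : ℕ → ℤ)
    (hT : ∀ i, i ∈ T (e i)) (hmono : ∀ a b, a ≤ b → T a ⊆ T b) (n : ℕ) :
    ∑ p ∈ Finset.HasAntidiagonal.antidiagonal n, P p.1 * (∑ i ∈ T p.2, if e i = p.2 then c i else 0)
      = ∑ i ∈ T n, if e i ≤ n then c i * P (n - e i) else 0 := by
  have h1 : ∀ p ∈ Finset.HasAntidiagonal.antidiagonal n, P p.1 * (∑ i ∈ T p.2, if e i = p.2 then c i else 0)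
      = ∑ i ∈ T n, if e i = p.2 then P p.1 * c i else 0 := by
    intro p hp
    have hp2 : p.2 ≤ n := by have := Finset.HasAntidiagonal.mem_antidiagonal.1 hp; omega
    rw [Finset.mul_sum]
    rw [← Finset.sum_subset (hmono _ _ hp2) (fun i _ hi => ?_)]
    · apply Finset.sum_congr rfl; intro i _; split_ifs <;> simp
    · rw [if_neg]; intro h; exact hi (h ▸ hT i)
  rw [Finset.sum_congr rfl h1, Finset.sum_comm]
  apply Finset.sum_congr rfl
  intro i _
  split_ifs with h
  · rw [Finset.sum_eq_single (n - e i, e i)]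
    · rw [if_pos rfl]; ring
    · rintro ⟨a, b⟩ hab hne
      rw [if_neg]
      intro he
      apply hne
      have := Finset.HasAntidiagonal.mem_antidiagonal.1 hab
      simp only at he this
      ext <;> simp <;> omega
    · intro h'; exfalso; apply h'; rw [Finset.HasAntidiagonal.mem_antidiagonal]; simp; omega
  · apply Finset.sum_eq_zero
    intro p hp
    rw [if_neg]
    have := Finset.HasAntidiagonal.mem_antidiagonal.1 hp
    omega

theorem nrH_step (j n K : ℕ)
    (h : ∀ n' < n, (nrH (j + 2 : ℕ) n' : ℤ) = ∑ i ∈ Finset.range K,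
      if (i + 1) * (2 * (j + 2) + 2 * i + 1) ≤ n' then (-1) ^ i * (nrP (n' - (i + 1) * (2 * (j + 2) + 2 * i + 1)) : ℤ) else 0) :
    (if n < 2 * j + 1 then (0 : ℤ) else nrP (n - (2 * j + 1)) - nrH (j + 2 : ℕ) (n - (2 * j + 1)))
     = ∑ i ∈ Finset.range (K + 1),
      if (i + 1) * (2 * j + 2 * i + 1) ≤ n then (-1) ^ i * (nrP (n - (i + 1) * (2 * j + 2 * i + 1)) : ℤ) else 0 := by
  rw [Finset.sum_range_succ']
  split_ifs with h1 h2 h2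
  · exfalso; omega
  · rw [Finset.sum_eq_zero, add_zero]
    intro i _
    rw [if_neg]
    nlinarith
  · rw [h _ (by omega), sub_eq_add_neg, add_comm]
    congr 1
    · rw [← Finset.sum_neg_distrib]
      apply Finset.sum_congr rfl
      intro i _
      have e : (i + 1 + 1) * (2 * j + 2 * (i + 1) + 1) = (2 * j + 1) + (i + 1) * (2 * (j + 2) + 2 * i + 1) := by ring
      rw [e, Nat.sub_sub]
      by_cases h3 : (i + 1) * (2 * (j + 2) + 2 * i + 1) ≤ n - (2 * j + 1)
      · rw [if_pos h3, if_pos (by omega), pow_succ]; ring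
      · rw [if_neg h3, if_neg (by omega)]; simp
    · simp
  · exfalso; omega

theorem nrH_formula : ∀ (K n : ℕ) (_ : n ≤ K) (j : ℕ) (_ : 1 ≤ j),
    (nrH j n : ℤ) = ∑ i ∈ Finset.range K,
      if (i + 1) * (2 * j + 2 * i + 1) ≤ n then (-1) ^ i * (nrP (n - (i + 1) * (2 * j + 2 * i + 1)) : ℤ) else 0 := by
  intro K
  induction K with
  | zero =>
    intro n hn j hj
    rw [nrH_rec hj, if_pos (by omega)]; simp
  | succ K ih =>
    intro n hn j hj
    rw [nrH_rec hj]
    exact nrH_step j n K (fun n' hn' => ih n' (by omega) (j + 2) (by omega))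

theorem nrH0_formula (n : ℕ) :
    (nrH 0 n : ℤ) = (if n = 0 then 1 else 0) + ∑ i ∈ Finset.range n,
      if (i + 1) * (2 * i + 1) ≤ n then (-1) ^ i * (nrP (n - (i + 1) * (2 * i + 1)) : ℤ) else 0 := by
  rw [nrH0_rec]
  rcases n with _ | n
  · simp
  · have := nrH_step 0 (n + 1) n (fun n' hn' => nrH_formula n n' (by omega) 2 (by omega))
    simp at this ⊢
    exact this

/-- coefficients of `ψ` -/
def psiC (n : ℕ) : ℤ := (if n = 0 then 1 else 0)
  - ((∑ i ∈ Finset.range n, if (i + 1) * (2 * i + 1) = n then (-1) ^ i else 0)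
    + ∑ i ∈ Finset.range n, if (i + 1) * (2 * i + 3) = n then (-1) ^ i else 0)

theorem nrP_psi (n : ℕ) :
    ∑ p ∈ Finset.HasAntidiagonal.antidiagonal n, (nrP p.1 : ℤ) * psiC p.2 = if n = 0 then 1 else 0 := by
  unfold psiC
  simp only [mul_sub (nrP _ : ℤ), mul_add (nrP _ : ℤ), Finset.sum_sub_distrib, Finset.sum_add_distrib]
  have a1 := conv_sum Finset.range (fun i => (i + 1) * (2 * i + 1)) (fun i => (-1) ^ i)
    (fun n => (nrP n : ℤ)) (fun i => by rw [Finset.mem_range]; nlinarith)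
    (fun a b h => Finset.range_mono h) n
  have a2 := conv_sum Finset.range (fun i => (i + 1) * (2 * i + 3)) (fun i => (-1) ^ i)
    (fun n => (nrP n : ℤ)) (fun i => by rw [Finset.mem_range]; nlinarith)
    (fun a b h => Finset.range_mono h) n
  rw [a1, a2]
  have b0 := nrH0_formula n
  have b1 := nrH_formula n n le_rfl 1 le_rfl
  have b2 := nrP_eq n
  have b3 : ∑ p ∈ Finset.HasAntidiagonal.antidiagonal n, (nrP p.1 : ℤ) * (if p.2 = 0 then 1 else 0) = nrP n := by
    rw [Finset.sum_eq_single (n, 0)]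
    · simp
    · rintro ⟨a, b⟩ hab hne
      simp only
      rw [if_neg, mul_zero]
      intro h
      apply hne
      have := Finset.HasAntidiagonal.mem_antidiagonal.1 hab
      simp only at this
      ext <;> simp <;> omega
    · intro h; exfalso; apply h; simp
  rw [b3]
  have b4 : ∀ i : ℕ, (i + 1) * (2 * 1 + 2 * i + 1) = (i + 1) * (2 * i + 3) := fun i => by ring
  simp only [b4] at b1
  push_cast at b1
  zify at b2
  rw [b2, b0, b1]
  ring

def kap (i : ℕ) : ℤ :=
  match i % 10 with
  | 0 => 2 | 1 => 1 | 2 => -2 | 3 => 1 | 4 => 2 | 5 => -2 | 6 => -1 | 7 => 2 | 8 => -1 | _ => -2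

/-- coefficients of `S` -/
def sC (n : ℕ) : ℤ := (if n = 0 then 1 else 0)
  + ∑ x ∈ Finset.range n ×ˢ Finset.range n,
      if (x.1 + 1) * (2 * x.1 + 3 + 2 * x.2) = n then (-1) ^ (x.1 + 1) * kap x.2 else 0

theorem kap_sum (s : ℕ) : ∀ k : ℕ, ∑ i ∈ Finset.range (10 * k + s), kap i = ∑ i ∈ Finset.range s, kap i := by
  have hp : ∀ m, kap (m + 10) = kap m := by intro m; unfold kap; rw [Nat.add_mod_right]
  intro k
  induction k with
  | zero => simp
  | succ k ih =>
    rw [← ih]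
    clear ih
    rw [show 10 * (k+1) + s = (10 * k + s) + 10 by ring]
    generalize 10 * k + s = M
    induction M with
    | zero => decide
    | succ M ihM =>
      rw [show M + 1 + 10 = (M + 10) + 1 by ring, Finset.sum_range_succ, ihM, hp, Finset.sum_range_succ]

def cfun (r : ℤ) : ℤ := (if r ≡ 0 [ZMOD 10] then 1 else 0) + (if r ≡ 3 [ZMOD 10] then 1 else 0)
  - (if r ≡ 2 [ZMOD 10] then 1 else 0) - (if r ≡ 5 [ZMOD 10] then 1 else 0)

noncomputable def Dn (n : ℕ) : ℤ := (N2 0 10 n + N2 3 10 n : ℤ) - N2 2 10 n - N2 5 10 n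

theorem N2_eq (r : ℤ) (n : ℕ) : (N2 r 10 n : ℤ) = ∑ P ∈ nrp n, if m2Rank P ≡ r [ZMOD 10] then 1 else 0 := by
  unfold N2 nrp
  rw [← Finset.sum_filter, Finset.filter_filter, Finset.sum_const, Nat.card_eq_fintype_card, Fintype.card_subtype]
  simp

theorem Dn_eq (n : ℕ) : Dn n = ∑ P ∈ nrp n, cfun (m2Rank P) := by
  unfold Dn cfun
  simp only [Finset.sum_sub_distrib, Finset.sum_add_distrib, N2_eq]

theorem rank_bound {n : ℕ} (P : n.Partition) : -(n : ℤ) ≤ m2Rank P ∧ m2Rank P ≤ n := by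
  unfold m2Rank
  have h1 : P.parts.sup ≤ n := by
    apply Multiset.sup_le.2
    intro b hb
    have := Multiset.le_sum_of_mem hb
    rwa [P.parts_sum] at this
  have h2 : Multiset.card P.parts ≤ n := by
    have := Multiset.card_nsmul_le_sum (s := P.parts) (a := 1) (fun x hx => P.parts_pos hx)
    rw [P.parts_sum] at this
    simpa using this
  constructor <;> omega

noncomputable def nrE (r : ℤ) (n : ℕ) : ℕ := ((nrp n).filter (fun P => m2Rank P = r)).card

theorem nrE_symm (n : ℕ) (r : ℤ) : nrE (-r) n = nrE r n := by
  have key : ∀ j : ℕ, 1 ≤ j → nrE (-(j : ℤ)) n = nrE j n := by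
    intro j hj
    have a1 : nrE j n + nrH (j + 1 : ℕ) n = nrH j n := by
      unfold nrE nrH
      rw [← Finset.card_union_of_disjoint]
      · congr 1; ext P; simp only [Finset.mem_union, Finset.mem_filter]
        constructor
        · rintro (⟨a, b⟩ | ⟨a, b⟩)
          · exact ⟨a, by omega⟩
          · exact ⟨a, by push_cast at b; omega⟩
        · rintro ⟨a, b⟩
          rcases b.eq_or_lt with h | h
          · exact Or.inl ⟨a, h.symm⟩
          · exact Or.inr ⟨a, by push_cast; omega⟩
      · rw [Finset.disjoint_filter]; intro P _ h; push_cast; omega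
    have a2 : nrE (-(j : ℤ)) n + nrL (-((j + 1 : ℕ) : ℤ)) n = nrL (-(j : ℤ)) n := by
      unfold nrE nrL
      rw [← Finset.card_union_of_disjoint]
      · congr 1; ext P; simp only [Finset.mem_union, Finset.mem_filter]
        constructor
        · rintro (⟨a, b⟩ | ⟨a, b⟩)
          · exact ⟨a, by omega⟩
          · exact ⟨a, by push_cast at b; omega⟩
        · rintro ⟨a, b⟩
          rcases b.eq_or_lt with h | h
          · exact Or.inl ⟨a, h⟩
          · exact Or.inr ⟨a, by push_cast; omega⟩
      · rw [Finset.disjoint_filter]; intro P _ h; push_cast; omega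
    have a3 := nr_symm n j hj
    have a4 := nr_symm n (j + 1) (by omega)
    omega
  rcases lt_trichotomy r 0 with h | h | h
  · have := key (-r).toNat (by omega)
    rw [Int.toNat_of_nonneg (by omega)] at this
    rw [← this, neg_neg]
  · subst h; simp
  · have := key r.toNat (by omega)
    rwa [Int.toNat_of_nonneg (by omega)] at this

theorem sum_rank (n : ℕ) (u : ℤ → ℤ) :
    ∑ P ∈ nrp n, u (m2Rank P) = ∑ r ∈ Finset.Icc (-(n : ℤ)) n, u r * nrE r n := by
  rw [← Finset.sum_fiberwise_of_maps_to (t := Finset.Icc (-(n : ℤ)) n) (g := m2Rank)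
    (fun P _ => Finset.mem_Icc.2 (rank_bound P))]
  apply Finset.sum_congr rfl
  intro r _
  unfold nrE
  rw [Finset.sum_congr rfl (g := fun _ => u r), Finset.sum_const, nsmul_eq_mul, mul_comm]
  intro P hP
  rw [(Finset.mem_filter.1 hP).2]

theorem sum_rank_symm (n : ℕ) (u : ℤ → ℤ) :
    2 * ∑ P ∈ nrp n, u (m2Rank P) = ∑ P ∈ nrp n, (u (m2Rank P) + u (-m2Rank P)) := by
  rw [sum_rank n u, sum_rank n (fun r => u r + u (-r))]
  simp only [add_mul, Finset.sum_add_distrib]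
  have : ∑ x ∈ Finset.Icc (-(n : ℤ)) n, u (-x) * (nrE x n : ℤ) = ∑ r ∈ Finset.Icc (-(n : ℤ)) n, u r * nrE r n := by
    apply Finset.sum_nbij' (fun x => -x) (fun x => -x)
    · intro a ha; rw [Finset.mem_Icc] at *; omega
    · intro a ha; rw [Finset.mem_Icc] at *; omega
    · intro a _; simp
    · intro a _; simp
    · intro a _; rw [nrE_symm]
  rw [this]; ring

def wfun (r : ℤ) : ℤ := 1 - ∑ i ∈ Finset.range r.toNat, kap i

theorem cfun_wfun_nat (r : ℕ) (h : 1 ≤ r) : cfun r + cfun (-r) = wfun r + wfun (-r) := by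
  have h1 : wfun (-(r : ℤ)) = 1 := by
    unfold wfun
    rw [Int.toNat_of_nonpos (by omega)]; simp
  rw [h1]
  unfold wfun cfun
  rw [Int.toNat_natCast]
  obtain ⟨k, s, hs, rfl⟩ : ∃ k s, s < 10 ∧ r = 10 * k + s := ⟨r / 10, r % 10, by omega, by omega⟩
  rw [kap_sum]
  simp only [Int.ModEq]
  push_cast
  have c1 : ∀ x : ℤ, (-(10 * (k : ℤ) + x)) % 10 = (-x) % 10 := by intro x; omega
  have c2 : ∀ x : ℤ, ((10 * (k : ℤ) + x)) % 10 = (x) % 10 := by intro x; omega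
  simp only [c1, c2]
  clear c1 c2 h1 h
  interval_cases s <;> decide

theorem cfun_wfun (r : ℤ) : cfun r + cfun (-r) = wfun r + wfun (-r) := by
  rcases lt_trichotomy r 0 with h | h | h
  · have := cfun_wfun_nat (-r).toNat (by omega)
    rw [Int.toNat_of_nonneg (by omega), neg_neg] at this
    linarith
  · subst h; simp [cfun, wfun]; decide
  · have := cfun_wfun_nat r.toNat (by omega)
    rwa [Int.toNat_of_nonneg (by omega)] at this

theorem Dn_eq2 (n : ℕ) : Dn n = nrP n - ∑ i ∈ Finset.range n, kap i * nrH (i + 1 : ℕ) n := by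
  have h1 : Dn n = ∑ P ∈ nrp n, wfun (m2Rank P) := by
    have a1 := sum_rank_symm n cfun
    have a2 := sum_rank_symm n wfun
    simp only [cfun_wfun] at a1
    rw [Dn_eq]; linarith
  rw [h1]
  have h2 : ∀ P ∈ nrp n, wfun (m2Rank P)
      = 1 - ∑ i ∈ Finset.range n, kap i * (if ((i + 1 : ℕ) : ℤ) ≤ m2Rank P then 1 else 0) := by
    intro P _
    unfold wfun
    congr 1
    have hb := (rank_bound P).2
    rw [← Finset.sum_subset (s₁ := Finset.range (m2Rank P).toNat) (s₂ := Finset.range n)]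
    · apply Finset.sum_congr rfl
      intro i hi
      rw [Finset.mem_range] at hi
      rw [if_pos (by omega), mul_one]
    · intro i hi
      rw [Finset.mem_range] at *
      omega
    · intro i _ hi
      rw [Finset.mem_range] at hi
      rw [if_neg (by omega), mul_zero]
  rw [Finset.sum_congr rfl h2, Finset.sum_sub_distrib, Finset.sum_comm]
  congr 1
  · simp [nrP]
  · apply Finset.sum_congr rfl
    intro i _
    rw [← Finset.mul_sum]
    congr 1
    simp [nrH]

theorem Dn_conv_P (n : ℕ) :
    ∑ p ∈ Finset.HasAntidiagonal.antidiagonal n, (nrP p.1 : ℤ) * sC p.2 = Dn n := by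
  unfold sC
  simp only [mul_add, Finset.sum_add_distrib]
  have a1 := conv_sum (fun n => Finset.range n ×ˢ Finset.range n)
    (fun x => (x.1 + 1) * (2 * x.1 + 3 + 2 * x.2)) (fun x => (-1) ^ (x.1 + 1) * kap x.2)
    (fun n => (nrP n : ℤ)) (fun i => by simp only [Finset.mem_product, Finset.mem_range]; constructor <;> nlinarith)
    (fun a b h => Finset.product_subset_product (Finset.range_mono h) (Finset.range_mono h)) n
  have b3 : ∑ p ∈ Finset.HasAntidiagonal.antidiagonal n, (nrP p.1 : ℤ) * (if p.2 = 0 then 1 else 0) = nrP n := by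
    rw [Finset.sum_eq_single (n, 0)]
    · simp
    · rintro ⟨a, b⟩ hab hne
      simp only
      rw [if_neg, mul_zero]
      intro h
      apply hne
      have := Finset.HasAntidiagonal.mem_antidiagonal.1 hab
      simp only at this
      ext <;> simp <;> omega
    · intro h; exfalso; apply h; simp
  simp only [mul_add] at a1
  rw [b3, a1, Dn_eq2, sub_eq_add_neg]
  congr 1
  rw [Finset.sum_product_right, ← Finset.sum_neg_distrib]
  apply Finset.sum_congr rfl
  intro i _
  rw [nrH_formula n n le_rfl (i + 1) (by omega), Finset.mul_sum, ← Finset.sum_neg_distrib]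
  apply Finset.sum_congr rfl
  intro j _
  simp only
  have e : (j + 1) * (2 * (i + 1) + 2 * j + 1) = (j + 1) * (2 * j) + (j + 1) * 3 + (j + 1) * (2 * i) := by ring
  rw [e]
  split_ifs
  · ring
  · simp

theorem Dn_psi (n : ℕ) :
    ∑ p ∈ Finset.HasAntidiagonal.antidiagonal n, Dn p.1 * psiC p.2 = sC n := by
  have h1 : (PowerSeries.mk fun n => (nrP n : ℤ)) * PowerSeries.mk psiC = 1 := by
    ext n
    rw [PowerSeries.coeff_mul, PowerSeries.coeff_one]
    simpa using nrP_psi n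
  have h2 : (PowerSeries.mk fun n => (nrP n : ℤ)) * PowerSeries.mk sC = PowerSeries.mk Dn := by
    ext n
    rw [PowerSeries.coeff_mul, PowerSeries.coeff_mk]
    simpa using Dn_conv_P n
  have h3 : PowerSeries.mk Dn * PowerSeries.mk psiC = PowerSeries.mk sC := by
    rw [← h2, mul_right_comm, h1, one_mul]
  have := congrArg (PowerSeries.coeff n) h3
  rw [PowerSeries.coeff_mul] at this
  simpa using this

def forceN {α : Type} (n : ℕ) (f : ℕ → α) : α := Nat.rec (f 0) (fun k _ => f (k + 1)) n

theorem forceN_eq {α : Type} (n : ℕ) (f : ℕ → α) : forceN n f = f n := by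
  cases n <;> rfl

def geoD (z : ℕ) : ℕ → ℕ
  | 0 => 1
  | r + 1 => geoD z r * (1 + z ^ (2 ^ r))

def rAux (N c : ℕ) : ℕ → ℕ
  | 0 => 0
  | f + 1 => bif Nat.ble N (c * 2 ^ f) then rAux N c f else f + 1

/-- parts of the sum over i for given j -/
def sA (x : ℕ) : ℕ := 2 + x + x ^ 3 + 2 * x ^ 4 + 2 * x ^ 7
def sB (x : ℕ) : ℕ := 2 * x ^ 2 + 2 * x ^ 5 + x ^ 6 + x ^ 8 + 2 * x ^ 9

def sE (X N j : ℕ) : ℕ :=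
  X ^ ((j + 1) * (2 * j + 3)) * geoD (X ^ (20 * (j + 1))) (rAux N (20 * (j + 1)) 14)

/-- par = true : returns positive part -/
def sPart (X N : ℕ) (par : Bool) : ℕ → ℕ
  | 0 => 0
  | j + 1 => sPart X N par j +
      sE X N j * (bif (Nat.beq (j % 2) 0).xor par then sA (X ^ (2 * (j + 1))) else sB (X ^ (2 * (j + 1))))

def pPart (X : ℕ) (par : ℕ) : ℕ → ℕ
  | 0 => 0
  | i + 1 => pPart X par i + (bif Nat.beq (i % 2) par then X ^ ((i + 1) * (2 * i + 1)) + X ^ ((i + 1) * (2 * i + 3)) else 0)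

def newt (X psi : ℕ) : ℕ → ℕ
  | 0 => 1
  | k + 1 => forceN (newt X psi k) fun I =>
      forceN (X ^ (2 ^ (k + 1))) fun m =>
       (I * (m + 2 - (psi % m * I) % m)) % m

def chkD (X B : ℕ) : ℕ → ℕ → ℕ → Bool
  | 0, q, n => (Nat.ble (q + 1) B) && (Nat.ble n 6 || Nat.ble 1 q)
  | k + 1, q, n => forceN (q % X ^ (2 ^ k)) (fun a => chkD X B k a n) &&
      forceN (q / X ^ (2 ^ k)) (fun b => chkD X B k b (n + 2 ^ k))

def bigCheck (X B K J : ℕ) : Bool :=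
  forceN (X ^ (2 ^ K)) fun M =>
  forceN (1 + pPart X 1 J) fun pP =>
  forceN (pPart X 0 J) fun pN =>
  forceN ((1 + sPart X (2 ^ K) true J) % M) fun SP =>
  forceN ((sPart X (2 ^ K) false J) % M) fun SN =>
  forceN ((newt X (M ^ 2 + pP - pN) K * (SP + M - SN)) % M) fun Q =>
  Nat.beq ((Q * pP + SN) % M) ((Q * pN + SP) % M) && chkD X B K Q 0

theorem chkD_sound (X B : ℕ) (hX : 0 < X) : ∀ (k q n : ℕ), chkD X B k q n = true →
    ∃ d : ℕ → ℕ, (∀ i < 2 ^ k, d i < B ∧ (7 ≤ n + i → 0 < d i)) ∧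
      q = ∑ i ∈ Finset.range (2 ^ k), d i * X ^ i := by
  intro k
  induction k with
  | zero =>
    intro q n h
    refine ⟨fun _ => q, ?_, by simp⟩
    simp only [chkD, Bool.and_eq_true, Bool.or_eq_true, Nat.ble_eq] at h
    intro i hi
    simp at hi
    subst hi
    simp only
    omega
  | succ k ih =>
    intro q n h
    simp only [chkD, forceN_eq, Bool.and_eq_true] at h
    obtain ⟨d1, h1, e1⟩ := ih _ _ h.1
    obtain ⟨d2, h2, e2⟩ := ih _ _ h.2
    refine ⟨fun i => if i < 2 ^ k then d1 i else d2 (i - 2 ^ k), ?_, ?_⟩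
    · intro i hi
      simp only
      split_ifs with hi2
      · exact h1 i hi2
      · have := h2 (i - 2 ^ k) (by rw [pow_succ] at hi; omega)
        refine ⟨this.1, fun h7 => this.2 (by omega)⟩
    · rw [pow_succ, mul_two, Finset.sum_range_add]
      have a1 : ∑ x ∈ Finset.range (2 ^ k), (if x < 2 ^ k then d1 x else d2 (x - 2 ^ k)) * X ^ x
          = q % X ^ (2 ^ k) := by
        rw [e1]
        apply Finset.sum_congr rfl
        intro x hx
        rw [if_pos (Finset.mem_range.1 hx)]
      have a2 : ∑ x ∈ Finset.range (2 ^ k), (if 2 ^ k + x < 2 ^ k then d1 (2 ^ k + x) else d2 (2 ^ k + x - 2 ^ k)) * X ^ (2 ^ k + x)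
          = X ^ (2 ^ k) * (q / X ^ (2 ^ k)) := by
        rw [e2, Finset.mul_sum]
        apply Finset.sum_congr rfl
        intro x hx
        rw [if_neg (by omega), Nat.add_sub_cancel_left, pow_add]; ring
      rw [a1, a2]
      exact (Nat.mod_add_div _ _).symm

theorem digits_zero (X : ℤ) (hX : 0 < X) : ∀ (N : ℕ) (r : ℕ → ℤ) (_ : ∀ i < N, |r i| < X)
    (_ : X ^ N ∣ ∑ i ∈ Finset.range N, r i * X ^ i), ∀ i < N, r i = 0 := by
  intro N
  induction N with
  | zero => intro r _ _ i hi; omega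
  | succ N ih =>
    intro r hr hd
    rw [Finset.sum_range_succ'] at hd
    have hf : ∑ i ∈ Finset.range N, r (i + 1) * X ^ (i + 1) = X * ∑ i ∈ Finset.range N, r (i + 1) * X ^ i := by
      rw [Finset.mul_sum]; apply Finset.sum_congr rfl; intro i _; ring
    rw [hf] at hd
    have h0 : r 0 = 0 := by
      have h1 : X ∣ r 0 := by
        have : X ∣ X ^ (N + 1) := dvd_pow_self X (by omega)
        have h2 := this.trans hd
        rw [pow_zero, mul_one] at h2
        exact (Int.dvd_add_right (Dvd.intro _ rfl)).1 h2
      exact Int.eq_zero_of_abs_lt_dvd h1 (hr 0 (by omega))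
    rw [h0, zero_mul, add_zero, pow_succ, mul_comm (X ^ N)] at hd
    have h3 := ih (fun i => r (i + 1)) (fun i hi => hr (i + 1) (by omega))
      (Int.dvd_of_mul_dvd_mul_left hX.ne' hd)
    intro i hi
    rcases i with _ | i
    · exact h0
    · exact h3 i (by omega)

theorem trunc_dvd {ι : Type*} (A : Finset ι) (e : ι → ℕ) (c : ι → ℤ) (X : ℤ) (N : ℕ) :
    X ^ N ∣ ∑ i ∈ A, c i * X ^ (e i)
      - ∑ n ∈ Finset.range N, (∑ i ∈ A, if e i = n then c i else 0) * X ^ n := by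
  have : ∑ n ∈ Finset.range N, (∑ i ∈ A, if e i = n then c i else 0) * X ^ n
      = ∑ i ∈ A, ∑ n ∈ Finset.range N, (if e i = n then c i else 0) * X ^ n := by
    rw [Finset.sum_comm]
    apply Finset.sum_congr rfl
    intro n _
    rw [Finset.sum_mul]
  rw [this, ← Finset.sum_sub_distrib]
  apply Finset.dvd_sum
  intro i _
  by_cases h : e i < N
  · rw [Finset.sum_eq_single (e i)]
    · simp
    · intro n _ hn; rw [if_neg (Ne.symm hn), zero_mul]
    · intro h'; exact absurd (Finset.mem_range.2 h) h'
  · rw [Finset.sum_eq_zero]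
    · rw [sub_zero]; exact Dvd.dvd.mul_left (pow_dvd_pow X (by omega)) _
    · intro n hn
      rw [Finset.mem_range] at hn
      rw [if_neg (by omega), zero_mul]

theorem sum_range_supp (f : ℕ → ℤ) (a b : ℕ) (h : ∀ i, f i ≠ 0 → i < a ∧ i < b) :
    ∑ i ∈ Finset.range a, f i = ∑ i ∈ Finset.range b, f i := by
  have key : ∀ a, (∀ i, f i ≠ 0 → i < a) → ∀ M, a ≤ M → ∑ i ∈ Finset.range a, f i = ∑ i ∈ Finset.range M, f i := by
    intro a ha M hM
    apply Finset.sum_subset (Finset.range_mono hM)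
    intro i _ hi
    by_contra hne
    exact hi (Finset.mem_range.2 (ha i hne))
  rw [key a (fun i hi => (h i hi).1) (max a b) (le_max_left _ _),
    key b (fun i hi => (h i hi).2) (max a b) (le_max_right _ _)]

theorem rAux_spec (N c : ℕ) : ∀ f, N ≤ c * 2 ^ f → N ≤ c * 2 ^ (rAux N c f) := by
  intro f
  induction f with
  | zero => intro h; simpa [rAux] using h
  | succ f ih =>
    intro h
    simp only [rAux]
    cases hb : Nat.ble N (c * 2 ^ f)
    · simpa using h
    · simp only [cond_true]
      exact ih (by simpa using hb)

theorem geoD_eq (z : ℕ) : ∀ r, geoD z r = ∑ l ∈ Finset.range (2 ^ r), z ^ l := by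
  intro r
  induction r with
  | zero => simp [geoD]
  | succ r ih =>
    rw [geoD, ih, pow_succ, mul_two, Finset.sum_range_add, mul_add, mul_one, Finset.sum_mul]
    congr 1
    apply Finset.sum_congr rfl
    intro x _
    rw [pow_add]; ring

theorem kap_poly (x : ℤ) (K : ℕ) : ∑ i ∈ Finset.range (10 * K), kap i * x ^ i
    = ((2 + x + x ^ 3 + 2 * x ^ 4 + 2 * x ^ 7) - (2 * x ^ 2 + 2 * x ^ 5 + x ^ 6 + x ^ 8 + 2 * x ^ 9))
      * ∑ l ∈ Finset.range K, (x ^ 10) ^ l := by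
  induction K with
  | zero => simp
  | succ K ih =>
    rw [Finset.sum_range_succ, mul_add (_ - _), ← ih, show 10 * (K + 1) = 10 * K + 10 by ring,
      Finset.sum_range_add]
    congr 1
    have hk : ∀ s, kap (10 * K + s) = kap s := by
      intro s; unfold kap; rw [Nat.mul_add_mod]
    simp only [hk, Finset.sum_range_succ, Finset.sum_range_zero]
    have : kap 0 = 2 ∧ kap 1 = 1 ∧ kap 2 = -2 ∧ kap 3 = 1 ∧ kap 4 = 2 ∧ kap 5 = -2 ∧ kap 6 = -1
      ∧ kap 7 = 2 ∧ kap 8 = -1 ∧ kap 9 = -2 := by decide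
    obtain ⟨h0, h1, h2, h3, h4, h5, h6, h7, h8, h9⟩ := this
    rw [h0, h1, h2, h3, h4, h5, h6, h7, h8, h9]
    ring

theorem pPart_eq (X J : ℕ) : (pPart X 0 J : ℤ) - (pPart X 1 J : ℤ)
    = ∑ i ∈ Finset.range J, (-1) ^ i * (X : ℤ) ^ ((i + 1) * (2 * i + 1))
      + ∑ i ∈ Finset.range J, (-1) ^ i * (X : ℤ) ^ ((i + 1) * (2 * i + 3)) := by
  induction J with
  | zero => simp [pPart]
  | succ i ih =>
    rw [Finset.sum_range_succ, Finset.sum_range_succ]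
    simp only [pPart]
    rcases Nat.even_or_odd i with h | h
    · have h2 : i % 2 = 0 := Nat.even_iff.1 h
      rw [h2, h.neg_one_pow]
      simp only [Nat.beq]
      push_cast
      simp only [cond_true, cond_false]
      push_cast
      linarith
    · have h2 : i % 2 = 1 := Nat.odd_iff.1 h
      rw [h2, h.neg_one_pow]
      simp only [Nat.beq]
      push_cast
      simp only [cond_true, cond_false]
      push_cast
      linarith

theorem sPart_eq (X N J : ℕ) : (sPart X N true J : ℤ) - (sPart X N false J : ℤ)
    = ∑ j ∈ Finset.range J, ∑ i ∈ Finset.range (10 * 2 ^ (rAux N (20 * (j + 1)) 14)),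
       ((-1) ^ (j + 1) * kap i) * (X : ℤ) ^ ((j + 1) * (2 * j + 3 + 2 * i)) := by
  induction J with
  | zero => simp [sPart]
  | succ j ih =>
    rw [Finset.sum_range_succ, ← ih]
    have h1 : ∑ i ∈ Finset.range (10 * 2 ^ (rAux N (20 * (j + 1)) 14)),
       ((-1) ^ (j + 1) * kap i) * (X : ℤ) ^ ((j + 1) * (2 * j + 3 + 2 * i))
       = (-1) ^ (j + 1) * ((sE X N j : ℤ) * ((sA (X ^ (2 * (j + 1))) : ℤ) - (sB (X ^ (2 * (j + 1))) : ℤ))) := by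
      have h2 := kap_poly ((X : ℤ) ^ (2 * (j + 1))) (2 ^ (rAux N (20 * (j + 1)) 14))
      have h3 : ∀ i, ((-1) ^ (j + 1) * kap i) * (X : ℤ) ^ ((j + 1) * (2 * j + 3 + 2 * i))
        = ((-1) ^ (j + 1) * (X : ℤ) ^ ((j + 1) * (2 * j + 3))) * (kap i * ((X : ℤ) ^ (2 * (j + 1))) ^ i) := by
        intro i
        rw [← pow_mul, show (j + 1) * (2 * j + 3 + 2 * i) = (j + 1) * (2 * j + 3) + 2 * (j + 1) * i by ring, pow_add]
        ring
      simp only [h3]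
      rw [← Finset.mul_sum, h2]
      unfold sE sA sB
      rw [geoD_eq]
      push_cast
      have h4 : ((X : ℤ) ^ (2 * (j + 1))) ^ 10 = (X : ℤ) ^ (20 * (j + 1)) := by
        rw [← pow_mul]; congr 1; ring
      rw [h4]
      ring
    rw [h1]
    simp only [sPart]
    rcases Nat.even_or_odd j with h | h
    · have h2 : j % 2 = 0 := Nat.even_iff.1 h
      rw [h2, (Even.add_one h).neg_one_pow]
      simp only [Nat.beq, Bool.xor_true, Bool.xor_false, Bool.not_true, cond_true, cond_false]
      push_cast
      ring
    · have h2 : j % 2 = 1 := Nat.odd_iff.1 h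
      rw [h2, (Odd.add_one h).neg_one_pow]
      simp only [Nat.beq, Bool.xor_true, Bool.xor_false, Bool.not_false, cond_true, cond_false]
      push_cast
      ring

theorem psi_trunc (X : ℤ) (N J : ℕ) (hN : 0 < N) (hJ : N ≤ (J + 1) * (2 * J + 1)) :
    X ^ N ∣ (1 - (∑ i ∈ Finset.range J, (-1) ^ i * X ^ ((i + 1) * (2 * i + 1))
      + ∑ i ∈ Finset.range J, (-1) ^ i * X ^ ((i + 1) * (2 * i + 3))))
      - ∑ n ∈ Finset.range N, psiC n * X ^ n := by
  have h1 := trunc_dvd (Finset.range J) (fun i => (i + 1) * (2 * i + 1)) (fun i => (-1) ^ i) X N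
  have h2 := trunc_dvd (Finset.range J) (fun i => (i + 1) * (2 * i + 3)) (fun i => (-1) ^ i) X N
  have h3 : ∑ n ∈ Finset.range N, (if n = 0 then (1 : ℤ) else 0) * X ^ n = 1 := by
    rw [Finset.sum_eq_single 0]
    · simp
    · intro n _ hn; simp [hn]
    · intro h; exact absurd (Finset.mem_range.2 hN) h
  have h4 : ∑ n ∈ Finset.range N, psiC n * X ^ n = 1
      - (∑ n ∈ Finset.range N, (∑ i ∈ Finset.range J, if (i + 1) * (2 * i + 1) = n then (-1) ^ i else 0) * X ^ n
      + ∑ n ∈ Finset.range N, (∑ i ∈ Finset.range J, if (i + 1) * (2 * i + 3) = n then (-1) ^ i else 0) * X ^ n) := by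
    rw [← Finset.sum_add_distrib]
    refine Eq.trans ?_ (congrArg (fun t => t - _) h3)
    rw [← Finset.sum_sub_distrib]
    apply Finset.sum_congr rfl
    intro n hn
    rw [Finset.mem_range] at hn
    rw [← add_mul, ← sub_mul]
    congr 1
    unfold psiC
    congr 2
    · apply sum_range_supp
      intro i hi
      have : (i + 1) * (2 * i + 1) = n := by by_contra h; rw [if_neg h] at hi; exact hi rfl
      constructor
      · nlinarith
      · by_contra hc; push Not at hc; nlinarith
    · apply sum_range_supp
      intro i hi
      have : (i + 1) * (2 * i + 3) = n := by by_contra h; rw [if_neg h] at hi; exact hi rfl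
      constructor
      · nlinarith
      · by_contra hc; push Not at hc; nlinarith
  rw [h4]
  have := (dvd_add h1 h2).neg_right
  refine Eq.mpr (congrArg _ ?_) this
  ring

theorem s_trunc (X : ℤ) (N J : ℕ) (L : ℕ → ℕ) (hN : 0 < N) (hJ : N ≤ (J + 1) * (2 * J + 1))
    (hL : ∀ j, N ≤ 2 * (j + 1) * L j) :
    X ^ N ∣ (1 + ∑ j ∈ Finset.range J, ∑ i ∈ Finset.range (L j),
       ((-1) ^ (j + 1) * kap i) * X ^ ((j + 1) * (2 * j + 3 + 2 * i)))
      - ∑ n ∈ Finset.range N, sC n * X ^ n := by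
  have h1 := trunc_dvd ((Finset.range J).sigma (fun j => Finset.range (L j)))
    (fun x => (x.1 + 1) * (2 * x.1 + 3 + 2 * x.2)) (fun x => (-1) ^ (x.1 + 1) * kap x.2) X N
  have h3 : ∑ n ∈ Finset.range N, (if n = 0 then (1 : ℤ) else 0) * X ^ n = 1 := by
    rw [Finset.sum_eq_single 0]
    · simp
    · intro n _ hn; simp [hn]
    · intro h; exact absurd (Finset.mem_range.2 hN) h
  have h4 : ∑ n ∈ Finset.range N, sC n * X ^ n = 1
      + ∑ n ∈ Finset.range N, (∑ x ∈ (Finset.range J).sigma (fun j => Finset.range (L j)),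
         if (x.1 + 1) * (2 * x.1 + 3 + 2 * x.2) = n then (-1) ^ (x.1 + 1) * kap x.2 else 0) * X ^ n := by
    refine Eq.trans ?_ (congrArg (fun t => t + _) h3)
    rw [← Finset.sum_add_distrib]
    apply Finset.sum_congr rfl
    intro n hn
    rw [Finset.mem_range] at hn
    rw [← add_mul]
    congr 1
    unfold sC
    congr 1
    rw [Finset.sum_product, Finset.sum_sigma]
    have a1 : ∀ j ∈ Finset.range J, ∑ i ∈ Finset.range (L j),
        (if (j + 1) * (2 * j + 3 + 2 * i) = n then (-1) ^ (j + 1) * kap i else 0)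
        = ∑ i ∈ Finset.range n, (if (j + 1) * (2 * j + 3 + 2 * i) = n then (-1) ^ (j + 1) * kap i else 0) := by
      intro j _
      apply sum_range_supp
      intro i hi
      have : (j + 1) * (2 * j + 3 + 2 * i) = n := by by_contra h; rw [if_neg h] at hi; exact hi rfl
      have h5 := hL j
      constructor
      · by_contra hc; push Not at hc; nlinarith
      · nlinarith
    rw [Finset.sum_congr rfl a1]
    apply sum_range_supp
    intro j hj
    obtain ⟨i, _, hi⟩ := Finset.exists_ne_zero_of_sum_ne_zero hj
    have : (j + 1) * (2 * j + 3 + 2 * i) = n := by by_contra h; rw [if_neg h] at hi; exact hi rfl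
    constructor
    · nlinarith
    · by_contra hc; push Not at hc; nlinarith
  rw [h4]
  convert h1 using 1
  rw [Finset.sum_sigma]
  ring

theorem psiC_bound (n : ℕ) : |psiC n| ≤ 1 + 2 * n := by
  have key : ∀ e : ℕ → ℕ, |∑ i ∈ Finset.range n, if e i = n then (-1 : ℤ) ^ i else 0| ≤ n := by
    intro e
    refine (Finset.abs_sum_le_sum_abs _ _).trans ?_
    have : ∑ i ∈ Finset.range n, |if e i = n then (-1 : ℤ) ^ i else 0| ≤ ∑ i ∈ Finset.range n, (1 : ℤ) := by
      apply Finset.sum_le_sum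
      intro i _
      split_ifs <;> simp
    simpa using this
  unfold psiC
  have h1 := abs_le.1 (key (fun i => (i + 1) * (2 * i + 1)))
  have h2 := abs_le.1 (key (fun i => (i + 1) * (2 * i + 3)))
  rw [abs_le]
  constructor <;> split_ifs <;> linarith

theorem kap_bound (i : ℕ) : |kap i| ≤ 2 := by
  unfold kap
  split <;> decide

theorem sC_bound (n : ℕ) : |sC n| ≤ 1 + 2 * n ^ 2 := by
  unfold sC
  refine (abs_add_le _ _).trans (add_le_add (by split_ifs <;> simp) ?_)
  refine (Finset.abs_sum_le_sum_abs _ _).trans ?_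
  have : ∑ x ∈ Finset.range n ×ˢ Finset.range n,
      |if (x.1 + 1) * (2 * x.1 + 3 + 2 * x.2) = n then (-1) ^ (x.1 + 1) * kap x.2 else 0|
      ≤ ∑ x ∈ Finset.range n ×ˢ Finset.range n, (2 : ℤ) := by
    apply Finset.sum_le_sum
    intro x _
    split_ifs
    · rw [abs_mul]; simpa using kap_bound x.2
    · simp
  refine this.trans ?_
  simp
  ring_nf
  rfl

theorem conv_unique (d : ℕ → ℤ) (N : ℕ)
    (h : ∀ n < N, ∑ p ∈ Finset.HasAntidiagonal.antidiagonal n, d p.1 * psiC p.2 = sC n) :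
    ∀ n < N, d n = Dn n := by
  intro n
  induction n using Nat.strong_induction_on with
  | _ n ih =>
    intro hn
    have h1 := h n hn
    have h2 := Dn_psi n
    have key : ∑ p ∈ Finset.HasAntidiagonal.antidiagonal n, (d p.1 - Dn p.1) * psiC p.2 = 0 := by
      simp only [sub_mul, Finset.sum_sub_distrib]; rw [h1, h2, sub_self]
    rw [Finset.sum_eq_single (n, 0)] at key
    · have : psiC 0 = 1 := by simp [psiC]
      simp only [this] at key
      linarith
    · rintro ⟨a, b⟩ hab hne
      have hab := Finset.HasAntidiagonal.mem_antidiagonal.1 hab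
      simp only at hab ⊢
      have : a < n := by
        rcases Nat.eq_zero_or_pos b with h0 | h0
        · exfalso; apply hne; ext <;> simp <;> omega
        · omega
      rw [ih a this (by omega)]; simp
    · intro h; exfalso; apply h; simp

theorem bigCheck_sound (X B K J : ℕ) (hX : 1 + 2 * (2 ^ K) ^ 2 + 2 ^ K * (B * (1 + 2 * 2 ^ K)) < X)
    (hJ : 2 ^ K ≤ (J + 1) * (2 * J + 1)) (hK : K ≤ 14) (hc : bigCheck X B K J = true) :
    ∀ n < 2 ^ K, 7 ≤ n → 0 < Dn n := by
  unfold bigCheck at hc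
  simp only [forceN_eq, Bool.and_eq_true] at hc
  obtain ⟨hc1, hc2⟩ := hc
  rw [Nat.beq_eq] at hc1
  have hX0 : 0 < X := by omega
  obtain ⟨d, hd, hQ⟩ := chkD_sound X B hX0 _ _ _ hc2
  set Q := _ % X ^ 2 ^ K with hQdef
  clear_value Q
  set N := 2 ^ K with hNdef
  have hN : 0 < N := by positivity
  have hp := pPart_eq X J
  have hs := sPart_eq X N J
  have t1 := psi_trunc X N J hN hJ
  have t2 := s_trunc X N J (fun j => 10 * 2 ^ (rAux N (20 * (j + 1)) 14)) hN hJ (by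
    intro j
    have := rAux_spec N (20 * (j + 1)) 14 (by
      have : 2 ^ K ≤ 2 ^ 14 := Nat.pow_le_pow_right (by omega) hK
      rw [hNdef]; nlinarith)
    calc N ≤ _ := this
      _ = _ := by ring)
  rw [← hp] at t1
  rw [← hs] at t2
  have hcz : (X : ℤ) ^ N ∣ (Q : ℤ) * (1 - ((pPart X 0 J : ℤ) - (pPart X 1 J : ℤ)))
      - (1 + ((sPart X N true J : ℤ) - (sPart X N false J : ℤ))) := by
    have e1 : (Q * (1 + pPart X 1 J) + sPart X N false J) ≡ (Q * pPart X 0 J + (1 + sPart X N true J)) [MOD X ^ N] := by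
      have a1 : Q * (1 + pPart X 1 J) + sPart X N false J ≡ Q * (1 + pPart X 1 J) + sPart X N false J % X ^ N [MOD X ^ N] :=
        Nat.ModEq.add_left _ (Nat.mod_modEq _ _).symm
      have a2 : Q * pPart X 0 J + (1 + sPart X N true J) % X ^ N ≡ Q * pPart X 0 J + (1 + sPart X N true J) [MOD X ^ N] :=
        Nat.ModEq.add_left _ (Nat.mod_modEq _ _)
      exact a1.trans (Nat.ModEq.trans hc1 a2)
    have e2 := (Nat.modEq_iff_dvd.1 e1)
    push_cast at e2
    have := e2.neg_right
    refine Eq.mpr (congrArg _ ?_) this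
    ring
  have hQz : (Q : ℤ) = ∑ i ∈ Finset.range N, (d i : ℤ) * (X : ℤ) ^ i := by
    rw [hQ]; push_cast; rfl
  have t3 := trunc_dvd (Finset.range N ×ˢ Finset.range N) (fun x => x.1 + x.2)
    (fun x => (d x.1 : ℤ) * psiC x.2) (X : ℤ) N
  have e3 : ∑ x ∈ Finset.range N ×ˢ Finset.range N, ((d x.1 : ℤ) * psiC x.2) * (X : ℤ) ^ (x.1 + x.2)
      = (Q : ℤ) * ∑ n ∈ Finset.range N, psiC n * (X : ℤ) ^ n := by
    rw [hQz, Finset.sum_mul_sum, Finset.sum_product]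
    apply Finset.sum_congr rfl; intro a _
    apply Finset.sum_congr rfl; intro b _
    rw [pow_add]; ring
  have e4 : ∀ n ∈ Finset.range N, (∑ x ∈ Finset.range N ×ˢ Finset.range N,
      if x.1 + x.2 = n then (d x.1 : ℤ) * psiC x.2 else 0) * (X : ℤ) ^ n
      = (∑ p ∈ Finset.HasAntidiagonal.antidiagonal n, (d p.1 : ℤ) * psiC p.2) * (X : ℤ) ^ n := by
    intro n hn
    rw [Finset.mem_range] at hn
    congr 1
    rw [← Finset.sum_filter]
    apply Finset.sum_congr _ (fun _ _ => rfl)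
    ext ⟨a, b⟩
    simp only [Finset.mem_filter, Finset.mem_product, Finset.mem_range, Finset.HasAntidiagonal.mem_antidiagonal]
    omega
  rw [e3, Finset.sum_congr rfl e4] at t3
  have hfin : (X : ℤ) ^ N ∣ ∑ n ∈ Finset.range N,
      ((∑ p ∈ Finset.HasAntidiagonal.antidiagonal n, (d p.1 : ℤ) * psiC p.2) - sC n) * (X : ℤ) ^ n := by
    simp only [sub_mul, Finset.sum_sub_distrib]
    have := dvd_sub (dvd_add hcz t2) (dvd_add (t1.mul_left (Q : ℤ)) t3)
    refine Eq.mpr (congrArg _ ?_) this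
    ring
  have hz := digits_zero X (by exact_mod_cast hX0) N _ (by
    intro n hn
    refine lt_of_le_of_lt ?_ (show (1 + 2 * (N : ℤ) ^ 2 + N * (B * (1 + 2 * N))) < X by exact_mod_cast hX)
    rw [sub_eq_add_neg, add_comm]
    refine (abs_add_le _ _).trans ?_
    rw [abs_neg]
    have hnN : (n : ℤ) < N := by exact_mod_cast hn
    have hn0 : (0 : ℤ) ≤ n := by positivity
    refine add_le_add ((sC_bound n).trans (by nlinarith)) ?_
    refine (Finset.abs_sum_le_sum_abs _ _).trans ?_
    have hb : ∀ p ∈ Finset.HasAntidiagonal.antidiagonal n, |(d p.1 : ℤ) * psiC p.2| ≤ B * (1 + 2 * N) := by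
      intro p hp
      have hp := Finset.HasAntidiagonal.mem_antidiagonal.1 hp
      rw [abs_mul]
      apply mul_le_mul
      · rw [Nat.abs_cast]; exact_mod_cast (hd p.1 (by omega)).1.le
      · refine (psiC_bound p.2).trans ?_
        have : (p.2 : ℤ) ≤ n := by exact_mod_cast (by omega : p.2 ≤ n)
        linarith
      · positivity
      · positivity
    refine (Finset.sum_le_sum hb).trans ?_
    rw [Finset.sum_const, Finset.Nat.card_antidiagonal, nsmul_eq_mul]
    apply mul_le_mul_of_nonneg_right _ (by positivity)
    exact_mod_cast hn) hfin
  have hu := conv_unique (fun n => (d n : ℤ)) N (fun n hn => by have := hz n hn; linarith)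
  intro n hn h7
  rw [← hu n hn]
  exact_mod_cast (hd n hn).2 (by omega)

set_option maxRecDepth 100000 in
theorem bigCheck_14 : bigCheck (2 ^ 304) (2 ^ 256) 14 92 = true := by decide +kernel

set_option exponentiation.threshold 1000 in
theorem Dn_pos_small (n : ℕ) (hn : 7 ≤ n) (h : n < 16384) : 0 < Dn n :=
  bigCheck_sound (2 ^ 304) (2 ^ 256) 14 92 (by norm_num) (by norm_num) (by norm_num) bigCheck_14 n (by norm_num; exact h) hn

open Complex in
/-- Theta constants with characteristics. -/
noncomputable def Th (a b : ℤ) (σ : ℂ) : ℂ :=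
  cexp (Real.pi * I * a ^ 2 * σ / 4) * jacobiTheta₂ (b / 2 + a * σ / 2) σ

open Complex in
theorem Th_b (a b : ℤ) (σ : ℂ) : Th a (b + 2) σ = Th a b σ := by
  unfold Th
  congr 1
  rw [← jacobiTheta₂_add_left ((b : ℂ) / 2 + a * σ / 2)]
  congr 1
  push_cast
  ring

open Complex in
theorem Th_a (a b : ℤ) (σ : ℂ) : ‖Th (a + 2) b σ‖ = ‖Th a b σ‖ := by
  unfold Th
  have h : ((b : ℂ) / 2 + ((a + 2 : ℤ) : ℂ) * σ / 2) = (b / 2 + a * σ / 2) + σ := by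
    push_cast
    ring
  rw [h, jacobiTheta₂_add_left', ← mul_assoc, ← Complex.exp_add, norm_mul, norm_mul]
  congr 1
  have h2 : (Real.pi * I * ((a + 2 : ℤ) : ℂ) ^ 2 * σ / 4 + -Real.pi * I * (σ + 2 * (b / 2 + a * σ / 2)) : ℂ)
    = Real.pi * I * a ^ 2 * σ / 4 + ((-Real.pi * b : ℝ) : ℂ) * I := by
    push_cast
    ring
  rw [h2, Complex.exp_add, norm_mul, norm_exp_ofReal_mul_I, mul_one]

open Complex in
theorem theta_T (z σ : ℂ) : jacobiTheta₂ z (σ + 1) = jacobiTheta₂ (z + 1 / 2) σ := by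
  refine tsum_congr (fun n ↦ ?_)
  unfold jacobiTheta₂_term
  rw [Complex.exp_eq_exp_iff_exists_int]
  obtain ⟨k, hk⟩ : ∃ k : ℤ, n ^ 2 = n + 2 * k := by
    have : Even (n ^ 2 - n) := by
      rw [show n ^ 2 - n = (n - 1) * (n - 1 + 1) by ring]
      exact Int.even_mul_succ_self _
    obtain ⟨k, hk⟩ := this
    exact ⟨k, by linarith⟩
  refine ⟨k, ?_⟩
  have hk' : (n : ℂ) ^ 2 = n + 2 * k := by exact_mod_cast hk
  linear_combination (Real.pi * I : ℂ) * hk'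

open Complex in
theorem Th_T (a b : ℤ) (σ : ℂ) : ‖Th a b (σ + 1)‖ = ‖Th a (a + b + 1) σ‖ := by
  unfold Th
  rw [theta_T, norm_mul, norm_mul]
  congr 1
  · have h2 : (Real.pi * I * a ^ 2 * (σ + 1) / 4 : ℂ)
      = Real.pi * I * a ^ 2 * σ / 4 + ((Real.pi * a ^ 2 / 4 : ℝ) : ℂ) * I := by
      push_cast
      ring
    rw [h2, Complex.exp_add, norm_mul, norm_exp_ofReal_mul_I, mul_one]
  · congr 2
    push_cast
    ring

open Complex in
theorem Th_S (a b : ℤ) (σ : ℂ) (hσ : σ ≠ 0) :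
    ‖Th b (-a) σ‖ = ‖σ‖ ^ (-(1 / 2) : ℝ) * ‖Th a b (-σ)⁻¹‖ := by
  unfold Th
  rw [jacobiTheta₂_functional_equation]
  have h1 : ((((-a : ℤ) : ℂ) / 2 + b * σ / 2) / σ) = b / 2 + a * (-σ)⁻¹ / 2 := by
    field_simp
    push_cast
    ring
  have h1' : (-1 / σ) = (-σ)⁻¹ := by field_simp
  rw [h1, h1']
  rw [← mul_assoc, ← mul_assoc, norm_mul, norm_mul (cexp (Real.pi * I * a ^ 2 * (-σ)⁻¹ / 4)), ← mul_assoc]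
  congr 1
  rw [mul_comm (cexp _), mul_assoc, ← Complex.exp_add, norm_mul]
  congr 1
  · rw [norm_div, norm_one, Complex.norm_cpow_of_ne_zero (by simp [hσ])]
    rw [show (1 / 2 : ℂ) = ((1 / 2 : ℝ) : ℂ) by push_cast; ring, ofReal_re, ofReal_im]
    rw [mul_zero, Real.exp_zero, div_one, Real.rpow_neg (norm_nonneg _)]
    simp
  · have h2 : ((Real.pi * I * b ^ 2 * σ / 4 + -Real.pi * I * (((-a : ℤ) : ℂ) / 2 + b * σ / 2) ^ 2 / σ) : ℂ)
      = Real.pi * I * a ^ 2 * (-σ)⁻¹ / 4 + ((Real.pi * a * b / 2 : ℝ) : ℂ) * I := by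
      push_cast
      field_simp
      ring
    rw [h2, Complex.exp_add, norm_mul, norm_exp_ofReal_mul_I, mul_one]

open UpperHalfPlane in
noncomputable def WW (x y : ℤ) (σ : ℍ) : ℝ := ‖Th (x + 1) (y + 1) (σ : ℂ)‖ * σ.im ^ (1 / 4 : ℝ)

theorem Th_b_even (a b k : ℤ) (σ : ℂ) : Th a (b + 2 * k) σ = Th a b σ := by
  induction k using Int.induction_on with
  | zero => simp
  | succ i hi => rw [← hi, ← Th_b a (b + 2 * i)]; congr 1; ring
  | pred i hi => rw [← hi, ← Th_b]; congr 1; ring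

theorem Th_a_even (a b k : ℤ) (σ : ℂ) : ‖Th (a + 2 * k) b σ‖ = ‖Th a b σ‖ := by
  induction k using Int.induction_on with
  | zero => simp
  | succ i hi => rw [← hi, ← Th_a (a + 2 * i)]; congr 2; ring
  | pred i hi => rw [← hi, ← Th_a]; congr 2; ring

open UpperHalfPlane in
theorem WW_T (x y : ℤ) (σ : ℍ) : WW x y (ModularGroup.T • σ) = WW x (x + y) σ := by
  unfold WW
  rw [modular_T_smul]
  have h1 : (((1 : ℝ) +ᵥ σ : ℍ) : ℂ) = σ + 1 := by simp [add_comm]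
  have h2 : ((1 : ℝ) +ᵥ σ : ℍ).im = σ.im := by simp
  rw [h1, h2, Th_T, show x + 1 + (y + 1) + 1 = x + y + 1 + 2 * 1 by ring, Th_b_even]

open UpperHalfPlane in
theorem WW_S (x y : ℤ) (σ : ℍ) : WW x y (ModularGroup.S • σ) = WW y (-x) σ := by
  unfold WW
  have h := Th_S (x + 1) (y + 1) (σ : ℂ) σ.ne_zero
  rw [show -x + 1 = -(x + 1) + 2 * 1 by ring, Th_b_even, h]
  rw [modular_S_smul]
  have h3 : (0:ℝ) < ‖(σ : ℂ)‖ := norm_pos_iff.mpr σ.ne_zero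
  have h2 : (UpperHalfPlane.mk (-(σ:ℂ))⁻¹ σ.im_inv_neg_coe_pos).im = σ.im * ‖(σ:ℂ)‖ ^ (-2 : ℝ) := by
    change ((-(σ:ℂ))⁻¹).im = _
    rw [Complex.inv_im, Complex.normSq_neg, Complex.neg_im, neg_neg, Complex.normSq_eq_norm_sq,
      Real.rpow_neg h3.le, div_eq_mul_inv]
    norm_num
  rw [h2, Real.mul_rpow σ.im_pos.le (by positivity), ← Real.rpow_mul h3.le]
  norm_num
  ring

open UpperHalfPlane Matrix in
theorem WW_smul (g : SpecialLinearGroup (Fin 2) ℤ) : ∀ (x y : ℤ) (σ : ℍ),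
    WW x y (g • σ) = WW (x * g 0 0 + y * g 1 0) (x * g 0 1 + y * g 1 1) σ := by
  have hg : g ∈ Subgroup.closure {ModularGroup.S, ModularGroup.T} := by
    simp [SpecialLinearGroup.SL2Z_generators]
  induction hg using Subgroup.closure_induction with
  | mem g h =>
    intro x y σ
    rcases h with rfl | h
    · rw [WW_S]
      simp [ModularGroup.S]
    · rw [Set.mem_singleton_iff] at h
      subst h
      rw [WW_T]
      simp [ModularGroup.T]
  | one => intro x y σ; simp
  | mul g h _ _ ihg ihh =>
    intro x y σ
    rw [mul_smul, ihg, ihh]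
    congr 1
    · simp [Matrix.mul_apply, Fin.sum_univ_two]; ring
    · simp [Matrix.mul_apply, Fin.sum_univ_two]; ring
  | inv g _ ih =>
    intro x y σ
    have hd := g.det_coe
    rw [Matrix.det_fin_two] at hd
    have := ih (x * g⁻¹ 0 0 + y * g⁻¹ 1 0) (x * g⁻¹ 0 1 + y * g⁻¹ 1 1) (g⁻¹ • σ)
    rw [smul_inv_smul] at this
    rw [this]
    congr 1
    · simp [Matrix.SpecialLinearGroup.SL2_inv_expl]
      linear_combination (-x) * hd
    · simp [Matrix.SpecialLinearGroup.SL2_inv_expl]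
      linear_combination (-y) * hd

theorem hasSum_near_two {g : ℕ → ℂ} {s : ℂ} (h : HasSum g s) {r : ℝ} (hr0 : 0 ≤ r) (hr : r ≤ 7 / 100)
    (h0 : g 0 = 2) (hg : ∀ n, ‖g n‖ ≤ 2 * r ^ n) : ‖s - 2‖ ≤ 16 / 100 := by
  have h1 : HasSum (fun n => g (n + 1)) (s - 2) := by
    have := (hasSum_nat_add_iff' 1).mpr h
    simpa [h0] using this
  have h2 : HasSum (fun n : ℕ => 2 * r * r ^ n) (2 * r * (1 - r)⁻¹) :=
    (hasSum_geometric_of_lt_one hr0 (by linarith)).mul_left _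
  have h3 := h1.norm_le_of_bounded h2 (fun n => by
    refine (hg (n + 1)).trans (le_of_eq ?_)
    ring)
  refine h3.trans ?_
  rw [← div_eq_mul_inv, div_le_iff₀ (by linarith)]
  linarith

theorem exp_fd_bound {y : ℝ} (hy : 3 ≤ 4 * y ^ 2) (hy0 : 0 < y) : Real.exp (-(Real.pi * y)) ≤ 7 / 100 := by
  have h1 : (0.866 : ℝ) ≤ y := by nlinarith
  have h2 : (2.66 : ℝ) ≤ Real.pi * y := by nlinarith [Real.pi_gt_d2]
  have h3 : Real.exp (2.66 : ℝ) ≥ 100 / 7 := by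
    have := Real.exp_one_gt_d9
    have h4 : Real.exp (2.66 : ℝ) = Real.exp 1 ^ 2 * Real.exp (0.66) := by
      rw [← Real.exp_nat_mul, ← Real.exp_add]; norm_num
    have h5 : (1.9345 : ℝ) ≤ Real.exp 0.66 := by
      have := Real.sum_le_exp_of_nonneg (x := 0.66) (by norm_num) 6
      refine le_trans ?_ this
      norm_num [Finset.sum_range_succ, Nat.factorial]
    have h6 : (7.389 : ℝ) ≤ Real.exp 1 ^ 2 := by nlinarith
    rw [h4]
    nlinarith
  rw [Real.exp_neg]
  rw [inv_le_comm₀ (Real.exp_pos _) (by norm_num)]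
  calc (7 / 100 : ℝ)⁻¹ = 100 / 7 := by norm_num
    _ ≤ _ := h3
    _ ≤ _ := Real.exp_le_exp.mpr h2

open Complex UpperHalfPlane in
theorem Th0_lower (b : ℤ) (σ : ℍ) (hy : 3 ≤ 4 * σ.im ^ 2) : 84 / 100 ≤ ‖Th 0 b σ‖ := by
  have h := hasSum_jacobiTheta₂_term ((b : ℂ) / 2) (τ := (σ : ℂ)) σ.im_pos
  have h2 := h.nat_add_neg
  have hb : ∀ n : ℤ, ‖jacobiTheta₂_term n (b / 2) σ‖ ≤ Real.exp (-(Real.pi * σ.im)) ^ n.natAbs := by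
    intro n
    rw [norm_jacobiTheta₂_term, ← Real.exp_nat_mul]
    apply Real.exp_le_exp.mpr
    have h0 : ((b : ℂ) / 2).im = 0 := by
      rw [show ((b : ℂ) / 2) = ((b / 2 : ℝ) : ℂ) by push_cast; ring, ofReal_im]
    rw [h0]
    have h3 : ((n.natAbs : ℝ)) ≤ (n : ℝ) ^ 2 := by
      have : (n.natAbs : ℤ) ≤ n ^ 2 := by
        rw [← Int.natAbs_sq, sq]
        have : n.natAbs ≤ n.natAbs * n.natAbs := Nat.le_mul_self _
        exact_mod_cast this
      have h4 := (Int.cast_le (R := ℝ)).mpr this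
      rw [Int.cast_natCast] at h4
      exact_mod_cast h4
    have h4 : 0 < Real.pi * σ.im := mul_pos Real.pi_pos σ.im_pos
    rw [UpperHalfPlane.coe_im]
    nlinarith
  have h3 := hasSum_near_two h2 (Real.exp_pos _).le (exp_fd_bound hy σ.im_pos) (by
      simp [jacobiTheta₂_term]; norm_num) (fun n => by
      refine (norm_add_le _ _).trans ?_
      have h1 := hb n
      have h2 := hb (-n)
      simp only [Int.natAbs_neg, Int.natAbs_natCast] at h1 h2
      linarith)
  unfold Th
  have h5 : jacobiTheta₂_term 0 (b / 2) σ = 1 := by simp [jacobiTheta₂_term]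
  rw [h5] at h3
  simp only [Int.cast_zero, zero_mul, zero_div, add_zero, ne_eq, OfNat.ofNat_ne_zero, not_false_eq_true, zero_pow, mul_zero, Complex.exp_zero, one_mul]
  have h6 : (1 : ℂ) = jacobiTheta₂ (b / 2) σ - (jacobiTheta₂ (b / 2) σ + 1 - 2) := by ring
  have h7 := congrArg norm h6
  rw [norm_one] at h7
  have := norm_sub_le (jacobiTheta₂ (b / 2) σ) (jacobiTheta₂ (b / 2) σ + 1 - 2)
  linarith

open Complex UpperHalfPlane in
theorem Th1_lower (σ : ℍ) (hy : 3 ≤ 4 * σ.im ^ 2) :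
    84 / 100 * Real.exp (-(Real.pi * σ.im / 4)) ≤ ‖Th 1 0 σ‖ := by
  have h := hasSum_jacobiTheta₂_term ((σ : ℂ) / 2) (τ := (σ : ℂ)) σ.im_pos
  have h2 := h.nat_add_neg_add_one
  have hb : ∀ n : ℕ, ‖jacobiTheta₂_term n (σ / 2) σ‖ ≤ Real.exp (-(Real.pi * σ.im)) ^ n := by
    intro n
    rw [norm_jacobiTheta₂_term, ← Real.exp_nat_mul]
    apply Real.exp_le_exp.mpr
    have h0 : ((σ : ℂ) / 2).im = σ.im / 2 := by simp
    rw [h0, UpperHalfPlane.coe_im]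
    have h4 : 0 < Real.pi * σ.im := mul_pos Real.pi_pos σ.im_pos
    push_cast
    nlinarith [mul_nonneg h4.le (sq_nonneg (n:ℝ))]
  have he : ∀ n : ℕ, jacobiTheta₂_term (-((n : ℤ) + 1)) (σ / 2) σ = jacobiTheta₂_term n (σ / 2) σ := by
    intro n
    unfold jacobiTheta₂_term
    congr 1
    push_cast
    ring
  have h3 := hasSum_near_two h2 (Real.exp_pos _).le (exp_fd_bound hy σ.im_pos) (by
      rw [he]
      simp [jacobiTheta₂_term]; norm_num) (fun n => by
      refine (norm_add_le _ _).trans ?_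
      rw [he]
      linarith [hb n])
  unfold Th
  have h6 : (2 : ℂ) = jacobiTheta₂ (σ / 2) σ - (jacobiTheta₂ (σ / 2) σ - 2) := by ring
  have h7 := congrArg norm h6
  have := norm_sub_le (jacobiTheta₂ (σ / 2) σ) (jacobiTheta₂ (σ / 2) σ - 2)
  have h8 : ‖(2:ℂ)‖ = 2 := by simp
  rw [norm_mul, mul_comm]
  have h9 : ‖cexp (Real.pi * Complex.I * ((1 : ℤ) : ℂ) ^ 2 * σ / 4)‖ = Real.exp (-(Real.pi * σ.im / 4)) := by
    rw [Complex.norm_exp]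
    congr 1
    simp [Complex.div_re, Complex.mul_re, Complex.mul_im, Complex.normSq_apply]
    ring
  rw [h9]
  have h10 : ((0 : ℤ) : ℂ) / 2 + ((1 : ℤ) : ℂ) * σ / 2 = σ / 2 := by push_cast; ring
  rw [h10]
  gcongr
  linarith

open Complex UpperHalfPlane Matrix in
theorem theta2_lower (σ : ℍ) (hσ : 4 * σ.im ^ 2 ≤ 3) (Y : ℝ) (hY : 0 ≤ Y)
    (H : ∀ c d : ℤ, Even c → Odd d → 3 / 4 ≤ (σ.im / Complex.normSq (c * σ + d)) ^ 2 →
      σ.im / Complex.normSq (c * σ + d) ≤ Y) :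
    84 / 100 * Real.exp (-(Real.pi * Y / 4)) ≤ ‖jacobiTheta₂ (σ / 2) σ‖ := by
  obtain ⟨g, hg⟩ := ModularGroup.exists_smul_mem_fd σ
  have h1 := ModularGroup.three_le_four_mul_im_sq_of_mem_fd hg
  have him : (g • σ).im = σ.im / Complex.normSq (g 1 0 * σ + g 1 1) := by
    rw [ModularGroup.im_smul_eq_div_normSq, ModularGroup.denom_apply]
  have hd := g.det_coe
  rw [Matrix.det_fin_two] at hd
  have hW := WW_smul g (g 1 0) (-(g 0 0)) σ
  have e1 : g 1 0 * g 0 0 + -(g 0 0) * g 1 0 = 0 := by ring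
  have e2 : g 1 0 * g 0 1 + -(g 0 0) * g 1 1 = -1 := by linarith
  rw [e1, e2] at hW
  unfold WW at hW
  rw [show (0 : ℤ) + 1 = 1 by rfl, show (-1 : ℤ) + 1 = 0 by rfl] at hW
  -- lower bound at the point of the fundamental domain
  have key : 84 / 100 * Real.exp (-(Real.pi * Y / 4)) ≤ ‖Th (g 1 0 + 1) (-(g 0 0) + 1) ((g • σ : ℍ) : ℂ)‖ := by
    rcases Int.even_or_odd (g 1 0) with hc | hc
    · have hdo : Odd (g 1 1) ∧ Odd (g 0 0) := by
        have : Odd (g 0 0 * g 1 1) := by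
          have h2 : g 0 0 * g 1 1 = 1 + g 0 1 * g 1 0 := by linarith
          rw [h2]
          exact odd_one.add_even (hc.mul_left _)
        exact ⟨(Int.odd_mul.mp this).2, (Int.odd_mul.mp this).1⟩
      obtain ⟨k, hk⟩ := hc
      obtain ⟨l, hl⟩ := hdo.2
      have e3 : g 1 0 + 1 = 1 + 2 * k := by omega
      have e4 : -(g 0 0) + 1 = 0 + 2 * (-l) := by omega
      rw [e3, e4, Th_b_even, Th_a_even]
      refine le_trans ?_ (Th1_lower (g • σ) h1)
      have hle : (g • σ).im ≤ Y := by
        rw [him]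
        apply H _ _ ⟨k, hk⟩ hdo.1
        rw [← him]
        linarith
      gcongr
    · obtain ⟨k, hk⟩ := hc
      have e3 : g 1 0 + 1 = 0 + 2 * (k + 1) := by omega
      rw [e3, Th_a_even]
      refine le_trans ?_ (Th0_lower _ (g • σ) h1)
      have : Real.exp (-(Real.pi * Y / 4)) ≤ 1 := by
        apply Real.exp_le_one_iff.mpr
        have := mul_nonneg Real.pi_pos.le hY
        linarith
      linarith
  have hp : (0:ℝ) < σ.im ^ (1 / 4 : ℝ) := Real.rpow_pos_of_pos σ.im_pos _
  have hle : σ.im ^ (1 / 4 : ℝ) ≤ (g • σ).im ^ (1 / 4 : ℝ) := by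
    apply Real.rpow_le_rpow σ.im_pos.le _ (by norm_num)
    have : 0 < (g • σ).im := (g • σ).im_pos
    nlinarith
  have h3 : 84 / 100 * Real.exp (-(Real.pi * Y / 4)) ≤ ‖Th 1 0 (σ : ℂ)‖ := by
    by_contra hcon
    push Not at hcon
    have : ‖Th 1 0 (σ : ℂ)‖ * σ.im ^ (1 / 4 : ℝ) <
        ‖Th (g 1 0 + 1) (-(g 0 0) + 1) ((g • σ : ℍ) : ℂ)‖ * (g • σ).im ^ (1 / 4 : ℝ) := by
      calc _ < 84 / 100 * Real.exp (-(Real.pi * Y / 4)) * σ.im ^ (1 / 4 : ℝ) := by gcongr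
        _ ≤ _ := by gcongr
    rw [hW] at this
    exact absurd this (lt_irrefl _)
  refine h3.trans ?_
  unfold Th
  rw [norm_mul]
  have h9 : ‖cexp (Real.pi * Complex.I * ((1 : ℤ) : ℂ) ^ 2 * σ / 4)‖ ≤ 1 := by
    rw [Complex.norm_exp]
    apply Real.exp_le_one_iff.mpr
    have := mul_pos Real.pi_pos σ.im_pos
    simp [Complex.div_re, Complex.mul_re, Complex.mul_im, Complex.normSq_apply]
    linarith
  have h10 : ((0 : ℤ) : ℂ) / 2 + ((1 : ℤ) : ℂ) * σ / 2 = σ / 2 := by push_cast; ring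
  rw [h10]
  exact mul_le_of_le_one_left (norm_nonneg _) h9

theorem hasSum_int_even_add_odd {f : ℤ → ℂ} {a b : ℂ} (he : HasSum (fun n => f (2 * n)) a)
    (ho : HasSum (fun n => f (2 * n + 1)) b) : HasSum f (a + b) := by
  have h1 : Function.Injective (fun n : ℤ => 2 * n) := fun a b h => by simpa using h
  have h2 : Function.Injective (fun n : ℤ => 2 * n + 1) := fun a b h => by simpa using h
  have he' := h1.hasSum_range_iff.mpr he
  have ho' := h2.hasSum_range_iff.mpr ho
  refine he'.add_isCompl ?_ ho'
  constructor
  · rw [Set.disjoint_iff]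
    rintro x ⟨⟨a, ha⟩, ⟨b, hb⟩⟩
    simp only at ha hb
    omega
  · rw [codisjoint_iff]; refine Set.eq_univ_iff_forall.mpr ?_
    intro x
    rcases Int.even_or_odd' x with ⟨k, hk | hk⟩
    · exact Or.inl ⟨k, hk.symm⟩
    · exact Or.inr ⟨k, hk.symm⟩

open Complex in
/-- The theta function `ψ(-q)` with `q = exp (-τ)`. -/
noncomputable def psiT (τ : ℂ) : ℂ := jacobiTheta₂ (1 / 2 + I * τ / (2 * Real.pi)) (2 * I * τ / Real.pi)

open Complex in
theorem psiT_term (τ : ℂ) (n : ℤ) : jacobiTheta₂_term n (1 / 2 + I * τ / (2 * Real.pi)) (2 * I * τ / Real.pi)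
    = (-1) ^ n * cexp (-((2 * n ^ 2 + n) * τ)) := by
  unfold jacobiTheta₂_term
  have hpi : (Real.pi : ℂ) ≠ 0 := by exact_mod_cast Real.pi_ne_zero
  rw [← Complex.exp_pi_mul_I, ← Complex.exp_int_mul, ← Complex.exp_add]
  congr 1
  field_simp
  ring_nf
  rw [I_sq]
  ring

open Complex in
theorem psiT_hasSum (τ : ℂ) (hτ : 0 < τ.re) :
    HasSum (fun n : ℤ => (-1 : ℂ) ^ n * cexp (-((2 * n ^ 2 + n) * τ))) (psiT τ) := by
  have him : 0 < (2 * I * τ / Real.pi).im := by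
    rw [show 2 * I * τ / Real.pi = ((2 / Real.pi : ℝ) : ℂ) * (I * τ) by push_cast; ring, Complex.im_ofReal_mul]
    simp
    positivity
  have := hasSum_jacobiTheta₂_term (1 / 2 + I * τ / (2 * Real.pi)) him
  simp_rw [psiT_term] at this
  exact this

open Complex in
noncomputable def sigT (τ : ℂ) : ℂ := 1 / 2 + I * τ / (2 * Real.pi)

open Complex in
theorem sigT_im (τ : ℂ) : (sigT τ).im = τ.re / (2 * Real.pi) := by
  unfold sigT
  rw [show I * τ / (2 * Real.pi) = ((1 / (2 * Real.pi) : ℝ) : ℂ) * (I * τ) by push_cast; ring, Complex.add_im, Complex.im_ofReal_mul]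
  simp
  ring

open Complex in
theorem sigT_re (τ : ℂ) : (sigT τ).re = 1 / 2 - τ.im / (2 * Real.pi) := by
  unfold sigT
  rw [show I * τ / (2 * Real.pi) = ((1 / (2 * Real.pi) : ℝ) : ℂ) * (I * τ) by push_cast; ring, Complex.add_re, Complex.re_ofReal_mul]
  simp
  ring

open Complex in
theorem psiT_two (τ : ℂ) (hτ : 0 < τ.re) : jacobiTheta₂ (sigT τ / 2) (sigT τ) = 2 * psiT τ := by
  have him : 0 < (sigT τ).im := by rw [sigT_im]; positivity
  have h := hasSum_jacobiTheta₂_term (sigT τ / 2) him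
  have hpi : (Real.pi : ℂ) ≠ 0 := by exact_mod_cast Real.pi_ne_zero
  have hP := psiT_hasSum τ hτ
  have he : HasSum (fun n : ℤ => jacobiTheta₂_term (2 * n) (sigT τ / 2) (sigT τ)) (psiT τ) := by
    convert hP using 2 with n
    unfold jacobiTheta₂_term sigT
    rw [← Complex.exp_pi_mul_I, ← Complex.exp_int_mul, ← Complex.exp_add, Complex.exp_eq_exp_iff_exists_int]
    refine ⟨n ^ 2, ?_⟩
    push_cast
    field_simp
    ring_nf
    rw [I_sq]
    ring
  have ho : HasSum (fun n : ℤ => jacobiTheta₂_term (2 * n + 1) (sigT τ / 2) (sigT τ)) (psiT τ) := by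
    rw [← (((Equiv.neg ℤ).trans (Equiv.addRight (-1)))).hasSum_iff]
    convert he using 2 with n
    simp only [Function.comp, Equiv.trans_apply, Equiv.neg_apply, Equiv.coe_addRight]
    unfold jacobiTheta₂_term
    congr 1
    push_cast
    ring
  have := hasSum_int_even_add_odd (f := fun n => jacobiTheta₂_term n (sigT τ / 2) (sigT τ)) he ho
  rw [h.unique this]
  ring

open Complex in
theorem psiT_ne_zero (τ : ℂ) (hτ : 0 < τ.re) : psiT τ ≠ 0 := by
  have him : 0 < (sigT τ).im := by rw [sigT_im]; positivity
  intro h0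
  have h2 := psiT_two τ hτ
  rw [h0, mul_zero] at h2
  rcases le_total (4 * (sigT τ).im ^ 2) 3 with h | h
  · have := theta2_lower ⟨sigT τ, him⟩ h ((sigT τ).im + 1 / (sigT τ).im) (by positivity) (by
      intro c d hc hd _
      change (sigT τ).im / normSq (c * sigT τ + d) ≤ _
      have h3 : (c : ℝ) ^ 2 * (sigT τ).im ^ 2 ≤ normSq (c * sigT τ + d) := by
        rw [normSq_apply]
        simp
        nlinarith [mul_self_nonneg ((c : ℝ) * (sigT τ).re + d)]
      rcases eq_or_ne c 0 with rfl | hc0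
      · have h4 : (1 : ℝ) ≤ normSq (((0 : ℤ) : ℂ) * sigT τ + d) := by
          simp [normSq_apply]
          have : (1 : ℤ) ≤ d * d := by
            have : d ≠ 0 := by rintro rfl; simp at hd
            have := mul_self_pos.mpr this
            linarith
          exact_mod_cast this
        have h5 : (sigT τ).im / normSq (((0 : ℤ) : ℂ) * sigT τ + d) ≤ (sigT τ).im :=
          div_le_self him.le h4
        have : 0 < 1 / (sigT τ).im := by positivity
        linarith
      · have h4 : (1 : ℝ) ≤ (c : ℝ) ^ 2 := by
          have : (1 : ℤ) ≤ c ^ 2 := by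
            have := sq_pos_of_ne_zero hc0
            linarith
          exact_mod_cast this
        have h5 : (sigT τ).im ^ 2 ≤ normSq (c * sigT τ + d) := by nlinarith [sq_nonneg (sigT τ).im]
        have h6 : (sigT τ).im / normSq (c * sigT τ + d) ≤ (sigT τ).im / (sigT τ).im ^ 2 := by gcongr
        have h7 : (sigT τ).im / (sigT τ).im ^ 2 = 1 / (sigT τ).im := by field_simp
        linarith)
    change _ ≤ ‖jacobiTheta₂ (sigT τ / 2) (sigT τ)‖ at this
    rw [h2, norm_zero] at this
    have h3 := Real.exp_pos (-(Real.pi * ((sigT τ).im + 1 / (sigT τ).im) / 4))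
    change 84 / 100 * Real.exp (-(Real.pi * ((sigT τ).im + 1 / (sigT τ).im) / 4)) ≤ 0 at this
    linarith
  · have := Th1_lower ⟨sigT τ, him⟩ h
    unfold Th at this
    change _ ≤ ‖cexp _ * jacobiTheta₂ (((0 : ℤ) : ℂ) / 2 + ((1 : ℤ) : ℂ) * sigT τ / 2) (sigT τ)‖ at this
    have h10 : ((0 : ℤ) : ℂ) / 2 + ((1 : ℤ) : ℂ) * sigT τ / 2 = sigT τ / 2 := by push_cast; ring
    rw [h10, h2, mul_zero, norm_zero] at this
    have h3 := Real.exp_pos (-(Real.pi * (UpperHalfPlane.im ⟨sigT τ, him⟩) / 4))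
    linarith

open Complex in
theorem psiT_minor (τ : ℂ) (hτ : 0 < τ.re) (ht : τ.re ≤ 1) (him : |τ.im| ≤ Real.pi)
    (h3 : 3 * τ.re ^ 2 ≤ τ.im ^ 2) :
    42 / 100 * Real.exp (-(Real.pi ^ 2 / (32 * τ.re))) ≤ ‖psiT τ‖ := by
  have hi : 0 < (sigT τ).im := by rw [sigT_im]; positivity
  have hpi := Real.pi_gt_three
  have hpi0 := Real.pi_pos
  have him' : (sigT τ).im ≤ 1 / 6 := by
    rw [sigT_im, div_le_div_iff₀ (by positivity) (by norm_num)]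
    linarith
  have hh : 4 * (sigT τ).im ^ 2 ≤ 3 := by nlinarith
  have := theta2_lower ⟨sigT τ, hi⟩ hh (Real.pi / (8 * τ.re)) (by positivity) (by
      intro c d hc hd h34
      change 3 / 4 ≤ ((sigT τ).im / normSq (c * sigT τ + d)) ^ 2 at h34
      change (sigT τ).im / normSq (c * sigT τ + d) ≤ _
      obtain ⟨k, hk⟩ := hc
      obtain ⟨l, hl⟩ := hd
      have hN : Real.pi ^ 2 * normSq (c * sigT τ + d) =
          (k * (Real.pi - τ.im) + d * Real.pi) ^ 2 + k ^ 2 * τ.re ^ 2 := by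
        rw [normSq_apply]
        simp only [add_re, mul_re, intCast_re, intCast_im, add_im, mul_im, sigT_im, sigT_re, hk]
        push_cast
        field_simp
        ring
      have key : k ≠ 0 → 4 * τ.re ^ 2 ≤ Real.pi ^ 2 * normSq (c * sigT τ + d) := by
        intro hk0
        rw [hN]
        by_cases h2 : 2 ≤ |k|
        · have : (4 : ℝ) ≤ (k : ℝ) ^ 2 := by
            have : (4 : ℤ) ≤ k ^ 2 := by
              rw [← sq_abs]; nlinarith
            exact_mod_cast this
          nlinarith [sq_nonneg (k * (Real.pi - τ.im) + d * Real.pi), sq_nonneg τ.re]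
        · have hk1 : k = 1 ∨ k = -1 := by
            have : 1 ≤ |k| := Int.one_le_abs hk0
            have : |k| = 1 := by omega
            exact (abs_eq (by norm_num)).mp this
          have habs := abs_le.mp him
          have main : ∀ m : ℤ, τ.im ^ 2 ≤ (2 * m * Real.pi - τ.im) ^ 2 := by
            intro m
            have hm : 0 ≤ (m : ℝ) * (m * Real.pi - τ.im) := by
              rcases lt_trichotomy m 0 with h | h | h
              · have : (m : ℝ) ≤ -1 := by exact_mod_cast (by omega : m ≤ -1)
                have h5 : m * Real.pi - τ.im ≤ 0 := by nlinarith
                nlinarith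
              · simp [h]
              · have : (1 : ℝ) ≤ m := by exact_mod_cast (by omega : 1 ≤ m)
                have h5 : 0 ≤ m * Real.pi - τ.im := by nlinarith
                nlinarith
            nlinarith [mul_nonneg hm hpi0.le]
          rcases hk1 with h | h
          · have := main (l + 1)
            rw [h, hl]
            push_cast at this ⊢
            nlinarith
          · have := main (-l)
            rw [h, hl]
            push_cast at this ⊢
            nlinarith
      rcases eq_or_ne k 0 with hk0 | hk0
      · exfalso
        have hc0 : c = 0 := by omega
        have h4 : (1 : ℝ) ≤ normSq ((c : ℂ) * sigT τ + d) := by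
          rw [hc0]
          simp [normSq_apply]
          have : (1 : ℤ) ≤ d * d := by
            have : d ≠ 0 := by omega
            have := mul_self_pos.mpr this
            linarith
          exact_mod_cast this
        have h5 : (sigT τ).im / normSq (c * sigT τ + d) ≤ (sigT τ).im :=
          div_le_self hi.le h4
        have h6 : 0 ≤ (sigT τ).im / normSq (c * sigT τ + d) := div_nonneg hi.le (normSq_nonneg _)
        nlinarith
      · have h4 := key hk0
        have hpos : 0 < normSq (c * sigT τ + d) := by
          by_contra hcon
          push Not at hcon
          have : 0 < τ.re ^ 2 := by positivity
          nlinarith [sq_nonneg Real.pi, mul_nonneg (sq_nonneg Real.pi) (neg_nonneg.mpr hcon)]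
        rw [sigT_im, div_div, div_le_div_iff₀ (by positivity) (by positivity)]
        nlinarith)
  change _ ≤ ‖jacobiTheta₂ (sigT τ / 2) (sigT τ)‖ at this
  rw [psiT_two τ hτ, norm_mul] at this
  have e : Real.pi * (Real.pi / (8 * τ.re)) / 4 = Real.pi ^ 2 / (32 * τ.re) := by field_simp; norm_num
  rw [e] at this
  simp at this
  linarith

theorem hasSum_fiber {ι : Type*} (f : ι → ℂ) (g : ι → ℕ) (T : ℕ → Finset ι) (hT : ∀ i, i ∈ T (g i))
    {s : ℂ} (h : HasSum f s) : HasSum (fun n => ∑ i ∈ T n, if g i = n then f i else 0) s := by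
  have h1 := (Equiv.sigmaFiberEquiv g).hasSum_iff.mpr h
  refine h1.sigma (fun n => ?_)
  have h2 : HasSum (fun i => if g i = n then f i else 0) (∑ i ∈ T n, if g i = n then f i else 0) := by
    apply hasSum_sum_of_ne_finset_zero
    intro i hi
    rw [if_neg]
    rintro rfl
    exact hi (hT i)
  have h3 : HasSum ((f ∘ Subtype.val) : {i | g i = n} → ℂ) (∑ i ∈ T n, if g i = n then f i else 0) := by
    rw [hasSum_subtype_iff_indicator]
    convert h2 using 2 with i
    simp [Set.indicator]
  exact h3

open Complex in
theorem psiC_hasSum (τ : ℂ) (hτ : 0 < τ.re) :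
    HasSum (fun n : ℕ => (psiC n : ℂ) * cexp (-τ) ^ n) (psiT τ) := by
  have h := psiT_hasSum τ hτ
  set f : ℤ → ℂ := fun n : ℤ => (-1 : ℂ) ^ n * cexp (-((2 * n ^ 2 + n) * τ)) with hf
  have hA : Summable (fun i : ℕ => f ((i : ℤ) + 1)) :=
    h.summable.comp_injective (i := fun i : ℕ => (i : ℤ) + 1) (fun a b hab => by simpa using hab)
  have hB : Summable (fun i : ℕ => f (-((i : ℤ) + 1))) :=
    h.summable.comp_injective (i := fun i : ℕ => -((i : ℤ) + 1)) (fun a b hab => by simpa using hab)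
  have hN : HasSum (fun i : ℕ => f (i : ℤ)) (f 0 + ∑' i : ℕ, f ((i : ℤ) + 1)) := by
    rw [add_comm]
    have h0 : HasSum (fun i : ℕ => f ((i + 1 : ℕ) : ℤ)) (∑' i : ℕ, f ((i : ℤ) + 1)) := by
      simpa using hA.hasSum
    have := (hasSum_nat_add_iff (f := fun i : ℕ => f (i : ℤ)) 1).mp h0
    simpa using this
  have hZ := HasSum.of_nat_of_neg_add_one hN hB.hasSum
  have hval := h.unique hZ
  have eA : ∀ i : ℕ, f ((i : ℤ) + 1) = -((-1) ^ i * cexp (-τ) ^ ((i + 1) * (2 * i + 3))) := by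
    intro i
    simp only [hf]
    rw [← Complex.exp_nat_mul]
    rw [show ((i : ℤ) + 1) = ((i + 1 : ℕ) : ℤ) by push_cast; rfl, zpow_natCast, pow_succ]
    push_cast
    rw [show (-((2 * ((i : ℂ) + 1) ^ 2 + (i + 1)) * τ)) = ((i : ℂ) + 1) * (2 * i + 3) * -τ by ring]
    ring
  have eB : ∀ i : ℕ, f (-((i : ℤ) + 1)) = -((-1) ^ i * cexp (-τ) ^ ((i + 1) * (2 * i + 1))) := by
    intro i
    simp only [hf]
    rw [← Complex.exp_nat_mul]
    rw [show (-((i : ℤ) + 1)) = -((i + 1 : ℕ) : ℤ) by push_cast; rfl, zpow_neg, zpow_natCast, pow_succ]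
    push_cast
    rw [show (-((2 * (-((i : ℂ) + 1)) ^ 2 + -((i : ℂ) + 1)) * τ)) = ((i : ℂ) + 1) * (2 * i + 1) * -τ by ring]
    rcases neg_one_pow_eq_or ℂ i with h | h <;> rw [h] <;> simp <;> ring_nf
  have fA := hasSum_fiber _ (fun i => (i + 1) * (2 * i + 3)) (fun n => Finset.range n)
    (fun i => by simp only [Finset.mem_range]; nlinarith) hA.hasSum
  have fB := hasSum_fiber _ (fun i => (i + 1) * (2 * i + 1)) (fun n => Finset.range n)
    (fun i => by simp only [Finset.mem_range]; nlinarith) hB.hasSum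
  have f0 : HasSum (fun n : ℕ => if n = 0 then (1 : ℂ) else 0) 1 := by
    convert hasSum_ite_eq (0 : ℕ) (1 : ℂ) using 2
  have f00 : f 0 = 1 := by simp [hf]
  rw [hval, f00]
  convert (f0.add fA).add fB using 2 with n
  unfold psiC
  push_cast
  rw [sub_mul, add_mul, sub_eq_add_neg, neg_add, ← neg_mul, ← neg_mul, ← Finset.sum_neg_distrib, ← Finset.sum_neg_distrib, Finset.sum_mul, Finset.sum_mul]
  rw [add_assoc, add_comm (∑ i ∈ Finset.range n, if (i + 1) * (2 * i + 3) = n then f ((i : ℤ) + 1) else 0)]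
  congr 1
  · split_ifs with h0
    · simp [h0]
    · simp
  congr 1
  · apply Finset.sum_congr rfl
    intro i _
    split_ifs with h0
    · rw [eB, h0]; ring
    · simp
  · apply Finset.sum_congr rfl
    intro i _
    split_ifs with h0
    · rw [eA, h0]; ring
    · simp

open Complex in
noncomputable def SerT (τ : ℂ) : ℂ :=
  1 + ∑' x : ℕ × ℕ, (-1 : ℂ) ^ (x.1 + 1) * kap x.2 * cexp (-τ) ^ ((x.1 + 1) * (2 * x.1 + 3 + 2 * x.2))

theorem ST_term_bound (q : ℂ) (hq : ‖q‖ ≤ 1) (x : ℕ × ℕ) :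
    ‖(-1 : ℂ) ^ (x.1 + 1) * kap x.2 * q ^ ((x.1 + 1) * (2 * x.1 + 3 + 2 * x.2))‖ ≤
      2 * (‖q‖ ^ x.1 * ‖q‖ ^ x.2) := by
  rw [norm_mul, norm_mul, norm_pow, norm_neg, norm_one, one_pow, one_mul, norm_pow, ← pow_add]
  have h1 : ‖((kap x.2 : ℤ) : ℂ)‖ ≤ 2 := by
    rw [Complex.norm_intCast]
    exact_mod_cast kap_bound x.2
  have h2 : ‖q‖ ^ ((x.1 + 1) * (2 * x.1 + 3 + 2 * x.2)) ≤ ‖q‖ ^ (x.1 + x.2) :=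
    pow_le_pow_of_le_one (norm_nonneg _) hq (by nlinarith)
  gcongr

theorem geom2_hasSum (r : ℝ) (h0 : 0 ≤ r) (h1 : r < 1) :
    HasSum (fun x : ℕ × ℕ => 2 * (r ^ x.1 * r ^ x.2)) (2 * ((1 - r)⁻¹ * (1 - r)⁻¹)) := by
  have h := hasSum_geometric_of_lt_one h0 h1
  have hs := h.summable.mul_of_nonneg h.summable (fun n => by positivity) (fun n => by positivity)
  exact (h.mul h hs).mul_left 2

theorem ST_summable (q : ℂ) (hq : ‖q‖ < 1) :
    Summable (fun x : ℕ × ℕ => (-1 : ℂ) ^ (x.1 + 1) * kap x.2 * q ^ ((x.1 + 1) * (2 * x.1 + 3 + 2 * x.2))) :=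
  Summable.of_norm_bounded (geom2_hasSum _ (norm_nonneg _) hq).summable (ST_term_bound q hq.le)

theorem norm_exp_neg (τ : ℂ) : ‖Complex.exp (-τ)‖ = Real.exp (-τ.re) := by
  rw [Complex.norm_exp, Complex.neg_re]

theorem norm_exp_neg_lt (τ : ℂ) (hτ : 0 < τ.re) : ‖Complex.exp (-τ)‖ < 1 := by
  rw [norm_exp_neg]
  exact Real.exp_lt_one_iff.mpr (by linarith)

theorem ST_bound (τ : ℂ) (hτ : 0 < τ.re) :
    ‖SerT τ‖ ≤ 1 + 2 / (1 - Real.exp (-τ.re)) ^ 2 := by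
  unfold SerT
  have hq := norm_exp_neg_lt τ hτ
  have h := (ST_summable _ hq).hasSum.norm_le_of_bounded (geom2_hasSum _ (norm_nonneg _) hq) (ST_term_bound _ hq.le)
  refine (norm_add_le _ _).trans ?_
  rw [norm_one]
  refine (add_le_add_right h 1).trans (le_of_eq ?_)
  rw [norm_exp_neg, ← mul_inv, ← sq, div_eq_mul_inv]

theorem sC_hasSum (τ : ℂ) (hτ : 0 < τ.re) :
    HasSum (fun n : ℕ => (sC n : ℂ) * Complex.exp (-τ) ^ n) (SerT τ) := by
  have hq := norm_exp_neg_lt τ hτ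
  have h := (ST_summable _ hq).hasSum
  have f1 := hasSum_fiber _ (fun x : ℕ × ℕ => (x.1 + 1) * (2 * x.1 + 3 + 2 * x.2)) (fun n => Finset.range n ×ˢ Finset.range n)
    (fun x => by simp only [Finset.mem_product, Finset.mem_range]; constructor <;> nlinarith) h
  have f0 : HasSum (fun n : ℕ => if n = 0 then (1 : ℂ) else 0) 1 := by
    convert hasSum_ite_eq (0 : ℕ) (1 : ℂ) using 2
  unfold SerT
  convert f0.add f1 using 2 with n
  unfold sC
  push_cast
  rw [add_mul, Finset.sum_mul]
  congr 1
  · split_ifs with h0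
    · simp [h0]
    · simp
  · apply Finset.sum_congr rfl
    intro i _
    split_ifs with h0
    · rw [h0]
    · simp

section coef
open Complex Metric

theorem ps_unique (a b : ℕ → ℂ) (r : ℝ) (hr : 0 < r) (F : ℂ → ℂ)
    (ha : ∀ z : ℂ, ‖z‖ < r → HasSum (fun n => a n * z ^ n) (F z))
    (hb : ∀ z : ℂ, ‖z‖ < r → HasSum (fun n => b n * z ^ n) (F z)) : a = b := by
  have key : ∀ c : ℕ → ℂ, (∀ z : ℂ, ‖z‖ < r → HasSum (fun n => c n * z ^ n) (F z)) →
      HasFPowerSeriesAt F (FormalMultilinearSeries.ofScalars ℂ c) 0 := by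
    intro c hc
    rw [hasFPowerSeriesAt_iff]
    have : Metric.ball (0:ℂ) r ∈ nhds (0:ℂ) := Metric.ball_mem_nhds _ hr
    filter_upwards [this] with z hz
    rw [mem_ball_zero_iff] at hz
    simpa [FormalMultilinearSeries.coeff_ofScalars, mul_comm] using hc z hz
  have h := (key a ha).eq_formalMultilinearSeries (key b hb)
  funext n
  have h2 := congrArg (fun p => FormalMultilinearSeries.coeff p n) h
  simpa [FormalMultilinearSeries.coeff_ofScalars] using h2

theorem psiC_summable_r (r : ℝ) (h0 : 0 ≤ r) (h1 : r < 1) : Summable (fun n : ℕ => (1 + 2 * (n:ℝ)) * r ^ n) := by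
  have h := summable_pow_mul_geometric_of_norm_lt_one 1 (r := r) (by rwa [Real.norm_eq_abs, abs_of_nonneg h0])
  have h' := summable_geometric_of_lt_one h0 h1
  refine (h'.add (h.mul_left 2)).congr (fun n => ?_)
  simp only [pow_one]; ring

theorem sC_summable_r (r : ℝ) (h0 : 0 ≤ r) (h1 : r < 1) : Summable (fun n : ℕ => (1 + 2 * (n:ℝ)^2) * r ^ n) := by
  have h := summable_pow_mul_geometric_of_norm_lt_one 2 (r := r) (by rwa [Real.norm_eq_abs, abs_of_nonneg h0])
  have h' := summable_geometric_of_lt_one h0 h1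
  refine (h'.add (h.mul_left 2)).congr (fun n => ?_)
  ring

theorem psiC_normb (n : ℕ) : ‖(psiC n : ℂ)‖ ≤ 1 + 2 * (n:ℝ) := by
  rw [Complex.norm_intCast]; exact_mod_cast psiC_bound n

theorem sC_normb (n : ℕ) : ‖(sC n : ℂ)‖ ≤ 1 + 2 * (n:ℝ)^2 := by
  rw [Complex.norm_intCast]; exact_mod_cast sC_bound n

noncomputable def psiQ (q : ℂ) : ℂ := ∑' n : ℕ, (psiC n : ℂ) * q ^ n
noncomputable def SQ (q : ℂ) : ℂ := ∑' n : ℕ, (sC n : ℂ) * q ^ n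

theorem psi_tb (q : ℂ) (r : ℝ) (hq : ‖q‖ ≤ r) (n : ℕ) : ‖(psiC n : ℂ) * q ^ n‖ ≤ (1 + 2 * (n:ℝ)) * r ^ n := by
  rw [norm_mul, norm_pow]; gcongr; exact psiC_normb n

theorem s_tb (q : ℂ) (r : ℝ) (hq : ‖q‖ ≤ r) (n : ℕ) : ‖(sC n : ℂ) * q ^ n‖ ≤ (1 + 2 * (n:ℝ)^2) * r ^ n := by
  rw [norm_mul, norm_pow]; gcongr; exact sC_normb n

theorem psiQ_diff (r : ℝ) (h0 : 0 ≤ r) (h1 : r < 1) : DifferentiableOn ℂ psiQ (ball 0 r) := by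
  refine differentiableOn_tsum_of_summable_norm (psiC_summable_r r h0 h1) ?_ isOpen_ball ?_
  · intro n; fun_prop
  · intro n q hq; exact psi_tb q r (by rw [mem_ball_zero_iff] at hq; exact hq.le) n

theorem SQ_diff (r : ℝ) (h0 : 0 ≤ r) (h1 : r < 1) : DifferentiableOn ℂ SQ (ball 0 r) := by
  refine differentiableOn_tsum_of_summable_norm (sC_summable_r r h0 h1) ?_ isOpen_ball ?_
  · intro n; fun_prop
  · intro n q hq; exact s_tb q r (by rw [mem_ball_zero_iff] at hq; exact hq.le) n

theorem psiQ_exp (τ : ℂ) (hτ : 0 < τ.re) : psiQ (exp (-τ)) = psiT τ := (psiC_hasSum τ hτ).tsum_eq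
theorem SQ_exp (τ : ℂ) (hτ : 0 < τ.re) : SQ (exp (-τ)) = SerT τ := (sC_hasSum τ hτ).tsum_eq

theorem psiC_zero : psiC 0 = 1 := by simp [psiC]

theorem psiQ_ne (q : ℂ) (hq : ‖q‖ < 1) : psiQ q ≠ 0 := by
  by_cases h : q = 0
  · subst h
    unfold psiQ
    rw [tsum_eq_single 0]
    · simp [psiC_zero]
    · intro n hn; simp [hn]
  · have h2 : q = exp (-(-log q)) := by rw [neg_neg, exp_log h]
    have h3 : 0 < (-log q).re := by
      rw [neg_re, log_re]
      have := Real.log_neg (norm_pos_iff.mpr h) hq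
      linarith
    rw [h2, psiQ_exp _ h3]
    exact psiT_ne_zero _ h3

theorem coef_eq (c : ℕ → ℂ) (r : ℝ) (hr : 0 < r) (hr1 : r < 1)
    (h : ∀ q : ℂ, ‖q‖ < r → HasSum (fun n => c n * q ^ n) (SQ q / psiQ q)) (n : ℕ) : c n = Dn n := by
  have hconv : (fun n => ∑ p ∈ Finset.HasAntidiagonal.antidiagonal n, c p.1 * (psiC p.2 : ℂ)) = fun n => (sC n : ℂ) := by
    refine ps_unique _ _ r hr SQ ?_ ?_
    · intro z hz
      have hp : Summable (fun n => ‖(psiC n : ℂ) * z ^ n‖) :=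
        Summable.of_nonneg_of_le (fun _ => norm_nonneg _) (psi_tb z r hz.le) (psiC_summable_r r hr.le hr1)
      have hc : Summable (fun n => ‖c n * z ^ n‖) := (h z hz).summable.norm
      have hm := tsum_mul_tsum_eq_tsum_sum_antidiagonal_of_summable_norm hc hp
      have hs := (summable_norm_sum_mul_antidiagonal_of_summable_norm hc hp).of_norm
      have e : ∀ n, (∑ kl ∈ Finset.HasAntidiagonal.antidiagonal n, c kl.1 * z ^ kl.1 * ((psiC kl.2 : ℂ) * z ^ kl.2))
          = (∑ p ∈ Finset.HasAntidiagonal.antidiagonal n, c p.1 * (psiC p.2 : ℂ)) * z ^ n := by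
        intro n
        rw [Finset.sum_mul]
        refine Finset.sum_congr rfl (fun p hp => ?_)
        rw [← Finset.HasAntidiagonal.mem_antidiagonal.mp hp, pow_add]; ring
      have hs2 := hs.hasSum
      rw [← hm, (h z hz).tsum_eq] at hs2
      change HasSum _ (SQ z / psiQ z * psiQ z) at hs2
      rw [div_mul_cancel₀ _ (psiQ_ne z (hz.trans hr1))] at hs2
      simpa only [e] using hs2
    · intro z hz
      exact (Summable.of_nonneg_of_le (fun _ => norm_nonneg _) (s_tb z r hz.le) (sC_summable_r r hr.le hr1)).of_norm.hasSum
  induction n using Nat.strong_induction_on with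
  | _ n ih =>
    have h1 := congrFun hconv n
    have h2 : ∑ p ∈ Finset.HasAntidiagonal.antidiagonal n, (Dn p.1 : ℂ) * (psiC p.2 : ℂ) = sC n := by
      rw [← Dn_psi n]; push_cast; rfl
    rw [← h2] at h1
    have hm : (n, 0) ∈ Finset.HasAntidiagonal.antidiagonal n := by simp
    rw [← Finset.add_sum_erase _ _ hm, ← Finset.add_sum_erase _ (fun p : ℕ × ℕ => (Dn p.1 : ℂ) * (psiC p.2 : ℂ)) hm] at h1
    have h3 : ∑ x ∈ (Finset.HasAntidiagonal.antidiagonal n).erase (n, 0), c x.1 * (psiC x.2 : ℂ)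
       = ∑ x ∈ (Finset.HasAntidiagonal.antidiagonal n).erase (n, 0), (Dn x.1 : ℂ) * (psiC x.2 : ℂ) := by
      refine Finset.sum_congr rfl (fun p hp => ?_)
      rw [Finset.mem_erase] at hp
      have h4 := Finset.HasAntidiagonal.mem_antidiagonal.mp hp.2
      have h5 : p.1 < n := by
        rcases Nat.lt_or_ge p.1 n with h6 | h6
        · exact h6
        · exfalso; apply hp.1; ext <;> simp <;> omega
      rw [ih _ h5]
    rw [h3] at h1
    have h9 := add_right_cancel h1
    simpa [psiC_zero] using h9

theorem Dn_integral (n : ℕ) (t : ℝ) (ht : 0 < t) :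
    2 * Real.pi * (Dn n : ℂ) = ∫ θ in (-Real.pi)..Real.pi, exp (n * (t + θ * I)) * (SerT (t + θ * I) / psiT (t + θ * I)) := by
  set r : ℝ := Real.exp (-t) with hr
  have hr0 : 0 < r := Real.exp_pos _
  have hr1 : r < 1 := by rw [hr, Real.exp_lt_one_iff]; linarith
  obtain ⟨r', h1, h2⟩ := exists_between hr1
  obtain ⟨R, hR⟩ : ∃ R : NNReal, (R:ℝ) = r := ⟨⟨r, hr0.le⟩, rfl⟩
  have hd : DifferentiableOn ℂ (fun q => SQ q / psiQ q) (closedBall 0 R) := by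
    have hsub : closedBall (0:ℂ) R ⊆ ball 0 r' := by
      intro x hx; rw [mem_ball_zero_iff]; rw [mem_closedBall_zero_iff, hR] at hx; exact lt_of_le_of_lt hx h1
    refine ((SQ_diff r' (hr0.trans h1).le h2).mono hsub).div ((psiQ_diff r' (hr0.trans h1).le h2).mono hsub) ?_
    intro x hx
    exact psiQ_ne x ((mem_ball_zero_iff.mp (hsub hx)).trans h2)
  have hps := hd.hasFPowerSeriesOnBall (by rw [← NNReal.coe_pos, hR]; exact hr0)
  rw [hR] at hps
  have hc := coef_eq (fun n => (cauchyPowerSeries (fun q => SQ q / psiQ q) 0 r).coeff n) r hr0 hr1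
    (by
      intro q hq
      have := hps.hasSum (y := q) (by
        rw [Metric.mem_eball, edist_zero_right, ← ofReal_norm, ENNReal.ofReal_lt_iff_lt_toReal (norm_nonneg _) (by simp)]
        simpa [hR] using hq)
      simpa [FormalMultilinearSeries.apply_eq_prod_smul_coeff, mul_comm] using this) n
  rw [← hc]
  have h3 : (cauchyPowerSeries (fun q => SQ q / psiQ q) 0 r).coeff n
     = (2 * Real.pi * I)⁻¹ • ∮ z in C(0, r), (1 / z) ^ n • z⁻¹ • (SQ z / psiQ z) := by
    have := cauchyPowerSeries_apply (fun q => SQ q / psiQ q) 0 r n 1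
    simp only [sub_zero] at this
    rw [← this]; rfl
  set G : ℝ → ℂ := fun θ => (circleMap 0 r θ)⁻¹ ^ n * (SQ (circleMap 0 r θ) / psiQ (circleMap 0 r θ)) with hG
  have h4 : (∮ z in C(0, r), (1 / z) ^ n • z⁻¹ • (SQ z / psiQ z)) = I * ∫ θ in (0:ℝ)..(2 * Real.pi), G θ := by
    rw [circleIntegral, ← intervalIntegral.integral_const_mul]
    refine intervalIntegral.integral_congr (fun θ _ => ?_)
    have h0 : circleMap 0 r θ ≠ 0 := circleMap_ne_center hr0.ne'
    simp only [deriv_circleMap, hG, smul_eq_mul, one_div]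
    field_simp
  have hper : Function.Periodic G (2 * Real.pi) := by
    intro θ; simp only [hG, (periodic_circleMap 0 r θ)]
  have h5 : ∫ θ in (0:ℝ)..(2 * Real.pi), G θ = ∫ θ in (-Real.pi)..Real.pi, G θ := by
    have := hper.intervalIntegral_add_eq 0 (-Real.pi)
    rw [zero_add, show -Real.pi + 2 * Real.pi = Real.pi by ring] at this
    exact this
  have h6 : ∫ θ in (-Real.pi)..Real.pi, G θ = ∫ θ in (-Real.pi)..Real.pi, G (-θ) := by
    rw [intervalIntegral.integral_comp_neg, neg_neg]
  rw [h3, h4, h5, h6, smul_eq_mul]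
  have hpi : (Real.pi : ℂ) ≠ 0 := by exact_mod_cast Real.pi_ne_zero
  have h7 : ∀ X : ℂ, 2 * (Real.pi:ℂ) * ((2 * Real.pi * I)⁻¹ * (I * X)) = X := by
    intro X; field_simp [I_ne_zero]
  rw [h7]
  refine intervalIntegral.integral_congr (fun θ _ => ?_)
  have h8 : circleMap 0 r (-θ) = exp (-(t + θ * I)) := by
    rw [circleMap_zero, hr]; push_cast; rw [← exp_add]; congr 1; ring
  have h9 : 0 < ((t:ℂ) + θ * I).re := by simpa using ht
  simp only [hG]
  rw [h8, psiQ_exp _ h9, SQ_exp _ h9, ← exp_neg, neg_neg, ← exp_nat_mul]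
end coef

section csc
open Complex Filter Topology MeasureTheory

theorem csc_partial (y : ℂ) (N : ℕ) :
    ∑ k ∈ Finset.range (2 * N + 1), (-1 : ℂ) ^ k * (1 / (y + k) + 1 / (k + 1 - y))
      = 1 / y + ∑ j ∈ Finset.range N, cotTerm (y / 2) j - ∑ j ∈ Finset.range (2 * N), cotTerm y j
        + 1 / (2 * N + 1 - y) := by
  induction N with
  | zero => simp
  | succ N ih =>
    rw [show 2 * (N + 1) + 1 = 2 * N + 1 + 1 + 1 by ring, Finset.sum_range_succ, Finset.sum_range_succ, ih,
      show 2 * (N + 1) = 2 * N + 1 + 1 by ring, Finset.sum_range_succ, Finset.sum_range_succ, Finset.sum_range_succ]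
    have e1 : cotTerm (y / 2) N = 2 * (1 / (y - (2 * N + 2)) + 1 / (y + (2 * N + 2))) := by
      unfold cotTerm
      rw [show y / 2 - (N + 1) = (y - (2 * N + 2)) / 2 by ring, show y / 2 + (N + 1) = (y + (2 * N + 2)) / 2 by ring]
      rw [one_div_div, one_div_div]; ring
    have s1 : (-1:ℂ) ^ (2 * N + 1) = -1 := by rw [pow_succ, pow_mul]; simp
    have s2 : (-1:ℂ) ^ (2 * N + 1 + 1) = 1 := by rw [pow_succ, s1]; simp
    have n1 : ∀ a b : ℂ, 1 / (a - b) = - (1 / (b - a)) := by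
      intro a b; rw [← neg_sub b a, one_div, one_div, inv_neg]
    rw [e1, s1, s2]
    unfold cotTerm
    push_cast
    rw [n1 y (2 * N + 2), n1 y (2 * N + 1), n1 y (2 * N + 1 + 1),
      show (2 * (N:ℂ) + 1 + 1 - y) = 2 * N + 2 - y by ring, show (y + (2 * (N:ℂ) + 1 + 1)) = y + (2 * N + 2) by ring,
      show (2 * ((N:ℂ) + 1) + 1 - y) = 2 * N + 1 + 1 + 1 - y by ring]
    ring

theorem csc_tendsto (y : ℂ) (hy : y ∈ integerComplement) :
    Tendsto (fun N : ℕ => ∑ k ∈ Finset.range (2 * N + 1), (-1 : ℂ) ^ k * (1 / (y + k) + 1 / (k + 1 - y))) atTop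
      (𝓝 (Real.pi / sin (Real.pi * y))) := by
  have hy2 : y / 2 ∈ integerComplement := by
    rw [mem_integerComplement_iff] at hy ⊢
    rintro ⟨n, hn⟩
    exact hy ⟨2 * n, by push_cast; rw [hn]; ring⟩
  have t1 := tendsto_logDeriv_euler_cot_sub hy2
  have t2 := (tendsto_logDeriv_euler_cot_sub hy).comp (tendsto_id.const_mul_atTop' (show 0 < 2 by norm_num))
  have t3 : Tendsto (fun N : ℕ => 1 / (2 * (N:ℂ) + 1 - y)) atTop (𝓝 0) := by
    simp only [one_div]
    refine tendsto_inv₀_cobounded.comp ?_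
    rw [← tendsto_norm_atTop_iff_cobounded]
    have : ∀ N : ℕ, (N:ℝ) + (-‖y‖) ≤ ‖2 * (N:ℂ) + 1 - y‖ := by
      intro N
      have h1 := norm_sub_norm_le (2 * (N:ℂ) + 1) y
      have h2 : ‖2 * (N:ℂ) + 1‖ = 2 * N + 1 := by
        have : (2 * (N:ℂ) + 1) = ((2 * N + 1 : ℕ) : ℂ) := by push_cast; ring
        rw [this, Complex.norm_natCast]; push_cast; ring
      have : (0:ℝ) ≤ N := Nat.cast_nonneg N
      linarith
    exact tendsto_atTop_mono this (tendsto_atTop_add_const_right _ _ tendsto_natCast_atTop_atTop)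
  have t4 := ((t1.const_add (1 / y)).sub t2).add t3
  have hs1 := sin_pi_mul_ne_zero hy
  have hs2 := sin_pi_mul_ne_zero hy2
  have hy0 := integerComplement.ne_zero hy
  have e : Real.pi / sin (Real.pi * y) = 1 / y + (Real.pi * cot (Real.pi * (y / 2)) - 1 / (y / 2))
      - (Real.pi * cot (Real.pi * y) - 1 / y) + 0 := by
    have d1 : sin (Real.pi * y) = 2 * sin (Real.pi * (y / 2)) * cos (Real.pi * (y / 2)) := by
      rw [← sin_two_mul]; congr 1; ring
    have d2 : cos (Real.pi * y) = 2 * cos (Real.pi * (y / 2)) ^ 2 - 1 := by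
      rw [← cos_two_mul]; congr 1; ring
    have hc : cos (Real.pi * (y / 2)) ≠ 0 := by
      intro h; apply hs1; rw [d1, h]; simp
    rw [cot_eq_cos_div_sin, cot_eq_cos_div_sin, d1, d2]
    generalize cos (Real.pi * (y / 2)) = C at *
    generalize sin (Real.pi * (y / 2)) = S at *
    field_simp
    ring
  rw [e]
  refine t4.congr (fun N => ?_)
  rw [csc_partial y N]
  simp

theorem one_add_exp_lower (w : ℂ) (h0 : 0 ≤ w.re) (h : w.im ^ 2 ≤ 3 * w.re ^ 2) : 1 / 2 ≤ ‖1 + exp (-w)‖ := by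
  by_cases hc : |w.im| ≤ Real.pi / 2
  · have h1 : (1 + exp (-w)).re = 1 + Real.exp (-w.re) * Real.cos (w.im) := by
      simp [exp_re]
    have h2 : 0 ≤ Real.cos w.im := Real.cos_nonneg_of_neg_pi_div_two_le_of_le (abs_le.mp hc).1 (abs_le.mp hc).2
    have h3 := Complex.re_le_norm (1 + exp (-w))
    rw [h1] at h3
    have h4 := mul_nonneg (Real.exp_pos (-w.re)).le h2
    linarith
  · push Not at hc
    have hp := Real.pi_gt_three
    have h1 : 7 / 10 ≤ w.re := by
      by_contra hcon
      push Not at hcon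
      have : (3/2:ℝ) < |w.im| := by linarith
      have h5 : (3/2:ℝ)^2 < |w.im|^2 := by gcongr
      rw [sq_abs] at h5
      nlinarith
    have h2 : ‖exp (-w)‖ ≤ 1 / 2 := by
      rw [norm_exp, neg_re]
      calc Real.exp (-w.re) ≤ Real.exp (-(7/10)) := by apply Real.exp_le_exp.mpr; linarith
        _ ≤ 1 / 2 := by
          rw [Real.exp_neg, one_div]
          apply inv_anti₀ (by norm_num)
          have := Real.quadratic_le_exp_of_nonneg (show (0:ℝ) ≤ 7/10 by norm_num)
          have := Real.sum_le_exp_of_nonneg (show (0:ℝ) ≤ 7/10 by norm_num) 4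
          norm_num [Finset.sum_range_succ, Nat.factorial] at this
          linarith
    have h3 := norm_sub_norm_le (1:ℂ) (-exp (-w))
    rw [norm_neg, sub_neg_eq_add, norm_one] at h3
    linarith

/-- the kernel -/
noncomputable def kerK (a b : ℂ) (η : ℝ) : ℂ := (exp (-a * η) + exp (-b * η)) / (1 + exp (-((a + b) * η)))

theorem kerK_bound (a b : ℂ) (hab0 : 0 < (a + b).re) (h : (a + b).im ^ 2 ≤ 3 * (a + b).re ^ 2) (η : ℝ) (hη : 0 ≤ η) :
    ‖kerK a b η‖ ≤ 2 * (Real.exp (-a.re * η) + Real.exp (-b.re * η)) := by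
  have h1 := one_add_exp_lower ((a + b) * η) (by simpa using mul_nonneg hab0.le hη) (by
    simp only [mul_im, mul_re, ofReal_re, ofReal_im]; nlinarith [mul_le_mul_of_nonneg_right h (sq_nonneg η)])
  unfold kerK
  rw [norm_div, div_le_iff₀ (by linarith)]
  have h2 := norm_add_le (exp (-a * η)) (exp (-b * η))
  rw [norm_exp, norm_exp] at h2
  simp only [mul_re, neg_re, ofReal_re, ofReal_im, mul_zero, sub_zero] at h2
  have := Real.exp_pos (-a.re * η)
  have := Real.exp_pos (-b.re * η)
  nlinarith

theorem kerK_cont (a b : ℂ) (hab0 : 0 < (a + b).re) (h : (a + b).im ^ 2 ≤ 3 * (a + b).re ^ 2) :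
    ContinuousOn (kerK a b) (Set.Ici 0) := by
  unfold kerK
  refine ContinuousOn.div (by fun_prop) (by fun_prop) ?_
  intro η hη h0
  have h1 := one_add_exp_lower ((a + b) * η) (by simpa using mul_nonneg hab0.le hη) (by
    simp only [mul_im, mul_re, ofReal_re, ofReal_im]; nlinarith [mul_le_mul_of_nonneg_right h (sq_nonneg η)])
  rw [h0, norm_zero] at h1
  norm_num at h1

theorem kerK_int (a b : ℂ) (ha : 0 < a.re) (hb : 0 < b.re) (h : (a + b).im ^ 2 ≤ 3 * (a + b).re ^ 2) :
    IntegrableOn (kerK a b) (Set.Ioi 0) := by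
  have hab0 : 0 < (a + b).re := by rw [add_re]; linarith
  have hb1 := (integrableOn_exp_mul_Ioi (a := -a.re) (by linarith) 0).add (integrableOn_exp_mul_Ioi (a := -b.re) (by linarith) 0)
  refine Integrable.mono' (hb1.const_mul 2) ?_ ?_
  · exact ((kerK_cont a b hab0 h).mono Set.Ioi_subset_Ici_self).aestronglyMeasurable measurableSet_Ioi
  · refine (ae_restrict_iff' measurableSet_Ioi).mpr (ae_of_all _ (fun η hη => ?_))
    exact kerK_bound a b hab0 h η (le_of_lt hη)

theorem kerK_integral (τ x : ℂ) (hτ : 0 < τ.re) (h3 : τ.im ^ 2 ≤ 3 * τ.re ^ 2) (ha : 0 < (x / τ).re)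
    (hb : 0 < ((Real.pi - x) / τ).re) :
    ∫ η in Set.Ioi (0:ℝ), kerK (x / τ) ((Real.pi - x) / τ) η = τ / sin x := by
  have hτ0 : τ ≠ 0 := by rintro rfl; simp at hτ
  have hpi : (Real.pi : ℂ) ≠ 0 := by exact_mod_cast Real.pi_ne_zero
  set a := x / τ with hadef
  set b := (Real.pi - x) / τ with hbdef
  have hab : a + b = Real.pi / τ := by rw [hadef, hbdef]; field_simp; ring
  have hab0 : 0 < (a + b).re := by rw [add_re]; linarith
  have hab3 : (a + b).im ^ 2 ≤ 3 * (a + b).re ^ 2 := by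
    rw [hab, div_re, div_im]
    simp only [ofReal_re, ofReal_im, zero_mul, zero_div, add_zero, zero_sub]
    have : 0 < normSq τ := normSq_pos.mpr hτ0
    have e1 : (-(Real.pi * τ.im / normSq τ)) ^ 2 = (Real.pi / normSq τ) ^ 2 * τ.im ^ 2 := by ring
    have e2 : (Real.pi * τ.re / normSq τ) ^ 2 = (Real.pi / normSq τ) ^ 2 * τ.re ^ 2 := by ring
    rw [e1, e2]
    nlinarith [sq_nonneg (Real.pi / normSq τ)]
  have hy : x / Real.pi ∈ integerComplement := by
    rw [mem_integerComplement_iff]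
    rintro ⟨k, hk⟩
    have hx : x = k * Real.pi := by rw [hk]; field_simp
    have hap : a = k * (a + b) := by rw [hab, hadef, hx]; ring
    have hbp : b = (1 - k) * (a + b) := by rw [hab, hbdef, hx]; ring
    have r1 : a.re = k * (a + b).re := by
      conv_lhs => rw [hap]
      rw [show ((k:ℂ)) = ((k:ℝ):ℂ) by push_cast; rfl, re_ofReal_mul]
    have r2 : b.re = (1 - k) * (a + b).re := by
      conv_lhs => rw [hbp]
      rw [show (1 - (k:ℂ)) = ((1 - k:ℝ):ℂ) by push_cast; rfl, re_ofReal_mul]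
    rw [r1] at ha; rw [r2] at hb
    have k1 : (0:ℝ) < k := pos_of_mul_pos_left ha hab0.le
    have k2 : (0:ℝ) < 1 - k := pos_of_mul_pos_left hb hab0.le
    have : (0:ℤ) < k := by exact_mod_cast k1
    have : (k:ℤ) < 1 := by have : (k:ℝ) < 1 := by linarith
                           exact_mod_cast this
    omega
  set F : ℕ → ℝ → ℂ := fun N η => ∑ k ∈ Finset.range (2 * N + 1), (-1:ℂ) ^ k *
      (exp (-(a + k * (a + b)) * η) + exp (-(b + k * (a + b)) * η)) with hF
  have hFe : ∀ N (η : ℝ), 0 ≤ η → F N η = kerK a b η * (1 - (-exp (-((a + b) * η))) ^ (2 * N + 1)) := by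
    intro N η hη
    have h1 := one_add_exp_lower ((a + b) * η) (by simpa using mul_nonneg hab0.le hη) (by
      simp only [mul_im, mul_re, ofReal_re, ofReal_im]; nlinarith [mul_le_mul_of_nonneg_right hab3 (sq_nonneg η)])
    have h0 : 1 + exp (-((a + b) * η)) ≠ 0 := by
      intro h0; rw [h0, norm_zero] at h1; norm_num at h1
    have hg := mul_neg_geom_sum (-exp (-((a + b) * η))) (2 * N + 1)
    rw [← hg, sub_neg_eq_add, kerK, ← mul_assoc, div_mul_cancel₀ _ h0, Finset.mul_sum]
    refine Finset.sum_congr rfl (fun k _ => ?_)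
    rw [neg_pow (exp _), ← exp_nat_mul]
    have e1 : exp (-(a + k * (a + b)) * η) = exp (-a * η) * exp (k * (-((a + b) * η))) := by
      rw [← exp_add]; congr 1; ring
    have e2 : exp (-(b + k * (a + b)) * η) = exp (-b * η) * exp (k * (-((a + b) * η))) := by
      rw [← exp_add]; congr 1; ring
    rw [e1, e2]; ring
  have hX : ∀ η : ℝ, 0 < η → ‖-exp (-((a + b) * η))‖ < 1 := by
    intro η hη
    rw [norm_neg, norm_exp_neg]
    simp only [mul_re, ofReal_re, ofReal_im, mul_zero, sub_zero]
    rw [Real.exp_lt_one_iff]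
    have := mul_pos hab0 hη
    linarith
  have hak : ∀ k : ℕ, (-(a + k * (a + b))).re < 0 := by
    intro k
    have : (0:ℝ) ≤ k := Nat.cast_nonneg k
    simp only [neg_re, add_re, mul_re, natCast_re, natCast_im, zero_mul, sub_zero]
    nlinarith
  have hbk : ∀ k : ℕ, (-(b + k * (a + b))).re < 0 := by
    intro k
    have : (0:ℝ) ≤ k := Nat.cast_nonneg k
    simp only [neg_re, add_re, mul_re, natCast_re, natCast_im, zero_mul, sub_zero]
    nlinarith
  have hFI : ∀ N, ∫ η in Set.Ioi (0:ℝ), F N η = ∑ k ∈ Finset.range (2 * N + 1), (-1:ℂ) ^ k *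
      (1 / (a + k * (a + b)) + 1 / (b + k * (a + b))) := by
    intro N
    simp only [hF]
    rw [integral_finsetSum]
    · refine Finset.sum_congr rfl (fun k _ => ?_)
      rw [integral_const_mul, integral_add (integrableOn_exp_mul_complex_Ioi (hak k) 0) (integrableOn_exp_mul_complex_Ioi (hbk k) 0),
        integral_exp_mul_complex_Ioi (hak k), integral_exp_mul_complex_Ioi (hbk k)]
      simp only [ofReal_zero, mul_zero, exp_zero, neg_div_neg_eq]
    · intro k _
      exact ((integrableOn_exp_mul_complex_Ioi (hak k) 0).add (integrableOn_exp_mul_complex_Ioi (hbk k) 0)).const_mul _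
  have hlim : Tendsto (fun N => ∫ η in Set.Ioi (0:ℝ), F N η) atTop (𝓝 (∫ η in Set.Ioi (0:ℝ), kerK a b η)) := by
    refine tendsto_integral_of_dominated_convergence (fun η => ‖kerK a b η‖ * 2) ?_ ((kerK_int a b ha hb hab3).norm.mul_const 2) ?_ ?_
    · intro N
      have : Continuous (F N) := by simp only [hF]; fun_prop
      exact this.aestronglyMeasurable
    · intro N
      refine (ae_restrict_iff' measurableSet_Ioi).mpr (ae_of_all _ (fun η hη => ?_))
      rw [hFe N η (le_of_lt hη), norm_mul]
      gcongr
      refine (norm_sub_le _ _).trans ?_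
      rw [norm_one, norm_pow]
      have := pow_le_one₀ (n := 2 * N + 1) (norm_nonneg _) (hX η hη).le
      linarith
    · refine (ae_restrict_iff' measurableSet_Ioi).mpr (ae_of_all _ (fun η hη => ?_))
      have h1 : Tendsto (fun N : ℕ => (-exp (-((a + b) * η))) ^ (2 * N + 1)) atTop (𝓝 0) := by
        refine (tendsto_pow_atTop_nhds_zero_of_norm_lt_one (hX η hη)).comp ?_
        exact tendsto_atTop_mono (fun n => by simp only [id]; omega) tendsto_id
      have h2 := (h1.const_sub 1).const_mul (kerK a b η)
      rw [sub_zero, mul_one] at h2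
      exact h2.congr (fun N => (hFe N η (le_of_lt hη)).symm)
  have hlim2 : Tendsto (fun N => ∫ η in Set.Ioi (0:ℝ), F N η) atTop (𝓝 (τ / sin x)) := by
    have := (csc_tendsto _ hy).const_mul (τ / Real.pi)
    have e0 : (Real.pi:ℂ) * (x / Real.pi) = x := by field_simp
    rw [e0] at this
    have e1 : τ / Real.pi * (Real.pi / sin x) = τ / sin x := by
      rw [div_mul_div_comm, mul_comm τ, mul_div_mul_left _ _ hpi]
    rw [e1] at this
    refine this.congr (fun N => ?_)
    rw [hFI, Finset.mul_sum]
    refine Finset.sum_congr rfl (fun k _ => ?_)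
    have q1 : a + k * (a + b) = (Real.pi / τ) * (x / Real.pi + k) := by
      rw [hab, hadef]; field_simp
    have q2 : b + k * (a + b) = (Real.pi / τ) * (k + 1 - x / Real.pi) := by
      rw [hab, hbdef]; field_simp; ring
    rw [q1, q2, one_div, one_div, one_div, one_div, mul_inv, mul_inv, inv_div]
    ring
  exact tendsto_nhds_unique hlim hlim2
end csc

section trig
open Real

noncomputable def aOne : ℝ := (3 * √5 - 5) / 20
noncomputable def aTwo : ℝ := (3 * √5 + 5) / 20

theorem sin_three_pi_ten : Real.sin (3 * π / 10) = (1 + √5) / 4 := by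
  rw [← cos_pi_div_five, ← Real.cos_pi_div_two_sub]; congr 1; ring

theorem sin_pi_ten : Real.sin (π / 10) = (√5 - 1) / 4 := by
  have h : Real.sin (π / 10) = 1 - 2 * ((1 + √5) / 4) ^ 2 + 2 * (((1 + √5) / 4) ^ 2 * 2 - 1) - 0 := by
    have h1 : Real.sin (π / 10) = Real.cos (2 * (π / 5)) := by
      rw [← Real.cos_pi_div_two_sub]; congr 1; ring
    rw [h1, Real.cos_two_mul, cos_pi_div_five]; ring
  have h5 : √5 ^ 2 = 5 := Real.sq_sqrt (by norm_num)
  rw [h]; nlinarith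

theorem kap_anti (i : ℕ) : kap (i + 5) = - kap i := by
  unfold kap
  have h : i % 10 < 10 := Nat.mod_lt _ (by norm_num)
  have h2 : (i + 5) % 10 = (i % 10 + 5) % 10 := by omega
  rw [h2]
  generalize i % 10 = r at *
  interval_cases r <;> rfl

theorem kap_sin (i : ℕ) : (kap i : ℝ) = 4 * (aOne * Real.sin ((2 * i + 1) * (π / 10)) + aTwo * Real.sin ((2 * i + 1) * (3 * π / 10))) := by
  have h5 : √5 ^ 2 = 5 := Real.sq_sqrt (by norm_num)
  have s1 := sin_pi_ten
  have s3 := sin_three_pi_ten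
  have c5 : Real.sin (5 * π / 10) = 1 := by rw [← Real.sin_pi_div_two]; congr 1; ring
  have c7 : Real.sin (7 * π / 10) = (1 + √5) / 4 := by rw [← s3, ← Real.sin_pi_sub]; congr 1; ring
  have c9 : Real.sin (9 * π / 10) = (√5 - 1) / 4 := by rw [← s1, ← Real.sin_pi_sub]; congr 1; ring
  induction i using Nat.strong_induction_on with
  | _ i ih =>
  by_cases hi : 5 ≤ i
  · obtain ⟨j, rfl⟩ := Nat.exists_eq_add_of_le' hi
    have := ih j (by omega)
    rw [kap_anti]; push_cast; rw [this]
    have e1 : (2 * ((j:ℝ) + 5) + 1) * (π / 10) = (2 * j + 1) * (π / 10) + π := by ring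
    have e2 : (2 * ((j:ℝ) + 5) + 1) * (3 * π / 10) = (2 * j + 1) * (3 * π / 10) + π + 2 * π := by ring
    rw [e1, e2, Real.sin_add_two_pi, Real.sin_add_pi, Real.sin_add_pi]; ring
  · push Not at hi
    unfold aOne aTwo
    interval_cases i
    · simp [kap]; rw [s1, s3]; nlinarith
    · simp [kap]
      rw [show ((2:ℝ) + 1) * (π / 10) = 3 * π / 10 by ring, show ((2:ℝ) + 1) * (3 * π / 10) = 9 * π / 10 by ring, s3, c9]; nlinarith
    · simp [kap]
      rw [show ((2:ℝ) * 2 + 1) * (π / 10) = 5 * π / 10 by ring, show ((2:ℝ) * 2 + 1) * (3 * π / 10) = 5 * π / 10 + π by ring, Real.sin_add_pi, c5]; nlinarith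
    · simp [kap]
      rw [show ((2:ℝ) * 3 + 1) * (π / 10) = 7 * π / 10 by ring, show ((2:ℝ) * 3 + 1) * (3 * π / 10) = π / 10 + 2 * π by ring, Real.sin_add_two_pi, c7, s1]; nlinarith
    · simp [kap]
      rw [show ((2:ℝ) * 4 + 1) * (π / 10) = 9 * π / 10 by ring, show ((2:ℝ) * 4 + 1) * (3 * π / 10) = 7 * π / 10 + 2 * π by ring, Real.sin_add_two_pi, c7, c9]; nlinarith

theorem a_sum : aOne / Real.sin (π / 10) + aTwo / Real.sin (3 * π / 10) = 1 := by
  have h5 : √5 ^ 2 = 5 := Real.sq_sqrt (by norm_num)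
  have h2 : 2 < √5 := by rw [Real.lt_sqrt (by norm_num)]; norm_num
  rw [sin_pi_ten, sin_three_pi_ten]
  unfold aOne aTwo
  have : √5 - 1 ≠ 0 := by linarith
  have : 1 + √5 ≠ 0 := by linarith
  field_simp
  nlinarith
end trig

section C4s
open Complex MeasureTheory

theorem csc_pair (φ : ℝ) (w : ℂ) (hw : 0 < w.re) :
    HasSum (fun k : ℕ => 4 * (Real.sin ((2 * k + 1) * φ) : ℂ) * exp (-w) ^ (2 * k + 1))
      (1 / sin (φ - I * w) + 1 / sin (φ + I * w)) := by
  have hz := norm_exp_neg_lt w hw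
  set z := exp (-w) with hzd
  have hz0 : z ≠ 0 := exp_ne_zero _
  set e := exp (φ * I) with hed
  have he0 : e ≠ 0 := exp_ne_zero _
  have hen : ‖e‖ = 1 := norm_exp_ofReal_mul_I φ
  have n1 : ‖(z * e⁻¹) ^ 2‖ < 1 := by
    rw [norm_pow, norm_mul, norm_inv, hen, inv_one, mul_one]; exact pow_lt_one₀ (norm_nonneg _) hz (by norm_num)
  have n2 : ‖(z * e) ^ 2‖ < 1 := by
    rw [norm_pow, norm_mul, hen, mul_one]; exact pow_lt_one₀ (norm_nonneg _) hz (by norm_num)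
  have g1 := (hasSum_geometric_of_norm_lt_one n1).mul_left (2 * I * (z * e⁻¹))
  have g2 := (hasSum_geometric_of_norm_lt_one n2).mul_left (2 * I * (z * e))
  have g := g1.sub g2
  have d1 : 1 - (z * e⁻¹) ^ 2 ≠ 0 := by
    intro h; rw [← sub_eq_zero.mp h, norm_one] at n1; exact lt_irrefl _ n1
  have d2 : 1 - (z * e) ^ 2 ≠ 0 := by
    intro h; rw [← sub_eq_zero.mp h, norm_one] at n2; exact lt_irrefl _ n2
  have s1 : 1 / sin (φ - I * w) = 2 * I * (z * e⁻¹) * (1 - (z * e⁻¹) ^ 2)⁻¹ := by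
    have : sin (φ - I * w) = (1 - (z * e⁻¹) ^ 2) / (2 * I * (z * e⁻¹)) := by
      rw [sin]
      have q1 : exp (-(φ - I * w) * I) = z * e⁻¹ := by
        rw [hzd, hed, ← exp_neg, ← exp_add]; congr 1; ring_nf; rw [I_sq]; ring
      have q2 : exp ((φ - I * w) * I) = (z * e⁻¹)⁻¹ := by
        rw [← q1, ← exp_neg]; congr 1; ring
      rw [q1, q2]
      have : z * e⁻¹ ≠ 0 := mul_ne_zero hz0 (inv_ne_zero he0)
      generalize z * e⁻¹ = u at *
      field_simp
      rw [I_sq]; ring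
    rw [this, one_div, inv_div]; rfl
  have s2 : 1 / sin (φ + I * w) = - (2 * I * (z * e) * (1 - (z * e) ^ 2)⁻¹) := by
    have : sin (φ + I * w) = - ((1 - (z * e) ^ 2) / (2 * I * (z * e))) := by
      rw [sin]
      have q1 : exp ((φ + I * w) * I) = z * e := by
        rw [hzd, hed, ← exp_add]; congr 1; ring_nf; rw [I_sq]; ring
      have q2 : exp (-(φ + I * w) * I) = (z * e)⁻¹ := by
        rw [← q1, ← exp_neg]; congr 1; ring
      rw [q1, q2]
      have : z * e ≠ 0 := mul_ne_zero hz0 he0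
      generalize z * e = u at *
      field_simp
      rw [I_sq]
    rw [this, one_div, inv_neg, inv_div]; rfl
  rw [s1, s2, ← sub_eq_add_neg]
  have ef : ∀ k : ℕ, 4 * (Real.sin ((2 * k + 1) * φ) : ℂ) * z ^ (2 * k + 1)
      = 2 * I * (z * e⁻¹) * ((z * e⁻¹) ^ 2) ^ k - 2 * I * (z * e) * ((z * e) ^ 2) ^ k := by
    intro k
    have r1 : 2 * I * (z * e⁻¹) * ((z * e⁻¹) ^ 2) ^ k = 2 * I * z ^ (2 * k + 1) * (e⁻¹) ^ (2 * k + 1) := by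
      rw [← pow_mul, mul_pow, pow_succ z, pow_succ e⁻¹]; ring
    have r2 : 2 * I * (z * e) * ((z * e) ^ 2) ^ k = 2 * I * z ^ (2 * k + 1) * e ^ (2 * k + 1) := by
      rw [← pow_mul, mul_pow, pow_succ z, pow_succ e]; ring
    have r3 : e ^ (2 * k + 1) = exp ((((2 * k + 1) * φ : ℝ) : ℂ) * I) := by
      rw [hed, ← exp_nat_mul]; congr 1; push_cast; ring
    have r4 : (e⁻¹) ^ (2 * k + 1) = exp (-(((2 * k + 1) * φ : ℝ) : ℂ) * I) := by
      rw [hed, ← exp_neg, ← exp_nat_mul]; congr 1; push_cast; ring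
    rw [r1, r2, r3, r4, ofReal_sin]
    have := two_sin ((((2 * k + 1) * φ : ℝ) : ℂ))
    calc 4 * sin (((2 * k + 1) * φ : ℝ) : ℂ) * z ^ (2 * k + 1) = 2 * (2 * sin (((2 * k + 1) * φ : ℝ) : ℂ)) * z ^ (2 * k + 1) := by ring
      _ = _ := by rw [this]; ring
  simp_rw [ef]
  exact g

noncomputable def KK (τ : ℂ) (η : ℝ) : ℂ :=
  aOne * kerK ((Real.pi / 10 : ℝ) / τ) ((Real.pi - (Real.pi / 10 : ℝ)) / τ) η
   + aTwo * kerK ((3 * Real.pi / 10 : ℝ) / τ) ((Real.pi - (3 * Real.pi / 10 : ℝ)) / τ) η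

noncomputable def thN (τ : ℂ) (η : ℝ) : ℂ := jacobiTheta₂ (1 / 2 + η / (2 * Real.pi)) (2 * I * τ / Real.pi)

theorem tau_im (τ : ℂ) (hτ : 0 < τ.re) : 0 < (2 * I * τ / Real.pi).im := by
  rw [show 2 * I * τ / Real.pi = ((2 / Real.pi : ℝ) : ℂ) * (I * τ) by push_cast; ring, Complex.im_ofReal_mul]
  simp
  positivity

theorem thN_hasSum (τ : ℂ) (hτ : 0 < τ.re) (η : ℝ) :
    HasSum (fun j : ℕ => (-1 : ℂ) ^ (j + 1) * exp (-(2 * (j + 1) ^ 2 * τ)) * (2 * cos ((j + 1) * η))) (thN τ η - 1) := by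
  have h := hasSum_jacobiTheta₂_term (1 / 2 + η / (2 * Real.pi)) (tau_im τ hτ)
  have hpi : (Real.pi : ℂ) ≠ 0 := by exact_mod_cast Real.pi_ne_zero
  have ht : ∀ n : ℤ, jacobiTheta₂_term n (1 / 2 + η / (2 * Real.pi)) (2 * I * τ / Real.pi)
      = (-1) ^ n * exp (-(2 * n ^ 2 * τ)) * exp (n * η * I) := by
    intro n
    unfold jacobiTheta₂_term
    rw [← Complex.exp_pi_mul_I, ← Complex.exp_int_mul, ← Complex.exp_add, ← Complex.exp_add]
    congr 1
    field_simp
    ring_nf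
    rw [I_sq]
    ring
  simp_rw [ht] at h
  have h2 := h.nat_add_neg
  rw [← hasSum_nat_add_iff' 1] at h2
  simp only [Finset.range_one, Finset.sum_singleton] at h2
  have e : thN τ η - 1 = jacobiTheta₂ (1 / 2 + η / (2 * Real.pi)) (2 * I * τ / Real.pi)
      + (-1) ^ (0:ℤ) * exp (-(2 * ((0:ℤ):ℂ) ^ 2 * τ)) * exp (((0:ℤ):ℂ) * η * I)
      - ((-1) ^ (((0:ℕ):ℤ)) * exp (-(2 * (((0:ℕ):ℤ):ℂ) ^ 2 * τ)) * exp ((((0:ℕ):ℤ):ℂ) * η * I)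
        + (-1) ^ (-((0:ℕ):ℤ)) * exp (-(2 * ((-((0:ℕ):ℤ):ℤ):ℂ) ^ 2 * τ)) * exp (((-((0:ℕ):ℤ):ℤ):ℂ) * η * I)) := by
    simp [thN]
  rw [e]
  suffices hj : ∀ j : ℕ, (-1 : ℂ) ^ (j + 1) * exp (-(2 * (j + 1) ^ 2 * τ)) * (2 * cos ((j + 1) * η))
      = (-1) ^ ((j + 1 : ℕ) : ℤ) * exp (-(2 * (((j + 1 : ℕ) : ℤ) : ℂ) ^ 2 * τ)) * exp ((((j + 1 : ℕ) : ℤ) : ℂ) * η * I)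
      + (-1) ^ (-((j + 1 : ℕ) : ℤ)) * exp (-(2 * ((-((j + 1 : ℕ) : ℤ) : ℤ) : ℂ) ^ 2 * τ)) * exp (((-((j + 1 : ℕ) : ℤ) : ℤ) : ℂ) * η * I) by
    simp_rw [hj]; exact h2
  intro j
  rw [two_cos, zpow_neg, zpow_natCast, ← inv_pow]
  push_cast
  rw [show (-1:ℂ)⁻¹ = -1 by norm_num]
  ring_nf

theorem thN_cont (τ : ℂ) (hτ : 0 < τ.re) : Continuous (thN τ) := by
  have h : Continuous (fun z => jacobiTheta₂ z (2 * I * τ / Real.pi)) :=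
    continuous_iff_continuousAt.mpr (fun z => (differentiableAt_jacobiTheta₂_fst z (tau_im τ hτ)).continuousAt)
  unfold thN
  exact h.comp (by fun_prop)

theorem div_re_pos (τ : ℂ) (hτ : 0 < τ.re) (x : ℝ) (hx : 0 < x) : 0 < ((x:ℂ) / τ).re := by
  rw [div_re]
  simp only [ofReal_re, ofReal_im, zero_mul, zero_div, add_zero]
  have : 0 < normSq τ := normSq_pos.mpr (by rintro rfl; simp at hτ)
  positivity

theorem sector_div (τ : ℂ) (x : ℝ) (h3 : τ.im ^ 2 ≤ 3 * τ.re ^ 2) : ((x:ℂ) / τ).im ^ 2 ≤ 3 * ((x:ℂ) / τ).re ^ 2 := by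
  rw [div_re, div_im]
  simp only [ofReal_re, ofReal_im, zero_mul, zero_div, add_zero, zero_sub]
  have e1 : (-(x * τ.im / normSq τ)) ^ 2 = (x / normSq τ) ^ 2 * τ.im ^ 2 := by ring
  have e2 : (x * τ.re / normSq τ) ^ 2 = (x / normSq τ) ^ 2 * τ.re ^ 2 := by ring
  rw [e1, e2]
  nlinarith [sq_nonneg (x / normSq τ)]

theorem ker_phi_int (τ : ℂ) (hτ : 0 < τ.re) (h3 : τ.im ^ 2 ≤ 3 * τ.re ^ 2) (φ : ℝ) (h0 : 0 < φ) (h1 : φ < Real.pi) :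
    IntegrableOn (kerK ((φ:ℂ) / τ) ((Real.pi - φ) / τ)) (Set.Ioi 0) := by
  refine kerK_int _ _ (div_re_pos τ hτ φ h0) ?_ ?_
  · have := div_re_pos τ hτ (Real.pi - φ) (by linarith)
    push_cast at this; exact this
  · rw [← add_div, add_sub_cancel]; exact sector_div τ _ h3

theorem ker_phi_cos (τ : ℂ) (hτ : 0 < τ.re) (h3 : τ.im ^ 2 ≤ 3 * τ.re ^ 2) (φ : ℝ) (h0 : 0 < φ) (h1 : φ < Real.pi) (J : ℕ) :
    ∫ η in Set.Ioi (0:ℝ), 2 * cos (J * η) * kerK ((φ:ℂ) / τ) ((Real.pi - φ) / τ) η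
      = τ * (1 / sin (φ - I * (J * τ)) + 1 / sin (φ + I * (J * τ))) := by
  have hτ0 : τ ≠ 0 := by rintro rfl; simp at hτ
  have p1 := div_re_pos τ hτ φ h0
  have p2 : 0 < ((Real.pi - φ : ℂ) / τ).re := by
    have := div_re_pos τ hτ (Real.pi - φ) (by linarith)
    push_cast at this; exact this
  have x1 : (φ - I * (J * τ)) / τ = φ / τ - J * I := by field_simp
  have x2 : (φ + I * (J * τ)) / τ = φ / τ + J * I := by field_simp
  have y1 : (Real.pi - (φ - I * (J * τ))) / τ = (Real.pi - φ) / τ + J * I := by field_simp; ring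
  have y2 : (Real.pi - (φ + I * (J * τ))) / τ = (Real.pi - φ) / τ - J * I := by field_simp; ring
  have i1 := kerK_integral τ (φ - I * (J * τ)) hτ h3 (by rw [x1]; simpa using p1) (by rw [y1]; simpa using p2)
  have i2 := kerK_integral τ (φ + I * (J * τ)) hτ h3 (by rw [x2]; simpa using p1) (by rw [y2]; simpa using p2)
  have s3 : ((φ:ℂ) / τ + (Real.pi - φ) / τ).im ^ 2 ≤ 3 * ((φ:ℂ) / τ + (Real.pi - φ) / τ).re ^ 2 := by
    rw [← add_div, add_sub_cancel]; exact sector_div τ _ h3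
  rw [x1, y1] at i1
  rw [x2, y2] at i2
  have j1 : IntegrableOn (kerK ((φ:ℂ) / τ - J * I) ((Real.pi - φ) / τ + J * I)) (Set.Ioi 0) := by
    refine kerK_int _ _ (by simpa using p1) (by simpa using p2) ?_
    rw [show (φ:ℂ) / τ - J * I + ((Real.pi - φ) / τ + J * I) = (φ:ℂ) / τ + (Real.pi - φ) / τ by ring]; exact s3
  have j2 : IntegrableOn (kerK ((φ:ℂ) / τ + J * I) ((Real.pi - φ) / τ - J * I)) (Set.Ioi 0) := by
    refine kerK_int _ _ (by simpa using p1) (by simpa using p2) ?_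
    rw [show (φ:ℂ) / τ + J * I + ((Real.pi - φ) / τ - J * I) = (φ:ℂ) / τ + (Real.pi - φ) / τ by ring]; exact s3
  rw [mul_add, mul_one_div, mul_one_div, ← i1, ← i2, ← integral_add j1 j2]
  refine integral_congr_ae (ae_of_all _ (fun η => ?_))
  simp only [kerK]
  rw [show (φ:ℂ) / τ - J * I + ((Real.pi - φ) / τ + J * I) = (φ:ℂ) / τ + (Real.pi - φ) / τ by ring,
    show (φ:ℂ) / τ + J * I + ((Real.pi - φ) / τ - J * I) = (φ:ℂ) / τ + (Real.pi - φ) / τ by ring, ← add_div, ← mul_div_assoc]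
  rw [two_cos]
  have e1 : exp (-((φ:ℂ) / τ - J * I) * η) = exp (-((φ:ℂ) / τ) * η) * exp (J * η * I) := by
    rw [← exp_add]; congr 1; ring
  have e2 : exp (-((φ:ℂ) / τ + J * I) * η) = exp (-((φ:ℂ) / τ) * η) * exp (-(J * η) * I) := by
    rw [← exp_add]; congr 1; ring
  have e3 : exp (-((Real.pi - φ) / τ - J * I) * η) = exp (-((Real.pi - φ) / τ) * η) * exp (J * η * I) := by
    rw [← exp_add]; congr 1; ring
  have e4 : exp (-((Real.pi - φ) / τ + J * I) * η) = exp (-((Real.pi - φ) / τ) * η) * exp (-(J * η) * I) := by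
    rw [← exp_add]; congr 1; ring
  rw [e1, e2, e3, e4]; ring

theorem KK_int (τ : ℂ) (hτ : 0 < τ.re) (h3 : τ.im ^ 2 ≤ 3 * τ.re ^ 2) : IntegrableOn (KK τ) (Set.Ioi 0) := by
  have hp := Real.pi_pos
  exact ((ker_phi_int τ hτ h3 (Real.pi / 10) (by positivity) (by linarith)).const_mul _).add
    ((ker_phi_int τ hτ h3 (3 * Real.pi / 10) (by positivity) (by linarith)).const_mul _)

theorem cos_int (f : ℝ → ℂ) (hf : IntegrableOn f (Set.Ioi 0)) (J : ℕ) :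
    IntegrableOn (fun η : ℝ => 2 * cos (J * η) * f η) (Set.Ioi 0) := by
  refine Integrable.bdd_mul (c := 2) hf (by fun_prop) (ae_of_all _ (fun η => ?_))
  rw [norm_mul, show ((J:ℂ) * η) = ((J * η : ℝ) : ℂ) by push_cast; rfl, ← ofReal_cos, norm_real, Real.norm_eq_abs]
  have := Real.abs_cos_le_one (J * η)
  simp only [Complex.norm_ofNat]
  linarith

theorem KK_cos (τ : ℂ) (hτ : 0 < τ.re) (h3 : τ.im ^ 2 ≤ 3 * τ.re ^ 2) (J : ℕ) :
    ∫ η in Set.Ioi (0:ℝ), 2 * cos (J * η) * KK τ η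
      = τ * (aOne * (1 / sin ((Real.pi / 10 : ℝ) - I * (J * τ)) + 1 / sin ((Real.pi / 10 : ℝ) + I * (J * τ)))
        + aTwo * (1 / sin ((3 * Real.pi / 10 : ℝ) - I * (J * τ)) + 1 / sin ((3 * Real.pi / 10 : ℝ) + I * (J * τ)))) := by
  have hp := Real.pi_pos
  have k1 := ker_phi_cos τ hτ h3 (Real.pi / 10) (by positivity) (by linarith) J
  have k2 := ker_phi_cos τ hτ h3 (3 * Real.pi / 10) (by positivity) (by linarith) J
  have i1 := cos_int _ (ker_phi_int τ hτ h3 (Real.pi / 10) (by positivity) (by linarith)) J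
  have i2 := cos_int _ (ker_phi_int τ hτ h3 (3 * Real.pi / 10) (by positivity) (by linarith)) J
  rw [mul_add, mul_left_comm, ← k1, mul_left_comm, ← k2, ← integral_const_mul, ← integral_const_mul,
    ← integral_add (i1.const_mul _) (i2.const_mul _)]
  refine integral_congr_ae (ae_of_all _ (fun η => ?_))
  simp only [KK]; ring

theorem KK_sum (τ : ℂ) (hτ : 0 < τ.re) (h3 : τ.im ^ 2 ≤ 3 * τ.re ^ 2) :
    ∫ η in Set.Ioi (0:ℝ), KK τ η = τ := by
  have h := KK_cos τ hτ h3 0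
  simp only [CharP.cast_eq_zero, zero_mul, cos_zero, mul_one, mul_zero, sub_zero, add_zero] at h
  rw [integral_const_mul] at h
  have ha : (aOne / Real.sin (Real.pi / 10) + aTwo / Real.sin (3 * Real.pi / 10) : ℂ) = 1 := by exact_mod_cast a_sum
  rw [← ofReal_sin, ← ofReal_sin] at h
  have h2 : (2:ℂ) * ∫ η in Set.Ioi (0:ℝ), KK τ η = 2 * τ := by
    rw [h]
    calc _ = 2 * τ * (aOne / Real.sin (Real.pi / 10) + aTwo / Real.sin (3 * Real.pi / 10) : ℂ) := by ring
      _ = _ := by rw [ha, mul_one]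
  exact mul_left_cancel₀ (by norm_num) h2

theorem kap_hasSum (w : ℂ) (hw : 0 < w.re) :
    HasSum (fun k : ℕ => (kap k : ℂ) * exp (-w) ^ (2 * k + 1))
      (aOne * (1 / sin ((Real.pi / 10 : ℝ) - I * w) + 1 / sin ((Real.pi / 10 : ℝ) + I * w))
        + aTwo * (1 / sin ((3 * Real.pi / 10 : ℝ) - I * w) + 1 / sin ((3 * Real.pi / 10 : ℝ) + I * w))) := by
  have h1 := (csc_pair (Real.pi / 10) w hw).mul_left (aOne : ℂ)
  have h2 := (csc_pair (3 * Real.pi / 10) w hw).mul_left (aTwo : ℂ)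
  have h := h1.add h2
  have e : ∀ k : ℕ, (kap k : ℂ) * exp (-w) ^ (2 * k + 1)
     = aOne * (4 * (Real.sin ((2 * k + 1) * (Real.pi / 10)) : ℂ) * exp (-w) ^ (2 * k + 1))
       + aTwo * (4 * (Real.sin ((2 * k + 1) * (3 * Real.pi / 10)) : ℂ) * exp (-w) ^ (2 * k + 1)) := by
    intro k
    have : ((kap k : ℤ) : ℂ) = ((kap k : ℝ) : ℂ) := by push_cast; rfl
    rw [this, kap_sin]
    push_cast
    ring
  simp_rw [e]
  exact h

theorem SerT_sum (τ : ℂ) (hτ : 0 < τ.re) (h3 : τ.im ^ 2 ≤ 3 * τ.re ^ 2) :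
    HasSum (fun j : ℕ => ∫ η in Set.Ioi (0:ℝ), (-1 : ℂ) ^ (j + 1) * exp (-(2 * (j + 1) ^ 2 * τ)) * (2 * cos ((j + 1) * η)) * KK τ η)
      (τ * (SerT τ - 1)) := by
  have h := (ST_summable _ (norm_exp_neg_lt τ hτ)).hasSum
  have e : SerT τ - 1 = ∑' x : ℕ × ℕ, (-1 : ℂ) ^ (x.1 + 1) * kap x.2 * exp (-τ) ^ ((x.1 + 1) * (2 * x.1 + 3 + 2 * x.2)) := by
    unfold SerT; ring
  rw [← e] at h
  have e1 : ∀ j : ℕ, ∫ η in Set.Ioi (0:ℝ), (-1 : ℂ) ^ (j + 1) * exp (-(2 * (j + 1) ^ 2 * τ)) * (2 * cos ((j + 1) * η)) * KK τ η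
      = τ * ((-1 : ℂ) ^ (j + 1) * exp (-(2 * (j + 1) ^ 2 * τ)) *
        (aOne * (1 / sin ((Real.pi / 10 : ℝ) - I * ((j + 1 : ℕ) * τ)) + 1 / sin ((Real.pi / 10 : ℝ) + I * ((j + 1 : ℕ) * τ)))
        + aTwo * (1 / sin ((3 * Real.pi / 10 : ℝ) - I * ((j + 1 : ℕ) * τ)) + 1 / sin ((3 * Real.pi / 10 : ℝ) + I * ((j + 1 : ℕ) * τ))))) := by
    intro j
    rw [mul_left_comm, ← KK_cos τ hτ h3 (j + 1), ← integral_const_mul]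
    refine integral_congr_ae (ae_of_all _ (fun η => ?_))
    push_cast
    ring
  simp_rw [e1]
  refine HasSum.mul_left τ (h.prod_fiberwise (fun j => ?_))
  have hk := (kap_hasSum ((j + 1 : ℕ) * τ) (by
    rw [show (((j + 1 : ℕ) : ℂ)) = ((j + 1 : ℕ) : ℝ) by push_cast; rfl, re_ofReal_mul]; positivity)).mul_left
      ((-1 : ℂ) ^ (j + 1) * exp (-(2 * (j + 1) ^ 2 * τ)))
  suffices hj : ∀ k : ℕ, (-1 : ℂ) ^ (j + 1) * kap k * exp (-τ) ^ ((j + 1) * (2 * j + 3 + 2 * k))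
      = (-1 : ℂ) ^ (j + 1) * exp (-(2 * (j + 1) ^ 2 * τ)) * ((kap k : ℂ) * exp (-((j + 1 : ℕ) * τ)) ^ (2 * k + 1)) by
    simp_rw [hj]; exact hk
  intro k
  have : exp (-τ) ^ ((j + 1) * (2 * j + 3 + 2 * k)) = exp (-(2 * (j + 1) ^ 2 * τ)) * exp (-((j + 1 : ℕ) * τ)) ^ (2 * k + 1) := by
    rw [← exp_nat_mul, ← exp_nat_mul, ← exp_add]; congr 1; push_cast; ring
  rw [this]; ring

theorem SerT_integral (τ : ℂ) (hτ : 0 < τ.re) (h3 : τ.im ^ 2 ≤ 3 * τ.re ^ 2) :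
    IntegrableOn (fun η => thN τ η * KK τ η) (Set.Ioi 0) ∧
    ∫ η in Set.Ioi (0:ℝ), thN τ η * KK τ η = τ * SerT τ := by
  have hK := KK_int τ hτ h3
  set c : ℕ → ℝ := fun j => 2 * Real.exp (-τ.re) ^ j with hc
  have hcs : Summable c := by
    refine (summable_geometric_of_lt_one (Real.exp_pos _).le ?_).mul_left 2
    rw [Real.exp_lt_one_iff]; linarith
  have hb : ∀ (j : ℕ) (η : ℝ), ‖(-1 : ℂ) ^ (j + 1) * exp (-(2 * (j + 1) ^ 2 * τ)) * (2 * cos ((j + 1) * η))‖ ≤ c j := by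
    intro j η
    rw [norm_mul, norm_mul, norm_pow, norm_neg, norm_one, one_pow, one_mul, norm_mul, Complex.norm_ofNat,
      show (((j:ℂ) + 1) * η) = (((j + 1) * η : ℝ) : ℂ) by push_cast; rfl, ← ofReal_cos, norm_real, Real.norm_eq_abs,
      norm_exp_neg, show (2 * ((j:ℂ) + 1) ^ 2 * τ) = ((2 * ((j:ℝ) + 1) ^ 2 : ℝ) : ℂ) * τ by push_cast; rfl, re_ofReal_mul]
    simp only [hc]
    rw [← Real.exp_nat_mul, mul_comm (2:ℝ) (Real.exp _)]
    have h1 := Real.abs_cos_le_one ((j + 1) * η)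
    have hj : (0:ℝ) ≤ j := Nat.cast_nonneg j
    gcongr
    · have : (j:ℝ) ≤ 2 * ((j:ℝ) + 1) ^ 2 := by nlinarith
      have := mul_le_mul_of_nonneg_right this hτ.le
      linarith
    · linarith
  have hbK : ∀ᵐ η ∂(volume.restrict (Set.Ioi (0:ℝ))), ‖thN τ η - 1‖ ≤ ∑' j, c j :=
    ae_of_all _ (fun η => (thN_hasSum τ hτ η).norm_le_of_bounded hcs.hasSum (fun j => hb j η))
  have hI : IntegrableOn (fun η => (thN τ η - 1) * KK τ η) (Set.Ioi 0) :=
    Integrable.bdd_mul hK (((thN_cont τ hτ).sub continuous_const).aestronglyMeasurable) hbK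
  have hS := hasSum_integral_of_summable_integral_norm (μ := volume.restrict (Set.Ioi (0:ℝ)))
    (F := fun (j : ℕ) (η : ℝ) => (-1 : ℂ) ^ (j + 1) * exp (-(2 * (j + 1) ^ 2 * τ)) * (2 * cos ((j + 1) * η)) * KK τ η)
    (fun j => Integrable.bdd_mul hK (by fun_prop) (ae_of_all _ (hb j)))
    (by
      refine Summable.of_nonneg_of_le (fun j => integral_nonneg (fun η => norm_nonneg _)) (fun j => ?_)
        (hcs.mul_right (∫ η in Set.Ioi (0:ℝ), ‖KK τ η‖))
      rw [← integral_const_mul]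
      refine integral_mono_of_nonneg (ae_of_all _ (fun η => norm_nonneg _)) (hK.norm.const_mul _) (ae_of_all _ (fun η => ?_))
      simp only
      rw [norm_mul]
      exact mul_le_mul_of_nonneg_right (hb j η) (norm_nonneg _))
  have hu := hS.unique (SerT_sum τ hτ h3)
  have e1 : ∀ η : ℝ, ∑' j : ℕ, (-1 : ℂ) ^ (j + 1) * exp (-(2 * (j + 1) ^ 2 * τ)) * (2 * cos ((j + 1) * η)) * KK τ η
      = (thN τ η - 1) * KK τ η := by
    intro η
    rw [tsum_mul_right, (thN_hasSum τ hτ η).tsum_eq]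
  simp_rw [e1] at hu
  have e2 : (fun η => thN τ η * KK τ η) = fun η => (thN τ η - 1) * KK τ η + KK τ η := by
    funext η; ring
  rw [e2]
  refine ⟨hI.add hK, ?_⟩
  rw [integral_add hI hK, hu, KK_sum τ hτ h3]
  ring
end C4s

section C2s
open Complex MeasureTheory

theorem hasSum_natAbs (r : ℝ) (h0 : 0 ≤ r) (h1 : r < 1) :
    HasSum (fun n : ℤ => r ^ n.natAbs) ((1 - r)⁻¹ + r * (1 - r)⁻¹) := by
  have h := hasSum_geometric_of_lt_one h0 h1
  refine HasSum.of_nat_of_neg_add_one ?_ ?_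
  · simpa using h
  · have h2 := h.mul_left r
    have e : ∀ n : ℕ, r ^ (-((n:ℤ) + 1)).natAbs = r * r ^ n := by
      intro n
      have : (-((n:ℤ) + 1)).natAbs = n + 1 := by omega
      rw [this, pow_succ]; ring
    simp_rw [e]; exact h2

/-- Gaussian terms after the functional equation. -/
noncomputable def gT (τ ζ : ℂ) (n : ℤ) : ℂ := exp (-((ζ - (2 * n - 1) * Real.pi) ^ 2 / (8 * τ)))

theorem gauss_fe (τ : ℂ) (hτ : 0 < τ.re) (ζ : ℂ) :
    HasSum (gT τ ζ) ((2 * τ / Real.pi) ^ (1 / 2 : ℂ) * jacobiTheta₂ (1 / 2 + ζ / (2 * Real.pi)) (2 * I * τ / Real.pi)) := by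
  have hτ0 : τ ≠ 0 := by rintro rfl; simp at hτ
  have hpi : (Real.pi : ℂ) ≠ 0 := by exact_mod_cast Real.pi_ne_zero
  have hpos := tau_im τ hτ
  set τ' := 2 * I * τ / Real.pi with hτ'
  set z := 1 / 2 + ζ / (2 * Real.pi) with hz
  have hτ'0 : τ' ≠ 0 := by rintro h; rw [h] at hpos; simp at hpos
  have e1 : -I * τ' = 2 * τ / Real.pi := by
    rw [hτ', show -I * (2 * I * τ / Real.pi) = -(I ^ 2) * (2 * τ / Real.pi) by ring, I_sq]; ring
  have hne : (2 * τ / Real.pi) ^ (1 / 2 : ℂ) ≠ 0 := by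
    rw [cpow_def_of_ne_zero (by simp [hτ0, hpi])]; exact exp_ne_zero _
  rw [jacobiTheta₂_functional_equation, e1, mul_assoc, ← mul_assoc, mul_one_div_cancel hne, one_mul]
  have hpos2 : 0 < (-1 / τ').im := by
    rw [neg_div, neg_im, one_div, inv_im, neg_div, neg_neg]
    exact div_pos hpos (normSq_pos.mpr hτ'0)
  have h := (hasSum_jacobiTheta₂_term (z / τ') hpos2).mul_left (exp (-Real.pi * I * z ^ 2 / τ'))
  suffices hj : ∀ n : ℤ, gT τ ζ n = exp (-Real.pi * I * z ^ 2 / τ') * jacobiTheta₂_term n (z / τ') (-1 / τ') by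
    rw [show gT τ ζ = _ from funext hj]; exact h
  intro n
  unfold gT jacobiTheta₂_term
  rw [← exp_add]
  congr 1
  rw [hτ', hz]
  field_simp
  ring

theorem norm_gT (τ : ℂ) (η : ℝ) (n : ℤ) :
    ‖gT τ η n‖ = Real.exp (-((1 / τ).re * ((η - (2 * n - 1) * Real.pi) ^ 2 / 8))) := by
  unfold gT
  have : ((η:ℂ) - (2 * n - 1) * Real.pi) ^ 2 / (8 * τ) = (((η - (2 * n - 1) * Real.pi) ^ 2 / 8 : ℝ) : ℂ) * (1 / τ) := by
    push_cast; rw [← div_div, mul_one_div]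
  rw [this, norm_exp_neg, re_ofReal_mul, mul_comm]

theorem gauss_pt (η : ℝ) (hη : 0 ≤ η) (n : ℤ) (hn : n ≠ 1) :
    Real.pi ^ 2 * (1 / 8 + 1 / 100 * n.natAbs) ≤ (η - (2 * n - 1) * Real.pi) ^ 2 / 8 + 5 / 100 * Real.pi * η := by
  have hp := Real.pi_pos
  have hN : ((n.natAbs : ℕ) : ℝ) = |(n:ℝ)| := by
    rw [Nat.cast_natAbs, Int.cast_abs]
  rw [hN]
  rcases lt_or_ge n 1 with h | h
  · have h1 : (n:ℝ) ≤ 0 := by exact_mod_cast Int.lt_add_one_iff.mp h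
    rw [abs_of_nonpos h1]
    have h2 : (n:ℝ) ^ 2 ≥ - n := by
      have : n ^ 2 ≥ -n := by nlinarith
      exact_mod_cast this
    have h3 : 0 ≤ η * ((1 - 2 * n) * Real.pi) := mul_nonneg hη (mul_nonneg (by linarith) hp.le)
    have h4 : 0 ≤ Real.pi * η := mul_nonneg hp.le hη
    have h5 : Real.pi ^ 2 * (1 / 8 + 1 / 100 * -n) ≤ Real.pi ^ 2 * ((2 * n - 1) ^ 2 / 8) := by
      apply mul_le_mul_of_nonneg_left _ (sq_nonneg _)
      nlinarith
    nlinarith [sq_nonneg η]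
  · have h1 : (2:ℝ) ≤ n := by
      have : (2:ℤ) ≤ n := by omega
      exact_mod_cast this
    rw [abs_of_nonneg (by linarith)]
    have h5 : Real.pi ^ 2 * (1 / 8 + 1 / 100 * n) ≤ Real.pi ^ 2 * (5 / 100 * (2 * n - 1) - 1 / 200) := by
      apply mul_le_mul_of_nonneg_left _ (sq_nonneg _)
      linarith
    nlinarith [sq_nonneg (η - (2 * n - 1) * Real.pi + Real.pi / 5)]

theorem hasSum_remove {f : ℤ → ℂ} {s : ℂ} (h : HasSum f s) (m : ℤ) :
    HasSum (fun n => if n = m then 0 else f n) (s - f m) := by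
  have h1 := hasSum_ite_eq m (f m)
  have h2 := h.sub h1
  refine h2.congr_fun (fun n => ?_)
  by_cases hn : n = m <;> simp [hn]
end C2s

section C2bs
open Complex MeasureTheory

theorem sum_small {f : ℤ → ℂ} {s : ℂ} (h : HasSum f s) (c r : ℝ) (hc : 0 ≤ c) (h0 : 0 ≤ r) (h1 : r ≤ 1 / 3)
    (hb : ∀ n, ‖f n‖ ≤ c * r ^ n.natAbs) : ‖s‖ ≤ 2 * c := by
  have h2 := (hasSum_natAbs r h0 (by linarith)).mul_left c
  have h3 := tsum_of_norm_bounded h2 hb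
  rw [h.tsum_eq] at h3
  refine h3.trans ?_
  rw [mul_comm 2 c]
  apply mul_le_mul_of_nonneg_left _ hc
  have h4 : 0 < 1 - r := by linarith
  rw [← one_add_mul, ← div_eq_mul_inv, div_le_iff₀ h4]
  linarith

theorem pi_sq_gt : 9.8 < Real.pi ^ 2 := by nlinarith [Real.pi_gt_d4]

theorem exp_small (x : ℝ) (h : 1.9 ≤ x) : Real.exp (-x) ≤ 1 / 3 := by
  have h2 : Real.exp (-x) ≤ Real.exp (-1.9) := Real.exp_le_exp.mpr (by linarith)
  have h3 : Real.exp (1.9) ≥ 3 := by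
    have := Real.add_one_le_exp (0.95:ℝ)
    have e : Real.exp 1.9 = Real.exp 0.95 ^ 2 := by rw [← Real.exp_nat_mul]; norm_num
    rw [e]; nlinarith
  rw [Real.exp_neg 1.9] at h2
  refine h2.trans ?_
  rw [one_div]; exact inv_anti₀ (by norm_num) h3

theorem G_err (τ : ℂ) (hτ : 0 < τ.re) (hρ : 20 ≤ (1 / τ).re) (η : ℝ) (hη : 0 ≤ η) :
    ‖(2 * τ / Real.pi) ^ (1 / 2 : ℂ) * thN τ η - gT τ η 1‖ ≤
      2 * Real.exp ((1 / τ).re * (- (Real.pi ^ 2 / 8) + 5 / 100 * Real.pi * η)) := by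
  have h := hasSum_remove (gauss_fe τ hτ η) 1
  set ρ := (1 / τ).re with hρd
  have hp2 := pi_sq_gt
  refine sum_small h _ (Real.exp (-(1 / 100 * Real.pi ^ 2 * ρ))) (Real.exp_pos _).le (Real.exp_pos _).le
    (exp_small _ (by nlinarith)) ?_
  intro n
  by_cases hn : n = 1
  · simp only [hn, if_true, norm_zero]; positivity
  · simp only [hn, if_false]
    rw [norm_gT, ← Real.exp_nat_mul, ← Real.exp_add]
    apply Real.exp_le_exp.mpr
    have := mul_le_mul_of_nonneg_left (gauss_pt η hη n hn) (show 0 ≤ ρ by linarith)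
    rw [← hρd]; linarith

theorem gT_psi (τ : ℂ) (hτ0 : τ ≠ 0) (n : ℤ) :
    gT τ (I * τ) n = exp (τ / 8 - Real.pi ^ 2 / (8 * τ) * (2 * n - 1) ^ 2 + (2 * n - 1) * (Real.pi / 4) * I) := by
  unfold gT
  congr 1
  have : (I * τ - (2 * n - 1) * Real.pi) ^ 2 = I ^ 2 * τ ^ 2 - 2 * I * τ * ((2 * n - 1) * Real.pi) + (2 * n - 1) ^ 2 * Real.pi ^ 2 := by ring
  rw [this, I_sq]
  field_simp
  ring

theorem norm_gT_psi (τ : ℂ) (hτ0 : τ ≠ 0) (n : ℤ) :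
    ‖gT τ (I * τ) n‖ = Real.exp (τ.re / 8 - (1 / τ).re * (Real.pi ^ 2 / 8) * (2 * n - 1) ^ 2) := by
  rw [gT_psi τ hτ0, norm_exp]
  congr 1
  have e1 : (Real.pi:ℂ) ^ 2 / (8 * τ) * (2 * n - 1) ^ 2 = ((Real.pi ^ 2 / 8 * (2 * n - 1) ^ 2 : ℝ) : ℂ) * (1 / τ) := by
    push_cast; field_simp
  have e2 : (2 * n - 1 : ℂ) * (Real.pi / 4) * I = (((2 * n - 1) * (Real.pi / 4) : ℝ) : ℂ) * I := by push_cast; ring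
  have e3 : τ / 8 = ((1 / 8 : ℝ) : ℂ) * τ := by push_cast; ring
  rw [e1, e2, e3, add_re, sub_re, re_ofReal_mul, re_ofReal_mul, re_ofReal_mul, I_re]; ring

theorem psi_main (τ : ℂ) (hτ0 : τ ≠ 0) : gT τ (I * τ) 0 + gT τ (I * τ) 1 = √2 * exp (τ / 8 - Real.pi ^ 2 / (8 * τ)) := by
  rw [gT_psi τ hτ0, gT_psi τ hτ0, exp_add, exp_add]
  push_cast
  rw [show (2 * 0 - 1 : ℂ) ^ 2 = 1 by norm_num, show (2 * 1 - 1 : ℂ) ^ 2 = 1 by norm_num,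
    show (2 * 0 - 1 : ℂ) * (Real.pi / 4) * I = -(((Real.pi / 4 : ℝ) : ℂ)) * I by push_cast; ring,
    show (2 * 1 - 1 : ℂ) * (Real.pi / 4) * I = (((Real.pi / 4 : ℝ) : ℂ)) * I by push_cast; ring, mul_one, ← mul_add,
    add_comm (exp (-((Real.pi / 4 : ℝ) : ℂ) * I)), ← two_cos, ← ofReal_cos, Real.cos_pi_div_four]
  push_cast; ring

theorem P_err (τ : ℂ) (hτ : 0 < τ.re) (hρ : 20 ≤ (1 / τ).re) :
    ‖(2 * τ / Real.pi) ^ (1 / 2 : ℂ) * psiT τ - √2 * exp (τ / 8 - Real.pi ^ 2 / (8 * τ))‖ ≤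
      2 * (Real.exp (τ.re / 8 - (1 / τ).re * (Real.pi ^ 2 / 8)) * Real.exp (-(1 / 4 * Real.pi ^ 2 * (1 / τ).re))) := by
  have hτ0 : τ ≠ 0 := by rintro rfl; simp at hτ
  have h := hasSum_remove (hasSum_remove (gauss_fe τ hτ (I * τ)) 0) 1
  simp only [one_ne_zero, if_false] at h
  rw [sub_sub, psi_main τ hτ0] at h
  set ρ := (1 / τ).re with hρd
  have hp2 := pi_sq_gt
  unfold psiT
  refine sum_small h _ (Real.exp (-(1 / 4 * Real.pi ^ 2 * ρ))) (by positivity) (Real.exp_pos _).le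
    (exp_small _ (by nlinarith)) ?_
  intro n
  by_cases hn : n = 1
  · simp only [hn, if_true, norm_zero]; positivity
  by_cases hn0 : n = 0
  · simp only [hn0, if_true, norm_zero]; simp; positivity
  simp only [hn, hn0, if_false]
  rw [norm_gT_psi τ hτ0, ← hρd, ← Real.exp_nat_mul, ← Real.exp_add, ← Real.exp_add]
  apply Real.exp_le_exp.mpr
  have hk : (1:ℝ) + 2 * n.natAbs + 2 ≤ (2 * n - 1) ^ 2 := by
    have : (1:ℤ) + 2 * n.natAbs + 2 ≤ (2 * n - 1) ^ 2 := by
      rcases lt_or_ge n 0 with h | h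
      · rw [show (n.natAbs : ℤ) = -n by omega]; nlinarith
      · rw [show (n.natAbs : ℤ) = n by omega]
        have : 2 ≤ n := by omega
        nlinarith
    have h9 : (((1:ℤ) + 2 * n.natAbs + 2 : ℤ) : ℝ) ≤ (((2 * n - 1) ^ 2 : ℤ) : ℝ) := Int.cast_le.mpr this
    simpa only [Int.cast_add, Int.cast_mul, Int.cast_pow, Int.cast_sub, Int.cast_natCast, Int.cast_one, Int.cast_ofNat] using h9
  have := mul_le_mul_of_nonneg_left hk (show 0 ≤ ρ * (Real.pi ^ 2 / 8) by positivity)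
  linarith

end C2bs

section C2cs
open Complex MeasureTheory

theorem aOne_bd : 0.085 ≤ aOne ∧ aOne ≤ 0.09 := by
  unfold aOne
  have h1 : (2.235:ℝ) ≤ √5 := Real.le_sqrt_of_sq_le (by norm_num)
  have h2 : √5 ≤ 2.24 := Real.sqrt_le_iff.mpr ⟨by norm_num, by norm_num⟩
  constructor <;> linarith

theorem aTwo_bd : 0 ≤ aTwo ∧ aTwo ≤ 0.6 := by
  unfold aTwo
  have h1 : (2.235:ℝ) ≤ √5 := Real.le_sqrt_of_sq_le (by norm_num)
  have h2 : √5 ≤ 2.24 := Real.sqrt_le_iff.mpr ⟨by norm_num, by norm_num⟩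
  constructor <;> linarith

theorem re_ofReal_div (τ : ℂ) (x : ℝ) : ((x:ℂ) / τ).re = x * (1 / τ).re := by
  rw [← mul_one_div, re_ofReal_mul]

theorem ker_bd (τ : ℂ) (h3 : τ.im ^ 2 ≤ 3 * τ.re ^ 2) (hρ : 0 < (1 / τ).re) (x : ℝ) (hx : 0 ≤ x) (hx2 : x ≤ Real.pi / 2)
    (η : ℝ) (hη : 0 ≤ η) :
    ‖kerK ((x:ℂ) / τ) ((Real.pi - x) / τ) η‖ ≤ 4 * Real.exp (-(x * (1 / τ).re * η)) ∧
    ‖kerK ((x:ℂ) / τ) ((Real.pi - x) / τ) η - exp (-((x:ℂ) / τ) * η)‖ ≤ 4 * Real.exp (-((Real.pi - x) * (1 / τ).re * η)) := by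
  have hp := Real.pi_pos
  set ρ := (1 / τ).re with hρd
  have eb : ((Real.pi:ℂ) - x) / τ = ((Real.pi - x : ℝ) : ℂ) / τ := by push_cast; rfl
  have eab : (x:ℂ) / τ + (Real.pi - x) / τ = ((Real.pi : ℝ) : ℂ) / τ := by rw [← add_div]; congr 1; ring
  have hre : 0 < (((Real.pi : ℝ) : ℂ) / τ).re := by rw [re_ofReal_div]; positivity
  have hmono : Real.exp (-((Real.pi - x) * ρ * η)) ≤ Real.exp (-(x * ρ * η)) := by
    apply Real.exp_le_exp.mpr
    have := mul_le_mul_of_nonneg_right (show x ≤ Real.pi - x by linarith) (mul_nonneg hρ.le hη)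
    linarith
  constructor
  · have h := kerK_bound ((x:ℂ) / τ) ((Real.pi - x) / τ) (by rw [eab]; exact hre) (by rw [eab]; exact sector_div τ _ h3) η hη
    rw [eb, re_ofReal_div, re_ofReal_div, ← hρd, ← eb] at h
    rw [show -(x * ρ) * η = -(x * ρ * η) by ring, show -((Real.pi - x) * ρ) * η = -((Real.pi - x) * ρ * η) by ring] at h
    linarith
  · have hw := one_add_exp_lower ((((Real.pi : ℝ) : ℂ) / τ) * η) (by
        rw [mul_comm, re_ofReal_mul]; positivity) (by
        rw [mul_comm, re_ofReal_mul, im_ofReal_mul]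
        have := mul_le_mul_of_nonneg_left (sector_div τ Real.pi h3) (sq_nonneg η)
        nlinarith)
    have hne : 1 + exp (-(((Real.pi : ℝ) : ℂ) / τ * η)) ≠ 0 := by
      intro h0; rw [h0] at hw; norm_num at hw
    unfold kerK
    rw [eab, div_sub' hne, norm_div, div_le_iff₀ (by linarith)]
    have e2 : exp (-((x:ℂ) / τ) * η) + exp (-((Real.pi - x) / τ) * η) - (1 + exp (-(((Real.pi : ℝ) : ℂ) / τ * η))) * exp (-((x:ℂ) / τ) * η)
        = exp (-((Real.pi - x) / τ) * η) - exp (-(((Real.pi + x : ℝ) : ℂ) / τ) * η) := by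
      rw [add_mul, one_mul, ← exp_add]
      have : -(((Real.pi : ℝ) : ℂ) / τ * η) + -((x:ℂ) / τ) * η = -(((Real.pi + x : ℝ) : ℂ) / τ) * η := by push_cast; ring
      rw [this]; ring
    rw [e2]
    refine (norm_sub_le _ _).trans ?_
    have n1 : ∀ y : ℝ, ‖exp (-((y:ℂ) / τ) * η)‖ = Real.exp (-(y * ρ * η)) := by
      intro y
      rw [neg_mul, norm_exp_neg, mul_comm, re_ofReal_mul, re_ofReal_div, mul_comm]
    rw [eb, n1, n1]
    have : Real.exp (-((Real.pi + x) * ρ * η)) ≤ Real.exp (-((Real.pi - x) * ρ * η)) := by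
      apply Real.exp_le_exp.mpr
      have := mul_le_mul_of_nonneg_right (show Real.pi - x ≤ Real.pi + x by linarith) (mul_nonneg hρ.le hη)
      linarith
    have hE := Real.exp_pos (-((Real.pi - x) * ρ * η))
    nlinarith

theorem KK_bd (τ : ℂ) (h3 : τ.im ^ 2 ≤ 3 * τ.re ^ 2) (hρ : 0 < (1 / τ).re) (η : ℝ) (hη : 0 ≤ η) :
    ‖KK τ η‖ ≤ 5 * Real.exp (-(1 / 10 * Real.pi * (1 / τ).re * η)) ∧
    ‖KK τ η - aOne * exp (-(((Real.pi / 10 : ℝ) : ℂ) / τ) * η)‖ ≤ 4 * Real.exp (-(3 / 10 * Real.pi * (1 / τ).re * η)) := by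
  have hp := Real.pi_pos
  obtain ⟨a1, a2⟩ := ker_bd τ h3 hρ (Real.pi / 10) (by positivity) (by linarith) η hη
  obtain ⟨b1, -⟩ := ker_bd τ h3 hρ (3 * Real.pi / 10) (by positivity) (by linarith) η hη
  set ρ := (1 / τ).re with hρd
  obtain ⟨o1, o2⟩ := aOne_bd
  obtain ⟨t1, t2⟩ := aTwo_bd
  have nO : ‖(aOne : ℂ)‖ = aOne := by rw [norm_real, Real.norm_eq_abs, abs_of_nonneg (by linarith)]
  have nT : ‖(aTwo : ℂ)‖ = aTwo := by rw [norm_real, Real.norm_eq_abs, abs_of_nonneg (by linarith)]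
  have hm : ∀ x y : ℝ, x ≤ y → Real.exp (-(y * Real.pi * ρ * η)) ≤ Real.exp (-(x * Real.pi * ρ * η)) := by
    intro x y h
    apply Real.exp_le_exp.mpr
    have := mul_le_mul_of_nonneg_right h (show 0 ≤ Real.pi * ρ * η by positivity)
    linarith
  rw [show Real.pi / 10 * ρ * η = 1 / 10 * Real.pi * ρ * η by ring] at a1
  rw [show (Real.pi - Real.pi / 10) * ρ * η = 9 / 10 * Real.pi * ρ * η by ring] at a2
  rw [show 3 * Real.pi / 10 * ρ * η = 3 / 10 * Real.pi * ρ * η by ring] at b1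
  have m1 := hm (1 / 10) (3 / 10) (by norm_num)
  have m2 := hm (3 / 10) (9 / 10) (by norm_num)
  have e1 := Real.exp_pos (-(1 / 10 * Real.pi * ρ * η))
  have e2 := Real.exp_pos (-(3 / 10 * Real.pi * ρ * η))
  have key : ∀ (c u k B : ℝ) (z : ℂ), 0 ≤ c → c ≤ k → 0 ≤ B → ‖z‖ ≤ B → c * ‖z‖ ≤ k * B := by
    intro c u k B z h0 h1 h2 h4
    exact mul_le_mul h1 h4 (norm_nonneg _) (h0.trans h1)
  constructor
  · unfold KK
    refine (norm_add_le _ _).trans ?_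
    rw [norm_mul, norm_mul, nO, nT]
    have k1 := key aOne 0 _ _ _ (by linarith) o2 (by positivity) a1
    have k2 := key aTwo 0 _ _ _ t1 t2 (by positivity) b1
    nlinarith
  · unfold KK
    rw [add_sub_right_comm, ← mul_sub]
    refine (norm_add_le _ _).trans ?_
    rw [norm_mul, norm_mul, nO, nT]
    have k1 := key aOne 0 _ _ _ (by linarith) o2 (by positivity) a2
    have k2 := key aTwo 0 _ _ _ t1 t2 (by positivity) b1
    nlinarith

/-- The main Gaussian integrand. -/
noncomputable def gM (τ : ℂ) (η : ℝ) : ℂ := aOne * exp (-(((Real.pi / 10 : ℝ) : ℂ) / τ) * η) * gT τ η 1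

theorem GK_err (τ : ℂ) (hτ : 0 < τ.re) (h3 : τ.im ^ 2 ≤ 3 * τ.re ^ 2) (hρ : 20 ≤ (1 / τ).re) (η : ℝ) (hη : 0 ≤ η) :
    ‖(2 * τ / Real.pi) ^ (1 / 2 : ℂ) * thN τ η * KK τ η - gM τ η‖ ≤
      14 * Real.exp (-((1 / τ).re * (Real.pi ^ 2 / 8))) * Real.exp (-(1 / 20 * Real.pi * (1 / τ).re) * η) := by
  have hp := Real.pi_pos
  obtain ⟨k1, k2⟩ := KK_bd τ h3 (by linarith) η hη
  have g1 := G_err τ hτ hρ η hη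
  have g2 := norm_gT τ η 1
  set ρ := (1 / τ).re with hρd
  set G := (2 * τ / Real.pi) ^ (1 / 2 : ℂ) * thN τ η with hG
  have e : G * KK τ η - gM τ η = (G - gT τ η 1) * KK τ η + gT τ η 1 * (KK τ η - aOne * exp (-(((Real.pi / 10 : ℝ) : ℂ) / τ) * η)) := by
    unfold gM; ring
  rw [e]
  refine (norm_add_le _ _).trans ?_
  rw [norm_mul, norm_mul]
  have p1 : ‖G - gT τ η 1‖ * ‖KK τ η‖ ≤ 10 * (Real.exp (-(ρ * (Real.pi ^ 2 / 8))) * Real.exp (-(1 / 20 * Real.pi * ρ) * η)) := by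
    refine (mul_le_mul g1 k1 (norm_nonneg _) (by positivity)).trans ?_
    rw [mul_mul_mul_comm, ← Real.exp_add, ← Real.exp_add]
    norm_num
    linarith
  have p2 : ‖gT τ η 1‖ * ‖KK τ η - aOne * exp (-(((Real.pi / 10 : ℝ) : ℂ) / τ) * η)‖ ≤ 4 * (Real.exp (-(ρ * (Real.pi ^ 2 / 8))) * Real.exp (-(1 / 20 * Real.pi * ρ) * η)) := by
    refine (mul_le_mul g2.le k2 (norm_nonneg _) (by positivity)).trans ?_
    rw [mul_left_comm, ← Real.exp_add, ← Real.exp_add]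
    refine mul_le_mul_of_nonneg_left (Real.exp_le_exp.mpr ?_) (by norm_num)
    push_cast
    have := mul_nonneg (show 0 ≤ ρ by linarith) (sq_nonneg η)
    nlinarith
  linarith

theorem gM_quad (τ : ℂ) (hτ0 : τ ≠ 0) (η : ℝ) : gM τ η = aOne * exp ((-(1 / (8 * τ))) * (η:ℂ) ^ 2 + (3 / 20 * Real.pi / τ) * η + -(Real.pi ^ 2 / (8 * τ))) := by
  unfold gM gT
  rw [mul_assoc, ← exp_add]
  congr 2
  push_cast
  field_simp
  ring

theorem neg_re_b (τ : ℂ) (hρ : 0 < (1 / τ).re) : (-(1 / (8 * τ))).re < 0 := by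
  rw [show -(1 / (8 * τ)) = ((-1 / 8 : ℝ) : ℂ) * (1 / τ) by push_cast; rw [one_div, mul_inv]; ring, re_ofReal_mul]
  linarith

theorem gM_int (τ : ℂ) (hτ0 : τ ≠ 0) (hρ : 0 < (1 / τ).re) : Integrable (gM τ) := by
  rw [show gM τ = _ from funext (gM_quad τ hτ0)]
  exact (integrable_cexp_quadratic' (neg_re_b τ hρ) _ _).const_mul _

theorem gM_integral (τ : ℂ) (hτ0 : τ ≠ 0) (hρ : 0 < (1 / τ).re) :
    ∫ η : ℝ, gM τ η = aOne * ((8 * Real.pi * τ) ^ (1 / 2 : ℂ) * exp (-(2 / 25 * Real.pi ^ 2 / τ))) := by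
  simp_rw [gM_quad τ hτ0]
  rw [integral_const_mul, integral_cexp_quadratic (neg_re_b τ hρ)]
  congr 3
  · field_simp
  · field_simp
    ring

theorem gM_tail (τ : ℂ) (hτ0 : τ ≠ 0) (hρ : 20 ≤ (1 / τ).re) :
    ‖∫ η in Set.Iic (0:ℝ), gM τ η‖ ≤ Real.exp (-((1 / τ).re * (Real.pi ^ 2 / 8))) := by
  have hp := Real.pi_gt_three
  set ρ := (1 / τ).re with hρd
  have hc : 0 < 3 / 20 * Real.pi * ρ := by positivity
  obtain ⟨o1, o2⟩ := aOne_bd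
  have hb : ∀ η ∈ Set.Iic (0:ℝ), ‖gM τ η‖ ≤ Real.exp (-(ρ * (Real.pi ^ 2 / 8))) * Real.exp (3 / 20 * Real.pi * ρ * η) := by
    intro η hη
    have hη : η ≤ 0 := hη
    unfold gM
    rw [norm_mul, norm_mul, norm_gT, neg_mul, norm_exp_neg, ← hρd, mul_comm _ (η:ℂ), re_ofReal_mul, re_ofReal_div, ← hρd, norm_real,
      Real.norm_eq_abs, abs_of_nonneg (by linarith), mul_assoc, ← Real.exp_add, ← Real.exp_add]
    refine (mul_le_of_le_one_left (Real.exp_pos _).le (by linarith)).trans (Real.exp_le_exp.mpr ?_)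
    push_cast
    have := mul_nonneg (show 0 ≤ ρ by linarith) (sq_nonneg η)
    nlinarith
  refine (norm_integral_le_of_norm_le ((integrableOn_exp_mul_Iic hc 0).const_mul _)
    ((ae_restrict_iff' measurableSet_Iic).mpr (ae_of_all _ hb))).trans ?_
  rw [integral_const_mul, integral_exp_mul_Iic hc]
  apply mul_le_of_le_one_right (Real.exp_pos _).le
  rw [mul_zero, Real.exp_zero, div_le_one hc]
  nlinarith

theorem Q_err (τ : ℂ) (hτ : 0 < τ.re) (h3 : τ.im ^ 2 ≤ 3 * τ.re ^ 2) (hρ : 20 ≤ (1 / τ).re) :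
    ‖(2 * τ / Real.pi) ^ (1 / 2 : ℂ) * (τ * SerT τ) - aOne * ((8 * Real.pi * τ) ^ (1 / 2 : ℂ) * exp (-(2 / 25 * Real.pi ^ 2 / τ)))‖ ≤
      6 * Real.exp (-((1 / τ).re * (Real.pi ^ 2 / 8))) := by
  have hp := Real.pi_gt_three
  have hp4 := Real.pi_gt_d4
  have hτ0 : τ ≠ 0 := by rintro rfl; simp at hτ
  obtain ⟨i1, i2⟩ := SerT_integral τ hτ h3
  have htail := gM_tail τ hτ0 hρ
  have hGi := gM_int τ hτ0 (by linarith)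
  have hmain := gM_integral τ hτ0 (by linarith)
  rw [← intervalIntegral.integral_Iic_add_Ioi (b := (0:ℝ)) hGi.integrableOn hGi.integrableOn] at hmain
  rw [← hmain, ← i2, ← integral_const_mul]
  have hE := GK_err τ hτ h3 hρ
  set ρ := (1 / τ).re with hρd
  have hc : -(1 / 20 * Real.pi * ρ) < 0 := by have : 0 < 1 / 20 * Real.pi * ρ := by positivity
                                              linarith
  have hd : ‖(∫ η in Set.Ioi (0:ℝ), (2 * τ / Real.pi) ^ (1 / 2 : ℂ) * (thN τ η * KK τ η)) - ∫ η in Set.Ioi (0:ℝ), gM τ η‖ ≤ 5 * Real.exp (-(ρ * (Real.pi ^ 2 / 8))) := by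
    rw [← integral_sub (i1.const_mul _) hGi.integrableOn]
    refine (norm_integral_le_of_norm_le ((integrableOn_exp_mul_Ioi hc 0).const_mul (14 * Real.exp (-(ρ * (Real.pi ^ 2 / 8)))))
      ((ae_restrict_iff' measurableSet_Ioi).mpr (ae_of_all _ (fun η hη => ?_)))).trans ?_
    · rw [← mul_assoc]; exact hE η (le_of_lt hη)
    · rw [integral_const_mul, integral_exp_mul_Ioi hc, mul_zero, Real.exp_zero, neg_div_neg_eq, mul_right_comm]
      apply mul_le_mul_of_nonneg_right _ (Real.exp_pos _).le
      rw [mul_one_div, div_le_iff₀ (by positivity)]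
      nlinarith
  rw [add_comm, ← sub_sub]
  refine (norm_sub_le _ _).trans ?_
  linarith

end C2cs

section C2ds
open Complex MeasureTheory

/-- The main term on the major arc. -/
noncomputable def Mt (τ : ℂ) : ℂ :=
  aOne * (8 * Real.pi * τ) ^ (1 / 2 : ℂ) / (√2 * τ) * exp (9 / 200 * Real.pi ^ 2 / τ - τ / 8)

theorem half_sq (z : ℂ) : (z ^ (1 / 2 : ℂ)) ^ 2 = z := by
  have := cpow_nat_inv_pow z (n := 2) (by norm_num)
  rw [one_div]; exact_mod_cast this

theorem major (τ : ℂ) (hτ : 0 < τ.re) (h1 : ‖τ‖ ≤ 1) (h3 : τ.im ^ 2 ≤ 3 * τ.re ^ 2) (hρ : 20 ≤ (1 / τ).re) :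
    ‖SerT τ / psiT τ - Mt τ‖ ≤ 10 / ‖τ‖ := by
  have hp := Real.pi_gt_three
  have hp4 := Real.pi_lt_d4
  have hp2 := pi_sq_gt
  have hτ0 : τ ≠ 0 := by rintro rfl; simp at hτ
  have hpi : (Real.pi : ℂ) ≠ 0 := by exact_mod_cast Real.pi_ne_zero
  have hQ := Q_err τ hτ h3 hρ
  have hP := P_err τ hτ hρ
  have hpsi := psiT_ne_zero τ hτ
  set ρ := (1 / τ).re with hρd
  set W := (2 * τ / Real.pi) ^ (1 / 2 : ℂ) with hW
  have hW0 : W ≠ 0 := by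
    rw [hW, cpow_def_of_ne_zero (by simp [hτ0, hpi])]; exact exp_ne_zero _
  set S := (8 * Real.pi * τ) ^ (1 / 2 : ℂ) with hS
  have nS : ‖S‖ ≤ 6 := by
    have h : ‖S‖ ^ 2 = 8 * Real.pi * ‖τ‖ := by
      rw [← norm_pow, hS, half_sq, norm_mul, norm_mul, norm_real, Real.norm_eq_abs, abs_of_pos (by linarith)]; norm_num
    nlinarith [norm_nonneg S, norm_nonneg τ]
  set Q := W * (τ * SerT τ) with hQd
  set Q0 := aOne * (S * exp (-(2 / 25 * Real.pi ^ 2 / τ))) with hQ0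
  set P := W * psiT τ with hPd
  set P0 := √2 * exp (τ / 8 - Real.pi ^ 2 / (8 * τ)) with hP0
  have hs2 : (√2 : ℂ) ≠ 0 := by exact_mod_cast (Real.sqrt_pos.mpr (by norm_num : (0:ℝ) < 2)).ne'
  have hP00 : P0 ≠ 0 := mul_ne_zero hs2 (exp_ne_zero _)
  have hPne : P ≠ 0 := mul_ne_zero hW0 hpsi
  have eMt : Mt τ = Q0 / P0 / τ := by
    unfold Mt
    rw [hQ0, hP0, ← hS]
    have : exp (9 / 200 * Real.pi ^ 2 / τ - τ / 8) = exp (-(2 / 25 * Real.pi ^ 2 / τ)) / exp (τ / 8 - Real.pi ^ 2 / (8 * τ)) := by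
      rw [← exp_sub]; congr 1; field_simp; ring
    rw [this]
    have := exp_ne_zero (τ / 8 - Real.pi ^ 2 / (8 * τ))
    field_simp
  have eS : SerT τ / psiT τ = Q / P / τ := by
    rw [hQd, hPd]; field_simp
  rw [eMt, eS, ← sub_div, norm_div]
  apply div_le_div_of_nonneg_right _ (norm_nonneg τ)
  set t := τ.re with ht
  set ε := Real.exp (-(ρ * (Real.pi ^ 2 / 8))) with hε
  set δ := Real.exp (-(1 / 4 * Real.pi ^ 2 * ρ)) with hδ
  set u := Real.exp (t / 8) with hu
  have hu1 : 1 ≤ u := Real.one_le_exp (by linarith)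
  have hε0 : 0 < ε := Real.exp_pos _
  have hδ0 : 0 < δ := Real.exp_pos _
  have hδs : δ ≤ 1 / 6 := by
    have hx : 5 ≤ 1 / 4 * Real.pi ^ 2 * ρ := by nlinarith
    have := Real.add_one_le_exp (1 / 4 * Real.pi ^ 2 * ρ)
    rw [hδ, Real.exp_neg, one_div (6:ℝ)]
    exact inv_anti₀ (by norm_num) (show (6:ℝ) ≤ _ by linarith)
  have hPe : ‖P - P0‖ ≤ 2 * (u * ε * δ) := by
    rw [show u * ε = Real.exp (t / 8 - ρ * (Real.pi ^ 2 / 8)) by rw [hu, hε, ← Real.exp_add]; rfl]; exact hP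
  have hs : (1.4:ℝ) ≤ √2 := Real.le_sqrt_of_sq_le (by norm_num)
  have nP0 : ‖P0‖ = √2 * (u * ε) := by
    rw [hP0, norm_mul, norm_real, Real.norm_eq_abs, abs_of_nonneg (Real.sqrt_nonneg _), norm_exp, hu, hε, ← Real.exp_add]
    congr 2
    rw [show τ / 8 = ((1 / 8 : ℝ) : ℂ) * τ by push_cast; ring,
      show (Real.pi : ℂ) ^ 2 / (8 * τ) = ((Real.pi ^ 2 / 8 : ℝ) : ℂ) * (1 / τ) by push_cast; field_simp,
      sub_re, re_ofReal_mul, re_ofReal_mul, ← hρd, ← ht]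
    ring
  have hue : 0 < u * ε := by positivity
  have hP0l : u * ε ≤ ‖P0‖ := by rw [nP0]; nlinarith
  have hPl : u * ε ≤ ‖P‖ := by
    have h5 : ‖P0‖ - ‖P - P0‖ ≤ ‖P‖ := by
      have := norm_sub_norm_le P0 (P0 - P)
      rw [sub_sub_cancel, norm_sub_rev P0 P] at this; exact this
    have : 2 * (u * ε * δ) ≤ 2 * (u * ε * (1 / 6)) := by gcongr
    nlinarith
  have hPl2 : ε ≤ ‖P‖ := by nlinarith
  obtain ⟨o1, o2⟩ := aOne_bd
  have nQ0 : ‖Q0‖ ≤ Real.exp (-(2 / 25 * Real.pi ^ 2 * ρ)) := by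
    have hh : ‖exp (-(2 / 25 * Real.pi ^ 2 / τ))‖ = Real.exp (-(2 / 25 * Real.pi ^ 2 * ρ)) := by
      rw [norm_exp_neg, show (2 / 25 * (Real.pi:ℂ) ^ 2 / τ) = ((2 / 25 * Real.pi ^ 2 : ℝ) : ℂ) / τ by push_cast; rfl, re_ofReal_div]
    rw [hQ0, norm_mul, norm_mul, hh, norm_real, Real.norm_eq_abs, abs_of_nonneg (by linarith), ← mul_assoc]
    apply mul_le_of_le_one_left (Real.exp_pos _).le
    nlinarith [norm_nonneg S]
  have key : Q / P - Q0 / P0 = (Q - Q0) / P + Q0 * (P0 - P) / (P * P0) := by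
    field_simp; ring
  rw [key]
  refine (norm_add_le _ _).trans ?_
  have b1 : ‖(Q - Q0) / P‖ ≤ 6 := by
    rw [norm_div, div_le_iff₀ (by linarith)]
    linarith
  have b2 : ‖Q0 * (P0 - P) / (P * P0)‖ ≤ 2 := by
    rw [norm_div, norm_mul Q0, norm_mul P, norm_sub_rev P0 P, div_le_iff₀ (mul_pos (by linarith) (by linarith))]
    have c1 : Real.exp (-(2 / 25 * Real.pi ^ 2 * ρ)) * δ ≤ ε := by
      rw [hδ, hε, ← Real.exp_add]; apply Real.exp_le_exp.mpr; nlinarith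
    calc ‖Q0‖ * ‖P - P0‖ ≤ Real.exp (-(2 / 25 * Real.pi ^ 2 * ρ)) * (2 * (u * ε * δ)) := by gcongr
      _ = 2 * ((Real.exp (-(2 / 25 * Real.pi ^ 2 * ρ)) * δ) * (u * ε)) := by ring
      _ ≤ 2 * (‖P‖ * ‖P0‖) := by gcongr; exact c1.trans hPl2
  linarith

end C2ds

section C6as
open Complex MeasureTheory

theorem half_re_nonneg (w : ℂ) (hw : w ≠ 0) : 0 ≤ (w ^ (1 / 2 : ℂ)).re := by
  rw [cpow_def_of_ne_zero hw, exp_re]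
  apply mul_nonneg (Real.exp_pos _).le
  have : (log w * (1 / 2)).im = w.arg / 2 := by
    rw [show (1 / 2 : ℂ) = ((1 / 2 : ℝ) : ℂ) by push_cast; rfl, mul_comm, im_ofReal_mul, log_im]; ring
  rw [this]
  apply Real.cos_nonneg_of_mem_Icc
  constructor <;> linarith [neg_pi_lt_arg w, arg_le_pi w]

/-- normalised main integrand -/
noncomputable def FC (N y : ℝ) : ℂ := ((1 + y * I) ^ (1 / 2 : ℂ))⁻¹ * exp (-(N * y ^ 2 / (1 + y * I)))

theorem one_add_ne (y : ℝ) : (1 + y * I : ℂ) ≠ 0 := by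
  intro h
  have := congrArg Complex.re h
  simp at this

theorem z_parts (N y : ℝ) : (-(N * y ^ 2 / (1 + y * I)) : ℂ) =
    ((-(N * y ^ 2 / (1 + y ^ 2)) : ℝ) : ℂ) + ((N * y ^ 3 / (1 + y ^ 2) : ℝ) : ℂ) * I := by
  have h1 := one_add_ne y
  have h2 : (1 + (y:ℂ) ^ 2) ≠ 0 := by
    have : (1 + y ^ 2 : ℝ) ≠ 0 := by positivity
    exact_mod_cast this
  push_cast
  field_simp
  ring_nf
  rw [I_sq]; ring

theorem E_norm (N y : ℝ) : ‖exp (-(N * y ^ 2 / (1 + y * I)) : ℂ)‖ = Real.exp (-(N * y ^ 2 / (1 + y ^ 2))) := by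
  rw [z_parts, norm_exp, add_re, ofReal_re, mul_I_re, ofReal_im, neg_zero, add_zero]

theorem E_re (N y : ℝ) : (exp (-(N * y ^ 2 / (1 + y * I)) : ℂ)).re =
    Real.exp (-(N * y ^ 2 / (1 + y ^ 2))) * Real.cos (N * y ^ 3 / (1 + y ^ 2)) := by
  rw [z_parts, exp_re]
  congr 2
  · rw [add_re, ofReal_re, mul_I_re, ofReal_im, neg_zero, add_zero]
  · rw [add_im, ofReal_im, mul_I_im, ofReal_re, zero_add]

theorem v_bd (y : ℝ) : ‖((1 + y * I : ℂ) ^ (1 / 2 : ℂ))⁻¹‖ ≤ 1 ∧ ‖1 - ((1 + y * I : ℂ) ^ (1 / 2 : ℂ))⁻¹‖ ≤ |y| := by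
  have hw := one_add_ne y
  set w : ℂ := 1 + y * I with hwd
  have hre := half_re_nonneg w hw
  have hsq := half_sq w
  set u := w ^ (1 / 2 : ℂ) with hu
  have hu0 : u ≠ 0 := by intro h; rw [h] at hsq; simp at hsq; exact hw hsq.symm
  have hn1 : 1 ≤ ‖w‖ := by
    have := abs_re_le_norm w
    rw [hwd] at this ⊢; simpa using this
  have hnu : 1 ≤ ‖u‖ := by
    have : ‖u‖ ^ 2 = ‖w‖ := by rw [← norm_pow, hsq]
    nlinarith [norm_nonneg u]
  have hnu2 : 1 ≤ ‖u + 1‖ := by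
    have := re_le_norm (u + 1)
    rw [add_re, one_re] at this; linarith
  constructor
  · rw [norm_inv]; exact inv_le_one_of_one_le₀ hnu
  · have hu1 : u + 1 ≠ 0 := by intro h; rw [h] at hnu2; norm_num at hnu2
    have e : 1 - u⁻¹ = (y * I) / (u * (u + 1)) := by
      have : (y * I : ℂ) = u ^ 2 - 1 := by rw [hsq, hwd]; ring
      rw [this]; field_simp; ring
    rw [e, norm_div, norm_mul, norm_mul, norm_I, mul_one, norm_real, Real.norm_eq_abs]
    apply div_le_self (abs_nonneg _)
    nlinarith

theorem FC_lower (N y : ℝ) (hN : 0 ≤ N) :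
    Real.exp (-(N * y ^ 2 / (1 + y ^ 2))) * (1 - (N * |y| ^ 3) ^ 2 / 2 - |y|) ≤ (FC N y).re := by
  obtain ⟨-, v2⟩ := v_bd y
  unfold FC
  have hn := E_norm N y
  have hr := E_re N y
  set E := exp (-(N * y ^ 2 / (1 + y * I)) : ℂ) with hE
  set v := ((1 + y * I : ℂ) ^ (1 / 2 : ℂ))⁻¹ with hv
  set W := Real.exp (-(N * y ^ 2 / (1 + y ^ 2))) with hW
  have e : v * E = E - (1 - v) * E := by ring
  rw [e, sub_re, hr]
  have h1 : ((1 - v) * E).re ≤ |y| * W := by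
    refine (re_le_norm _).trans ?_
    rw [norm_mul, hn]
    exact mul_le_mul_of_nonneg_right v2 (Real.exp_pos _).le
  have h2 := Real.one_sub_sq_div_two_le_cos (x := N * y ^ 3 / (1 + y ^ 2))
  have h3 : (N * y ^ 3 / (1 + y ^ 2)) ^ 2 ≤ (N * |y| ^ 3) ^ 2 := by
    apply sq_le_sq'
    · rw [neg_le, ← neg_div, div_le_iff₀ (by positivity)]
      have : -(N * y ^ 3) ≤ N * |y| ^ 3 := by
        rw [← abs_pow, ← mul_neg]; exact mul_le_mul_of_nonneg_left (neg_le_abs _) hN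
      nlinarith [mul_nonneg (mul_nonneg hN (pow_nonneg (abs_nonneg y) 3)) (sq_nonneg y)]
    · rw [div_le_iff₀ (by positivity)]
      have : (N * y ^ 3) ≤ N * |y| ^ 3 := by
        rw [← abs_pow]; exact mul_le_mul_of_nonneg_left (le_abs_self _) hN
      nlinarith [mul_nonneg (mul_nonneg hN (pow_nonneg (abs_nonneg y) 3)) (sq_nonneg y)]
  have hW0 : 0 < W := Real.exp_pos _
  have h4 : W * (1 - (N * |y| ^ 3) ^ 2 / 2) ≤ W * Real.cos (N * y ^ 3 / (1 + y ^ 2)) :=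
    mul_le_mul_of_nonneg_left (by linarith) hW0.le
  linarith

theorem FC_large (R y : ℝ) (hy : y ^ 2 ≤ 3) : - Real.exp (-((y * R) ^ 2 / 4)) ≤ (FC (R ^ 2) y).re := by
  obtain ⟨v1, -⟩ := v_bd y
  have hn := E_norm (R ^ 2) y
  have h : ‖FC (R ^ 2) y‖ ≤ Real.exp (-((y * R) ^ 2 / 4)) := by
    unfold FC
    rw [norm_mul, hn]
    refine (mul_le_of_le_one_left (Real.exp_pos _).le v1).trans (Real.exp_le_exp.mpr ?_)
    rw [neg_le_neg_iff, mul_pow, mul_comm (y ^ 2)]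
    apply div_le_div_of_nonneg_left (by positivity) (by positivity) (by linarith)
  have := abs_re_le_norm (FC (R ^ 2) y)
  linarith [neg_abs_le (FC (R ^ 2) y).re]

theorem FC_small (R y : ℝ) (hR : 9.2 ≤ R) (hy : |y| * R ≤ 1) : 0.88 * (1 - (y * R) ^ 2) ≤ (FC (R ^ 2) y).re := by
  refine le_trans ?_ (FC_lower (R ^ 2) y (by positivity))
  have hy0 := abs_nonneg y
  set u := |y| * R with hu
  have hu0 : 0 ≤ u := by positivity
  have hyb : |y| ≤ 0.109 := by nlinarith
  have h1 : (R ^ 2 * |y| ^ 3) ≤ 0.109 := by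
    have : R ^ 2 * |y| ^ 3 = u ^ 2 * |y| := by rw [hu]; ring
    rw [this]
    have : u ^ 2 ≤ 1 := by nlinarith
    nlinarith
  have h0 : 0 ≤ R ^ 2 * |y| ^ 3 := by positivity
  have hb : (0.88:ℝ) ≤ 1 - (R ^ 2 * |y| ^ 3) ^ 2 / 2 - |y| := by nlinarith
  have hE : 1 - (y * R) ^ 2 ≤ Real.exp (-(R ^ 2 * y ^ 2 / (1 + y ^ 2))) := by
    have h5 := Real.add_one_le_exp (-(R ^ 2 * y ^ 2 / (1 + y ^ 2)))
    have h6 : R ^ 2 * y ^ 2 / (1 + y ^ 2) ≤ R ^ 2 * y ^ 2 := div_le_self (by positivity) (by nlinarith [sq_nonneg y])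
    nlinarith
  have h7 : 0 ≤ 1 - (y * R) ^ 2 := by
    have : (y * R) ^ 2 = u ^ 2 := by rw [hu, mul_pow, mul_pow, sq_abs]
    rw [this]; nlinarith
  rw [mul_comm]
  exact mul_le_mul hE hb (by norm_num) (Real.exp_pos _).le

theorem FC_mid (R y : ℝ) (hR : 9.2 ≤ R) (hy : |y| * R ≤ 2) : 0 ≤ (FC (R ^ 2) y).re := by
  refine le_trans ?_ (FC_lower (R ^ 2) y (by positivity))
  have hy0 := abs_nonneg y
  set u := |y| * R with hu
  have hu0 : 0 ≤ u := by positivity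
  have hyb : |y| ≤ 0.218 := by nlinarith
  have h1 : (R ^ 2 * |y| ^ 3) ≤ 0.872 := by
    have : R ^ 2 * |y| ^ 3 = u ^ 2 * |y| := by rw [hu]; ring
    rw [this]
    have : u ^ 2 ≤ 4 := by nlinarith
    nlinarith
  have h0 : 0 ≤ R ^ 2 * |y| ^ 3 := by positivity
  have hb : (0:ℝ) ≤ 1 - (R ^ 2 * |y| ^ 3) ^ 2 / 2 - |y| := by nlinarith
  exact mul_nonneg (Real.exp_pos _).le hb

theorem int_lower (F : ℝ → ℝ) (hF : Continuous F) (s b : ℝ) (hs : 0 < s) (hb : 2 * s ≤ b)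
    (h1 : ∀ θ, 0 ≤ θ → θ ≤ s → 0.88 * (1 - (θ / s) ^ 2) ≤ F θ) (h2 : ∀ θ, 0 ≤ θ → θ ≤ 2 * s → 0 ≤ F θ)
    (h3 : ∀ θ, 0 ≤ θ → θ ≤ b → - Real.exp (-((θ / s) ^ 2 / 4)) ≤ F θ) :
    0.2 * s ≤ ∫ θ in (0:ℝ)..b, F θ := by
  have hi : ∀ a c, IntervalIntegrable F volume a c := fun a c => hF.intervalIntegrable a c
  rw [← intervalIntegral.integral_add_adjacent_intervals (hi 0 s) (hi s b),
    ← intervalIntegral.integral_add_adjacent_intervals (hi s (2 * s)) (hi (2 * s) b)]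
  have p1 : 0.88 * (2 / 3) * s ≤ ∫ θ in (0:ℝ)..s, F θ := by
    have e : ∫ θ in (0:ℝ)..s, 0.88 * (1 - (θ / s) ^ 2) = 0.88 * (s - s / 3 * (s / s) ^ 3) - 0.88 * (0 - s / 3 * (0 / s) ^ 3) := by
      apply intervalIntegral.integral_eq_sub_of_hasDerivAt (f := fun θ => 0.88 * (θ - s / 3 * (θ / s) ^ 3))
      · intro θ _
        have h := (((hasDerivAt_id θ).sub ((((hasDerivAt_id θ).div_const s).pow 3).const_mul (s / 3))).const_mul (0.88:ℝ))
        refine h.congr_deriv ?_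
        simp only [id]
        push_cast
        field_simp
      · apply Continuous.intervalIntegrable; fun_prop
    rw [div_self hs.ne', zero_div] at e
    have h := intervalIntegral.integral_mono_on hs.le (by apply Continuous.intervalIntegrable; fun_prop) (hi 0 s)
      (fun θ hθ => h1 θ hθ.1 hθ.2)
    rw [e] at h
    refine le_trans (le_of_eq ?_) h
    ring
  have p2 : 0 ≤ ∫ θ in s..(2 * s), F θ :=
    intervalIntegral.integral_nonneg (by linarith) (fun θ hθ => h2 θ (by linarith [hθ.1]) hθ.2)
  have p3 : - (0.37 * s) ≤ ∫ θ in (2 * s)..b, F θ := by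
    have e : ∫ θ in (2 * s)..b, -(θ / (2 * s)) * Real.exp (-((θ / s) ^ 2 / 4)) = s * Real.exp (-((b / s) ^ 2 / 4)) - s * Real.exp (-((2 * s / s) ^ 2 / 4)) := by
      apply intervalIntegral.integral_eq_sub_of_hasDerivAt (f := fun θ => s * Real.exp (-((θ / s) ^ 2 / 4)))
      · intro θ _
        have h := ((((((hasDerivAt_id θ).div_const s).pow 2).div_const 4).neg).exp).const_mul s
        refine h.congr_deriv ?_
        have e1 : (-fun x : ℝ => ((fun x => id x / s) ^ 2) x / 4) θ = -((θ / s) ^ 2 / 4) := rfl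
        rw [e1]
        simp only [id]
        generalize Real.exp (-((θ / s) ^ 2 / 4)) = X
        push_cast
        field_simp
        norm_num
        ring
      · apply Continuous.intervalIntegrable; fun_prop
    have h := intervalIntegral.integral_mono_on hb (f := fun θ => -(θ / (2 * s)) * Real.exp (-((θ / s) ^ 2 / 4))) (by apply Continuous.intervalIntegrable; fun_prop) (hi (2 * s) b)
      (fun θ hθ => by
        refine le_trans ?_ (h3 θ (by linarith [hθ.1]) hθ.2)
        have : 1 ≤ θ / (2 * s) := by rw [le_div_iff₀ (by linarith)]; linarith [hθ.1]
        have := Real.exp_pos (-((θ / s) ^ 2 / 4))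
        nlinarith)
    rw [e] at h
    have he : Real.exp (-((2 * s / s) ^ 2 / 4)) ≤ 0.37 := by
      rw [mul_div_assoc, div_self hs.ne', show -(((2:ℝ) * 1) ^ 2 / 4) = -1 by norm_num]
      have := Real.exp_neg_one_lt_d9
      linarith
    have := Real.exp_pos (-((b / s) ^ 2 / 4))
    nlinarith
  linarith

end C6as

section C6bs
open Complex MeasureTheory

theorem fI_cont (n : ℕ) (t : ℝ) (ht : 0 < t) :
    Continuous (fun θ : ℝ => exp (n * (t + θ * I)) * (SerT (t + θ * I) / psiT (t + θ * I))) := by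
  have hre : ∀ θ : ℝ, ((t:ℂ) + θ * I).re = t := fun θ => by simp
  have e : ∀ θ : ℝ, SerT (t + θ * I) / psiT (t + θ * I) = SQ (exp (-(t + θ * I))) / psiQ (exp (-(t + θ * I))) := by
    intro θ
    rw [SQ_exp _ (by rw [hre]; exact ht), psiQ_exp _ (by rw [hre]; exact ht)]
  simp_rw [e]
  have hn : ∀ θ : ℝ, ‖exp (-((t:ℂ) + θ * I))‖ < 1 := fun θ => norm_exp_neg_lt _ (by rw [hre]; exact ht)
  obtain ⟨r, hr1, hr2⟩ := exists_between (show Real.exp (-t) < 1 by rw [Real.exp_lt_one_iff]; linarith)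
  have hr0 : 0 ≤ r := (Real.exp_pos _).le.trans hr1.le
  have hmem : ∀ θ : ℝ, exp (-((t:ℂ) + θ * I)) ∈ Metric.ball (0:ℂ) r := by
    intro θ
    rw [mem_ball_zero_iff, norm_exp_neg, hre]; exact hr1
  have hc : Continuous (fun θ : ℝ => exp (-((t:ℂ) + θ * I))) := by fun_prop
  have c1 : Continuous (fun θ : ℝ => SQ (exp (-((t:ℂ) + θ * I)))) := (SQ_diff r hr0 hr2).continuousOn.comp_continuous hc hmem
  have c2 : Continuous (fun θ : ℝ => psiQ (exp (-((t:ℂ) + θ * I)))) := (psiQ_diff r hr0 hr2).continuousOn.comp_continuous hc hmem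
  refine Continuous.mul (by fun_prop) (c1.div c2 (fun θ => psiQ_ne _ (hn θ)))

theorem FC_cont (N t : ℝ) : Continuous (fun θ : ℝ => FC N (θ / t)) := by
  unfold FC
  refine Continuous.mul (Continuous.inv₀ ?_ ?_) ?_
  · rw [continuous_iff_continuousAt]
    intro θ
    refine ContinuousAt.cpow (by fun_prop) (by fun_prop) ?_
    left; simp
  · intro θ h
    have := half_sq (1 + ((θ / t : ℝ) : ℂ) * I)
    rw [h] at this
    exact one_add_ne (θ / t) (by rw [← this]; simp)
  · refine continuous_exp.comp (Continuous.neg (Continuous.div (by fun_prop) (by fun_prop) (fun θ => one_add_ne (θ / t))))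

theorem half_ofReal_mul (r : ℝ) (hr : 0 < r) (w : ℂ) (hw : w ≠ 0) :
    ((r:ℂ) * w) ^ (1 / 2 : ℂ) = (√r : ℝ) * w ^ (1 / 2 : ℂ) := by
  have hr' : (r:ℂ) ≠ 0 := by exact_mod_cast hr.ne'
  rw [cpow_def_of_ne_zero (mul_ne_zero hr' hw), cpow_def_of_ne_zero hw, log_ofReal_mul hr hw, add_mul, exp_add]
  congr 1
  rw [show (Real.log r : ℂ) * (1 / 2) = ((Real.log r * (1 / 2) : ℝ) : ℂ) by push_cast; rfl, ← ofReal_exp,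
    Real.sqrt_eq_rpow, Real.rpow_def_of_pos hr]

theorem main_eq (n : ℕ) (t θ : ℝ) (ht : 0 < t) (hn : (n:ℝ) = 9 / 200 * Real.pi ^ 2 / t ^ 2 + 1 / 8) :
    exp (n * (t + θ * I)) * Mt (t + θ * I) =
      ((aOne * (√(8 * Real.pi * t) / (√2 * t)) * Real.exp (2 * (9 / 200 * Real.pi ^ 2 / t)) : ℝ) : ℂ) *
        FC (9 / 200 * Real.pi ^ 2 / t) (θ / t) := by
  have hp := Real.pi_pos
  have ht' : (t:ℂ) ≠ 0 := by exact_mod_cast ht.ne'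
  have hs2 : (√2 : ℂ) ≠ 0 := by exact_mod_cast (Real.sqrt_pos.mpr (by norm_num : (0:ℝ) < 2)).ne'
  have hw := one_add_ne (θ / t)
  have hn' : (n:ℂ) = 9 / 200 * Real.pi ^ 2 / t ^ 2 + 1 / 8 := by
    rw [show (n:ℂ) = ((n:ℝ):ℂ) by push_cast; rfl, hn]; push_cast; rfl
  unfold Mt FC
  have hsq := half_sq (1 + ((θ / t : ℝ) : ℂ) * I)
  set y := θ / t with hy
  have hθ : θ = t * y := by rw [hy]; field_simp
  have hτ : (t:ℂ) + θ * I = t * (1 + y * I) := by rw [hθ]; push_cast; ring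
  have h8 : 8 * Real.pi * ((t:ℂ) + θ * I) = ((8 * Real.pi * t : ℝ) : ℂ) * (1 + y * I) := by rw [hτ]; push_cast; ring
  rw [h8, half_ofReal_mul _ (by positivity) _ hw, hτ]
  set u := (1 + (y:ℂ) * I) ^ (1 / 2 : ℂ) with hu
  have hu0 : u ≠ 0 := by intro h; rw [h] at hsq; simp at hsq; exact hw hsq.symm
  have hE : exp (n * (t * (1 + y * I))) * exp (9 / 200 * Real.pi ^ 2 / (t * (1 + y * I)) - t * (1 + y * I) / 8)
      = exp (2 * (9 / 200 * Real.pi ^ 2 / t)) * exp (-(((9 / 200 * Real.pi ^ 2 / t : ℝ) : ℂ) * (y:ℂ) ^ 2 / (1 + y * I))) := by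
    rw [← exp_add, ← exp_add, hn']
    congr 1
    have hyy : (y:ℂ) ^ 2 = - (((1 + (y:ℂ) * I) - 1) ^ 2) := by
      rw [add_sub_cancel_left, mul_pow, I_sq]; ring
    rw [hyy]
    generalize (1 + (y:ℂ) * I) = w at *
    push_cast
    field_simp
    ring
  push_cast at hE ⊢
  calc _ = (aOne * (√(8 * Real.pi * t) * u) / (√2 * (t * (1 + y * I)))) *
      (exp (n * (t * (1 + y * I))) * exp (9 / 200 * Real.pi ^ 2 / (t * (1 + y * I)) - t * (1 + y * I) / 8)) := by ring
    _ = _ := by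
      rw [hE, ← hsq]
      field_simp

theorem Ks (t R : ℝ) (ht : 0 < t) (hR : 0 < R) (hR2 : R ^ 2 = 9 / 200 * Real.pi ^ 2 / t) :
    5 * t ≤ √(8 * Real.pi * t) / (√2 * t) * (t / R) := by
  have hp := Real.pi_pos
  have hp4 := Real.pi_lt_d4
  refine (sq_le_sq₀ (by positivity) (by positivity)).mp ?_
  rw [mul_pow, mul_pow, div_pow, div_pow, mul_pow (√2), Real.sq_sqrt (by positivity), Real.sq_sqrt (by norm_num), hR2]
  have : 8 * Real.pi * t / (2 * t ^ 2) * (t ^ 2 / (9 / 200 * Real.pi ^ 2 / t)) = 800 / (9 * Real.pi) * t ^ 2 := by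
    field_simp; norm_num
  rw [this]
  apply mul_le_mul_of_nonneg_right _ (sq_nonneg t)
  rw [le_div_iff₀ (by positivity)]
  linarith

theorem FC_int (t R : ℝ) (ht : 0 < t) (hR : 9.2 ≤ R) :
    0.4 * (t / R) ≤ (∫ θ in (-(√3 * t))..(√3 * t), FC (R ^ 2) (θ / t)).re := by
  have hs3 : 1 ≤ √3 := Real.le_sqrt_of_sq_le (by norm_num)
  have hs3' : √3 ^ 2 = 3 := Real.sq_sqrt (by norm_num)
  have hc := FC_cont (R ^ 2) t
  have hcr : Continuous (fun θ : ℝ => (FC (R ^ 2) (θ / t)).re) := continuous_re.comp hc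
  have e : (∫ θ in (-(√3 * t))..(√3 * t), FC (R ^ 2) (θ / t)).re = ∫ θ in (-(√3 * t))..(√3 * t), (FC (R ^ 2) (θ / t)).re :=
    (reCLM.intervalIntegral_comp_comm (hc.intervalIntegrable _ _)).symm
  rw [e, ← intervalIntegral.integral_add_adjacent_intervals (hcr.intervalIntegrable _ 0) (hcr.intervalIntegrable 0 _)]
  have hR0 : 0 < R := by linarith
  have hs : 0 < t / R := by positivity
  have hb : 2 * (t / R) ≤ √3 * t := by
    have h5 : t / R ≤ t / 2 := div_le_div_of_nonneg_left ht.le (by norm_num) (by linarith)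
    have := mul_le_mul_of_nonneg_right hs3 ht.le
    linarith
  have hq : ∀ θ : ℝ, θ / (t / R) = θ / t * R := fun θ => by field_simp
  have habs : ∀ θ : ℝ, 0 ≤ θ → |θ / t| = θ / t := fun θ h => abs_of_nonneg (by positivity)
  have hle : ∀ c θ : ℝ, θ ≤ c * (t / R) → θ / t * R ≤ c := by
    intro c θ h
    rw [← hq, div_le_iff₀ hs]; exact h
  have hy3 : ∀ θ : ℝ, 0 ≤ θ → θ ≤ √3 * t → (θ / t) ^ 2 ≤ 3 := by
    intro θ h0 h
    rw [← hs3']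
    apply pow_le_pow_left₀ (by positivity)
    rw [div_le_iff₀ ht]; exact h
  have r1 := int_lower (fun θ => (FC (R ^ 2) (θ / t)).re) hcr (t / R) (√3 * t) hs hb
    (fun θ h0 h => by
      rw [hq]
      exact FC_small R (θ / t) hR (by rw [habs θ h0]; exact hle 1 θ (by linarith)))
    (fun θ h0 h => FC_mid R (θ / t) hR (by rw [habs θ h0]; exact hle 2 θ h))
    (fun θ h0 h => by rw [hq]; exact FC_large R (θ / t) (hy3 θ h0 h))
  have r2 := int_lower (fun θ => (FC (R ^ 2) (-θ / t)).re) (hcr.comp continuous_neg) (t / R) (√3 * t) hs hb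
    (fun θ h0 h => by
      have := FC_small R (-θ / t) hR (by rw [neg_div, abs_neg, habs θ h0]; exact hle 1 θ (by linarith))
      rw [hq]
      rwa [show (-θ / t * R) ^ 2 = (θ / t * R) ^ 2 by ring] at this)
    (fun θ h0 h => FC_mid R (-θ / t) hR (by rw [neg_div, abs_neg, habs θ h0]; exact hle 2 θ h))
    (fun θ h0 h => by
      have := FC_large R (-θ / t) (by rw [neg_div, neg_sq]; exact hy3 θ h0 h)
      rw [hq]
      rwa [show (-θ / t * R) ^ 2 = (θ / t * R) ^ 2 by ring] at this)
  have e2 := intervalIntegral.integral_comp_neg (a := 0) (b := √3 * t) (fun θ => (FC (R ^ 2) (θ / t)).re)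
  rw [neg_zero] at e2
  rw [← e2]
  linarith

end C6bs

section C6cs
open Complex MeasureTheory

theorem exp_cube (x : ℝ) (hx : 192 ≤ x) : 5000 * x ^ 3 ≤ Real.exp (0.1347 * x) := by
  have e1 : Real.exp (0.1347 * x) = Real.exp (0.1347 * 192) * Real.exp (0.0449 * (x - 192)) ^ 3 := by
    rw [← Real.exp_nat_mul, ← Real.exp_add]; congr 1; push_cast; ring
  have h1 : x / 192 ≤ Real.exp (0.0449 * (x - 192)) := by
    have := Real.add_one_le_exp (0.0449 * (x - 192))
    linarith
  have h2 : (x / 192) ^ 3 ≤ Real.exp (0.0449 * (x - 192)) ^ 3 := pow_le_pow_left₀ (by positivity) h1 3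
  have h3 : (5000 * 192 ^ 3 : ℝ) ≤ Real.exp (0.1347 * 192) := by
    have h4 : Real.exp 25 ≤ Real.exp (0.1347 * 192) := Real.exp_le_exp.mpr (by norm_num)
    have h5 : Real.exp 25 = Real.exp 1 ^ 25 := by rw [← Real.exp_nat_mul]; norm_num
    have h6 : (2.71:ℝ) ^ 25 ≤ Real.exp 1 ^ 25 := pow_le_pow_left₀ (by norm_num) (by linarith [Real.exp_one_gt_d9]) 25
    have h7 : (5000 * 192 ^ 3 : ℝ) ≤ 2.71 ^ 25 := by norm_num
    linarith
  rw [e1]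
  calc 5000 * x ^ 3 = (5000 * 192 ^ 3) * (x / 192) ^ 3 := by ring
    _ ≤ _ := by gcongr

theorem final_num (t A : ℝ) (ht : 0 < t) (ht2 : t ≤ 1 / 192) (hA : A = 9 / 200 * Real.pi ^ 2) :
    Real.exp (A / t + t / 8) * (35 + 2 * Real.pi * ((1 + 2 / (1 - Real.exp (-t)) ^ 2) / (42 / 100 * Real.exp (-(Real.pi ^ 2 / (32 * t))))))
      < 0.17 * t * Real.exp (2 * (A / t)) := by
  have hp := Real.pi_pos
  have hp4 := Real.pi_lt_d4
  have hp2 := pi_sq_gt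
  set x := 1 / t with hx
  have hxt : x * t = 1 := by rw [hx]; field_simp
  have hx192 : 192 ≤ x := by rw [hx, le_div_iff₀ ht]; linarith
  have hx0 : 0 < x := by linarith
  have hS : 1 + 2 / (1 - Real.exp (-t)) ^ 2 ≤ 2.1 * x ^ 2 := by
    have h1 : Real.exp (-t) ≤ 1 / (1 + t) := by
      rw [Real.exp_neg, ← one_div]
      apply one_div_le_one_div_of_le (by linarith)
      linarith [Real.add_one_le_exp t]
    have h2 : 1 / (x + 1) ≤ 1 - Real.exp (-t) := by
      have : 1 / (x + 1) = 1 - 1 / (1 + t) := by rw [hx]; field_simp; ring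
      linarith
    have h3 : 2 / (1 - Real.exp (-t)) ^ 2 ≤ 2 / (1 / (x + 1)) ^ 2 := by gcongr
    have h4 : 2 / (1 / (x + 1)) ^ 2 = 2 * (x + 1) ^ 2 := by field_simp
    nlinarith
  set L := Real.exp (Real.pi ^ 2 / 32 * x) with hL
  have hL1 : 1 ≤ L := Real.one_le_exp (by positivity)
  have hmin : (1 + 2 / (1 - Real.exp (-t)) ^ 2) / (42 / 100 * Real.exp (-(Real.pi ^ 2 / (32 * t)))) ≤ 5 * x ^ 2 * L := by
    have e : Real.exp (-(Real.pi ^ 2 / (32 * t))) * L = 1 := by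
      rw [hL, ← Real.exp_add, hx, Real.exp_eq_one_iff]; field_simp; ring
    rw [div_le_iff₀ (by positivity)]
    calc _ ≤ 2.1 * x ^ 2 := hS
      _ = 5 * x ^ 2 * (42 / 100) * (Real.exp (-(Real.pi ^ 2 / (32 * t))) * L) := by rw [e]; ring
      _ = _ := by ring
  have hu : Real.exp (t / 8) ≤ 2 := by
    have h1 : Real.exp (t / 8) ≤ Real.exp (1 / 2) := Real.exp_le_exp.mpr (by linarith)
    have h2 : Real.exp (1 / 2) ^ 2 = Real.exp 1 := by rw [← Real.exp_nat_mul]; norm_num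
    nlinarith [Real.exp_one_lt_d9, Real.exp_pos (1 / 2)]
  have hN : L * Real.exp (0.1347 * x) ≤ Real.exp (A / t) := by
    rw [hL, ← Real.exp_add]
    apply Real.exp_le_exp.mpr
    have : A / t = A * x := by rw [hx]; ring
    rw [this, hA]
    nlinarith
  have hc := exp_cube x hx192
  have hE0 := Real.exp_pos (A / t)
  have h2N : Real.exp (2 * (A / t)) = Real.exp (A / t) * Real.exp (A / t) := by rw [← Real.exp_add]; congr 1; ring
  rw [Real.exp_add, h2N]
  have hbig : 850 * x ^ 2 * L ≤ 0.17 * t * Real.exp (A / t) := by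
    calc 850 * x ^ 2 * L = 0.17 * (L * (5000 * x ^ 3)) * t := by
          have : x ^ 3 * t = x ^ 2 := by rw [show x ^ 3 * t = x ^ 2 * (x * t) by ring, hxt, mul_one]
          rw [show 0.17 * (L * (5000 * x ^ 3)) * t = 850 * L * (x ^ 3 * t) by ring, this]; ring
      _ ≤ 0.17 * (L * Real.exp (0.1347 * x)) * t := by gcongr
      _ ≤ 0.17 * Real.exp (A / t) * t := by gcongr
      _ = _ := by ring
  have hx2L : 1 ≤ x ^ 2 * L := by
    have : 1 ≤ x ^ 2 := by nlinarith
    nlinarith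
  have hsmall : 35 + 2 * Real.pi * ((1 + 2 / (1 - Real.exp (-t)) ^ 2) / (42 / 100 * Real.exp (-(Real.pi ^ 2 / (32 * t))))) ≤ 70 * (x ^ 2 * L) := by
    have h1 : 2 * Real.pi * ((1 + 2 / (1 - Real.exp (-t)) ^ 2) / (42 / 100 * Real.exp (-(Real.pi ^ 2 / (32 * t))))) ≤ 2 * Real.pi * (5 * x ^ 2 * L) := by
      gcongr
    nlinarith
  have hpos : 0 ≤ 35 + 2 * Real.pi * ((1 + 2 / (1 - Real.exp (-t)) ^ 2) / (42 / 100 * Real.exp (-(Real.pi ^ 2 / (32 * t))))) := by positivity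
  calc _ ≤ Real.exp (A / t) * 2 * (70 * (x ^ 2 * L)) := by gcongr
    _ < Real.exp (A / t) * (850 * x ^ 2 * L) := by nlinarith [mul_pos hE0 (show 0 < x ^ 2 * L by linarith)]
    _ ≤ Real.exp (A / t) * (0.17 * t * Real.exp (A / t)) := by gcongr
    _ = _ := by ring

set_option maxHeartbeats 1000000 in
theorem Dn_pos_core (n : ℕ) (t : ℝ) (ht : 0 < t) (ht2 : t ≤ 1 / 192) (hn : (n:ℝ) = 9 / 200 * Real.pi ^ 2 / t ^ 2 + 1 / 8) :
    0 < Dn n := by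
  have hp := Real.pi_pos
  have hp3 := Real.pi_gt_three
  have hp4 := Real.pi_lt_d4
  have hp2 := pi_sq_gt
  have hs3 : 1 ≤ √3 := Real.le_sqrt_of_sq_le (by norm_num)
  have hs3' : √3 ^ 2 = 3 := Real.sq_sqrt (by norm_num)
  have hs3u : √3 ≤ 1.75 := Real.sqrt_le_iff.mpr ⟨by norm_num, by norm_num⟩
  obtain ⟨o1, o2⟩ := aOne_bd
  set A := 9 / 200 * Real.pi ^ 2 with hA
  set R := √(A / t) with hRd
  have hR2 : R ^ 2 = A / t := Real.sq_sqrt (by positivity)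
  have hR : 9.2 ≤ R := by
    apply Real.le_sqrt_of_sq_le
    rw [le_div_iff₀ ht, hA]
    nlinarith
  set b := √3 * t with hb
  have hb0 : 0 < b := by positivity
  have hbpi : b ≤ Real.pi := by rw [hb]; nlinarith
  have hI := Dn_integral n t ht
  have hcont := fI_cont n t ht
  set f : ℝ → ℂ := fun θ => exp (n * (t + θ * I)) * (SerT (t + θ * I) / psiT (t + θ * I)) with hf
  set C : ℝ := aOne * (√(8 * Real.pi * t) / (√2 * t)) * Real.exp (2 * (A / t)) with hC
  have hFC := FC_cont (A / t) t
  have hnt : n * t = A / t + t / 8 := by rw [hn]; field_simp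
  have hre : ∀ θ : ℝ, ((t:ℂ) + θ * I).re = t := fun θ => by simp
  have him : ∀ θ : ℝ, ((t:ℂ) + θ * I).im = θ := fun θ => by simp
  have hen : ∀ θ : ℝ, ‖exp (n * (t + θ * I))‖ = Real.exp (A / t + t / 8) := by
    intro θ
    rw [norm_exp, ← hnt]; congr 1; simp
  set En := Real.exp (A / t + t / 8) with hEn
  -- minor arcs
  set Em := (1 + 2 / (1 - Real.exp (-t)) ^ 2) / (42 / 100 * Real.exp (-(Real.pi ^ 2 / (32 * t)))) with hEm
  have hEm0 : 0 ≤ Em := by positivity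
  have hmin : ∀ θ : ℝ, |θ| ≤ Real.pi → b ≤ |θ| → ‖f θ‖ ≤ En * Em := by
    intro θ h1 h2
    have h3 : 3 * t ^ 2 ≤ θ ^ 2 := by
      rw [← sq_abs θ, ← hs3', ← mul_pow]; exact pow_le_pow_left₀ hb0.le h2 2
    have m1 := psiT_minor (t + θ * I) (by rw [hre]; exact ht) (by rw [hre]; linarith) (by rw [him]; exact h1) (by rw [hre, him]; exact h3)
    have m2 := ST_bound (t + θ * I) (by rw [hre]; exact ht)
    rw [hre] at m1 m2
    rw [hf]
    simp only []
    rw [norm_mul, hen, norm_div]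
    apply mul_le_mul_of_nonneg_left _ (Real.exp_pos _).le
    exact div_le_div₀ (by positivity) m2 (by positivity) m1
  have i1 : ‖∫ θ in (-Real.pi)..(-b), f θ‖ ≤ En * Em * Real.pi := by
    refine (intervalIntegral.norm_integral_le_of_norm_le_const (C := En * Em) ?_).trans ?_
    · intro θ hθ
      rw [Set.uIoc_of_le (by linarith)] at hθ
      have : |θ| = -θ := abs_of_nonpos (by linarith [hθ.2])
      exact hmin θ (by rw [this]; linarith [hθ.1]) (by rw [this]; linarith [hθ.2])
    · apply mul_le_mul_of_nonneg_left _ (by positivity)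
      rw [abs_of_nonneg (by linarith)]; linarith
  have i3 : ‖∫ θ in b..Real.pi, f θ‖ ≤ En * Em * Real.pi := by
    refine (intervalIntegral.norm_integral_le_of_norm_le_const (C := En * Em) ?_).trans ?_
    · intro θ hθ
      rw [Set.uIoc_of_le (by linarith)] at hθ
      have : |θ| = θ := abs_of_nonneg (by linarith [hθ.1])
      exact hmin θ (by rw [this]; linarith [hθ.2]) (by rw [this]; linarith [hθ.1])
    · apply mul_le_mul_of_nonneg_left _ (by positivity)
      rw [abs_of_nonneg (by linarith)]; linarith
  -- major arc
  have hmaj : ∀ θ : ℝ, |θ| ≤ b → ‖f θ - C * FC (A / t) (θ / t)‖ ≤ En * (10 / t) := by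
    intro θ h1
    have h3 : θ ^ 2 ≤ 3 * t ^ 2 := by
      rw [← sq_abs θ, ← hs3', ← mul_pow]; exact pow_le_pow_left₀ (abs_nonneg _) h1 2
    have hnorm : ‖(t:ℂ) + θ * I‖ ^ 2 = t ^ 2 + θ ^ 2 := by
      rw [← normSq_eq_norm_sq, normSq_apply, hre, him]; ring
    have hge : t ≤ ‖(t:ℂ) + θ * I‖ := by
      have := re_le_norm ((t:ℂ) + θ * I); rwa [hre] at this
    have hρ : 20 ≤ (1 / ((t:ℂ) + θ * I)).re := by
      rw [one_div, inv_re, normSq_eq_norm_sq, hre, hnorm, le_div_iff₀ (by positivity)]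
      nlinarith
    have hm := major (t + θ * I) (by rw [hre]; exact ht) (by nlinarith [norm_nonneg ((t:ℂ) + θ * I)]) (by rw [hre, him]; exact h3) hρ
    rw [← main_eq n t θ ht hn, hf]
    simp only []
    rw [← mul_sub, norm_mul, hen]
    apply mul_le_mul_of_nonneg_left _ (Real.exp_pos _).le
    exact hm.trans (div_le_div_of_nonneg_left (by norm_num) ht hge)
  have i2 : ‖(∫ θ in (-b)..b, f θ) - C * ∫ θ in (-b)..b, FC (A / t) (θ / t)‖ ≤ En * 35 := by
    rw [← intervalIntegral.integral_const_mul, ← intervalIntegral.integral_sub (hcont.intervalIntegrable _ _) ((hFC.const_mul _).intervalIntegrable _ _)]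
    refine (intervalIntegral.norm_integral_le_of_norm_le_const (C := En * (10 / t)) ?_).trans ?_
    · intro θ hθ
      rw [Set.uIoc_of_le (by linarith)] at hθ
      exact hmaj θ (abs_le.mpr ⟨by linarith [hθ.1], hθ.2⟩)
    · rw [mul_assoc]
      apply mul_le_mul_of_nonneg_left _ (Real.exp_pos _).le
      rw [abs_of_nonneg (by linarith), hb]
      have : 10 / t * (√3 * t - -(√3 * t)) = 20 * √3 := by field_simp; ring
      rw [this]; linarith
  have hF := FC_int t R ht hR
  rw [hR2, ← hb] at hF
  have hK := Ks t R ht (by linarith) hR2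
  have hmain : 0.17 * t * Real.exp (2 * (A / t)) ≤ C * (∫ θ in (-b)..b, FC (A / t) (θ / t)).re := by
    have hR0 : 0 < R := by linarith
    calc 0.17 * t * Real.exp (2 * (A / t)) = 0.085 * (5 * t) * 0.4 * Real.exp (2 * (A / t)) := by ring
      _ ≤ aOne * (√(8 * Real.pi * t) / (√2 * t) * (t / R)) * 0.4 * Real.exp (2 * (A / t)) := by gcongr
      _ = C * (0.4 * (t / R)) := by rw [hC]; ring
      _ ≤ _ := by
        apply mul_le_mul_of_nonneg_left hF
        rw [hC]; have : 0 ≤ aOne := by linarith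
        positivity
  have hfin := final_num t A ht ht2 hA
  rw [← hEn, ← hEm] at hfin
  -- combine
  rw [← intervalIntegral.integral_add_adjacent_intervals (hcont.intervalIntegrable (-Real.pi) (-b)) (hcont.intervalIntegrable (-b) Real.pi),
    ← intervalIntegral.integral_add_adjacent_intervals (hcont.intervalIntegrable (-b) b) (hcont.intervalIntegrable b Real.pi)] at hI
  set J1 := ∫ θ in (-Real.pi)..(-b), f θ
  set J2 := ∫ θ in (-b)..b, f θ
  set J3 := ∫ θ in b..Real.pi, f θ
  set JF := ∫ θ in (-b)..b, FC (A / t) (θ / t)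
  have hIr := congrArg Complex.re hI
  rw [add_re, add_re, show (2 * (Real.pi:ℂ) * (Dn n : ℂ)) = ((2 * Real.pi * (Dn n : ℝ) : ℝ) : ℂ) by push_cast; rfl, ofReal_re] at hIr
  have a1 := (abs_le.mp (abs_re_le_norm J1)).1
  have a3 := (abs_le.mp (abs_re_le_norm J3)).1
  have a2 := (abs_le.mp (abs_re_le_norm (J2 - C * JF))).1
  rw [sub_re, re_ofReal_mul] at a2
  have hpos : 0 < 2 * Real.pi * (Dn n : ℝ) := by
    rw [hIr]
    clear_value J1 J2 J3 JF En Em C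
    have hx : En * (35 + 2 * Real.pi * Em) = En * 35 + 2 * (En * Em * Real.pi) := by ring
    rw [hx] at hfin
    linarith only [i1, i2, i3, a1, a2, a3, hmain, hfin]
  have : 0 < (Dn n : ℝ) := (mul_pos_iff_of_pos_left (by positivity)).mp hpos
  exact_mod_cast this

theorem Dn_pos_large (n : ℕ) (h : 16384 ≤ n) : 0 < Dn n := by
  have hp := Real.pi_pos
  have hp4 := Real.pi_lt_d4
  have h' : (16384:ℝ) ≤ n := by exact_mod_cast h
  have hν : 0 < (n:ℝ) - 1 / 8 := by linarith
  have ht2 : √(9 / 200 * Real.pi ^ 2 / (n - 1 / 8)) ^ 2 = 9 / 200 * Real.pi ^ 2 / (n - 1 / 8) := Real.sq_sqrt (by positivity)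
  refine Dn_pos_core n (√(9 / 200 * Real.pi ^ 2 / (n - 1 / 8))) (Real.sqrt_pos.mpr (by positivity)) ?_ ?_
  · refine Real.sqrt_le_iff.mpr ⟨by norm_num, ?_⟩
    rw [div_le_iff₀ hν]
    nlinarith
  · rw [ht2]; field_simp; ring

end C6cs

theorem N2_mod10_second_inequality (n : ℕ) (hn : 7 ≤ n) :
    N2 0 10 n + N2 3 10 n > N2 2 10 n + N2 5 10 n := by
  have h : 0 < Dn n := by
    rcases lt_or_ge n 16384 with h | h
    · exact Dn_pos_small n hn h
    · exact Dn_pos_large n h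
  unfold Dn at h
  omega
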